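/- arXiv:1203.0922 — 3 statements merged into one kernel-verified Lean document; each statement's English description precedes it below -/
import Mathlib

section
/- Let t,n be positive integers, let P be a finite semipure poset of length n having a unique minimum element, and let λ_P : Cov(P̂) → L_P be an EL-labeling of P̂. Let λ be the EL-labeling of (P∗T_{t,n})^ obtained by applying the Rees-product EL-labeling construction to λ_P and the constant semi-EL-labeling of T_{t,n}, and identify (P∗T_{t,n})⁺ with the interval of (P∗T_{t,n})^ above the bottom element. For m ∈ ℕ and w ∈ L_P^{m+1}, let c(w) be the number of maximal chains of P⁺ of length m+1 with label sequence w (edges labeled by the restriction of λ_P, edges into the adjoined maximum of P⁺ labeled λ_P(x,1̂)). Then the number of ascent-free maximal chains of (P∗T_{t,n})⁺ of length m+1 equals the sum over all w ∈ L_P^{m+1} with no double ascent and w_m ≰ w_{m+1} of c(w)·t^{asc(w)}(1+t)^{m−2·asc(w)}, plus the sum over all w ∈ L_P^{m+1} with no double ascent and w_m ≤ w_{m+1} of c(w)·t^{asc(w)}(1+t)^{m+1−2·asc(w)}. -/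
attribute [local instance] Classical.propDecidable

section Prelude

variable {α : Type*} {L : Type*}

/-- The cover relation within the subposet on the subset `s`. -/
def CovIn [PartialOrder α] (s : Set α) (a b : α) : Prop :=
  a ∈ s ∧ b ∈ s ∧ a < b ∧ ∀ c ∈ s, ¬(a < c ∧ c < b)

/-- `l` is a maximal chain of the subposet of `α` on the subset `s`:
a nonempty saturated chain starting at a minimal element of `s` and
ending at a maximal element of `s`. -/
def IsMaxChainIn [PartialOrder α] (s : Set α) (l : List α) : Prop :=
  l ≠ [] ∧ (∀ x ∈ l, x ∈ s) ∧ l.Chain' (CovIn s) ∧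
    (∀ x, l.head? = some x → ∀ c ∈ s, ¬c < x) ∧
    (∀ x, l.getLast? = some x → ∀ c ∈ s, ¬x < c)

/-- `l` is a maximal chain of the poset `α`. -/
def IsMaximalChain [PartialOrder α] (l : List α) : Prop :=
  IsMaxChainIn Set.univ l

/-- The poset `α` has length `n`, i.e. its longest chains have `n + 1` elements. -/
def HasLength (α : Type*) [PartialOrder α] (n : ℕ) : Prop :=
  (∃ l : List α, l.Chain' (· < ·) ∧ l.length = n + 1) ∧
    ∀ l : List α, l.Chain' (· < ·) → l.length ≤ n + 1

/-- `r` is a rank function for the poset `α`; the existence of such a function says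
exactly that `α` is semipure with rank function `r` (for every `x`, every maximal chain
of the lower order ideal `P_{≤ x}` has length `r x`, i.e. `r x + 1` elements). -/
def IsRankFunction [PartialOrder α] (r : α → ℕ) : Prop :=
  ∀ x : α, ∀ l : List α, IsMaxChainIn (Set.Iic x) l → l.length = r x + 1

/-- The label sequence of a chain `l` under the edge labeling `lab`. -/
def labelSeq (lab : α → α → L) (l : List α) : List L :=
  List.zipWith lab l l.tail

/-- `l` is a maximal (i.e. saturated) chain of the closed interval `[x, y]`. -/
def IsMaxChainOfInterval [PartialOrder α] (x y : α) (l : List α) : Prop :=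
  l.Chain' (· ⋖ ·) ∧ l.head? = some x ∧ l.getLast? = some y

/-- The EL-condition for the interval `[x, y]`: there is a unique maximal chain of
`[x, y]` with weakly increasing labels, and its label sequence strictly lexicographically
precedes the label sequence of any other maximal chain of `[x, y]`. -/
def ELCondition [PartialOrder α] [PartialOrder L] (lab : α → α → L) (x y : α) : Prop :=
  ∃ c : List α, IsMaxChainOfInterval x y c ∧ (labelSeq lab c).Chain' (· ≤ ·) ∧
    (∀ d : List α, IsMaxChainOfInterval x y d → (labelSeq lab d).Chain' (· ≤ ·) → d = c) ∧
    ∀ d : List α, IsMaxChainOfInterval x y d → d ≠ c →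
      List.Lex (· < ·) (labelSeq lab c) (labelSeq lab d)

/-- `lab` is an EL-labeling of the poset `α`. -/
def IsELLabeling [PartialOrder α] [PartialOrder L] (lab : α → α → L) : Prop :=
  ∀ x y : α, x ≤ y → ELCondition lab x y

/-- `lab` is a semi-EL-labeling of the poset `α` with minimum element: its restriction to
`[⊥, m]` is an EL-labeling for every maximal element `m`. -/
def IsSemiELLabeling [PartialOrder α] [OrderBot α] [PartialOrder L] (lab : α → α → L) : Prop :=
  ∀ m : α, IsMax m → ∀ x y : α, x ≤ y → y ≤ m → ELCondition lab x y

/-- The underlying set of the Rees product of two (semipure) posets with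
rank functions `rP`, `rQ`. -/
def Rees {α β : Type*} [PartialOrder α] [PartialOrder β] (rP : α → ℕ) (rQ : β → ℕ) : Type _ :=
  {x : α × β // rQ x.2 ≤ rP x.1}

/-- The Rees product order: `(p₁,q₁) ≤ (p₂,q₂)` iff `p₁ ≤ p₂`, `q₁ ≤ q₂` and the rank
increase in the first coordinate is at least the rank increase in the second coordinate. -/
instance Rees.instPartialOrder {α β : Type*} [PartialOrder α] [PartialOrder β]
    (rP : α → ℕ) (rQ : β → ℕ) : PartialOrder (Rees rP rQ) where
  le x y := x.1.1 ≤ y.1.1 ∧ x.1.2 ≤ y.1.2 ∧ rQ y.1.2 + rP x.1.1 ≤ rP y.1.1 + rQ x.1.2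
  le_refl x := ⟨le_rfl, le_rfl, by omega⟩
  le_trans x y z h₁ h₂ := ⟨h₁.1.trans h₂.1, h₁.2.1.trans h₂.2.1, by
    have := h₁.2.2; have := h₂.2.2; omega⟩
  le_antisymm x y h₁ h₂ := Subtype.ext
    (Prod.ext (le_antisymm h₁.1 h₂.1) (le_antisymm h₁.2.1 h₂.2.1))

/-- First (`P₁`) component of an element of `(P₁ ∗ P₂)^`, as an element of `P̂₁`;
the adjoined minimum goes to `0̂₁` and the adjoined maximum to `1̂₁`. -/
def reesFst {α β : Type*} [PartialOrder α] [PartialOrder β] {rP : α → ℕ} {rQ : β → ℕ}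
    (a : WithBot (WithTop (Rees rP rQ))) : WithBot (WithTop α) :=
  WithBot.recBotCoe ⊥
    (fun b => WithTop.recTopCoe (⊤ : WithBot (WithTop α))
      (fun z => ((z.1.1 : WithTop α) : WithBot (WithTop α))) b) a

/-- Second (`P₂`) component of an element of `(P₁ ∗ P₂)^`; the adjoined minimum is
identified with `(0̂₁, 0̂₂)`, so its second component is `0̂₂ = ⊥`. -/
def reesSnd {α β : Type*} [PartialOrder α] [PartialOrder β] [OrderBot β]
    {rP : α → ℕ} {rQ : β → ℕ} (a : WithBot (WithTop (Rees rP rQ))) : β :=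
  WithBot.recBotCoe ⊥ (fun b => WithTop.recTopCoe (⊥ : β) (fun z => z.1.2) b) a

/-- The Rees-product edge labeling of `(P₁ ∗ P₂)^` by the poset `L₁ × (L₂ ⊎ {0̂_{L₂}})`
(the product order, a new minimum `⊥` adjoined to `L₂`): a cover `((x,k),(y,l))` is
labeled `(λ₁(x,y), λ₂(k,l))` if `k < l`, and `(λ₁(x,y), 0̂_{L₂})` if `k = l`; a cover
`((x,k), 1̂)` of the top is labeled `(λ₁(x,1̂₁), 0̂_{L₂})`. -/
noncomputable def reesLab {α β L₁ L₂ : Type*} [PartialOrder α] [PartialOrder β] [OrderBot β]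
    [PartialOrder L₂] (rP : α → ℕ) (rQ : β → ℕ)
    (lab₁ : WithBot (WithTop α) → WithBot (WithTop α) → L₁) (lab₂ : β → β → L₂)
    (a b : WithBot (WithTop (Rees rP rQ))) : L₁ × WithBot L₂ :=
  (lab₁ (reesFst a) (reesFst b),
    if reesSnd a < reesSnd b then ((lab₂ (reesSnd a) (reesSnd b) : L₂) : WithBot L₂) else ⊥)

end Prelude

section Words

/-- `T_{t,n}`: the poset of sequences over `[t]` of length at most `n`,
ordered by the prefix order (a complete `t`-ary tree of height `n`, rooted at bottom). -/
def Ttn (t n : ℕ) : Type := {l : List (Fin t) // l.length ≤ n}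

instance (t n : ℕ) : PartialOrder (Ttn t n) where
  le x y := x.1 <+: y.1
  le_refl x := List.prefix_refl x.1
  le_trans _ _ _ h₁ h₂ := List.IsPrefix.trans h₁ h₂
  le_antisymm _ _ h₁ h₂ := Subtype.ext (List.IsPrefix.eq_of_length h₁
    (le_antisymm (List.IsPrefix.length_le h₁) (List.IsPrefix.length_le h₂)))

instance (t n : ℕ) : OrderBot (Ttn t n) where
  bot := ⟨[], by simp⟩
  bot_le x := show [] <+: x.1 from List.nil_prefix

/-- The rank function of `T_{t,n}` (its length as a sequence). -/
def rankT (t n : ℕ) (q : Ttn t n) : ℕ := q.1.length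

/-- A maximal chain is ascent free (w.r.t. the labeling `lab`) if no two consecutive
labels `a`, `b` on the chain satisfy `a ≤ b`. -/
def AscentFree {α L : Type*} [Preorder L] (lab : α → α → L) (l : List α) : Prop :=
  (labelSeq lab l).Chain' (fun a b => ¬a ≤ b)

/-- The number of ascents of the word `w = w₁ ⋯ w_m` over the poset `L`:
indices `i ∈ [m-1]` with `w_i ≤ w_{i+1}`. -/
noncomputable def ascF {L : Type*} [Preorder L] {m : ℕ} (w : Fin m → L) : ℕ :=
  (Finset.univ.filter fun i : Fin (m - 1) =>
      w ⟨(i : ℕ), by have := i.2; omega⟩ ≤ w ⟨(i : ℕ) + 1, by have := i.2; omega⟩).card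

/-- The word `w = w₁ ⋯ w_m` over the poset `L` has no double ascent
(no `i` with `w_i ≤ w_{i+1} ≤ w_{i+2}`). -/
def NDAF {L : Type*} [Preorder L] {m : ℕ} (w : Fin m → L) : Prop :=
  ∀ i : ℕ, ∀ h : i + 2 < m,
    ¬(w ⟨i, by omega⟩ ≤ w ⟨i + 1, by omega⟩ ∧ w ⟨i + 1, by omega⟩ ≤ w ⟨i + 2, h⟩)

end Words

namespace ReesAux

/-- The list `l` of elements of `γ`, followed by the adjoined top. -/
def ext {γ : Type*} (l : List γ) : List (WithTop γ) :=
  l.map WithTop.some ++ [⊤]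

theorem ext_cons {γ : Type*} (a : γ) (l : List γ) : ext (a :: l) = (a : WithTop γ) :: ext l := rfl

theorem ext_nil {γ : Type*} : ext ([] : List γ) = [⊤] := rfl

theorem ext_inj {γ : Type*} {l l' : List γ} (h : ext l = ext l') : l = l' := by
  unfold ext at h
  have := List.append_cancel_right h
  exact List.map_injective_iff.2 WithTop.coe_injective this

theorem ext_length {γ : Type*} (l : List γ) : (ext l).length = l.length + 1 := by
  simp [ext]

theorem ext_getLast {γ : Type*} (l : List γ) : (ext l).getLast? = some ⊤ := by
  simp [ext]

theorem exists_ext {γ : Type*} [PartialOrder γ] (l : List (WithTop γ))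
    (hc : l.IsChain (· ⋖ ·)) (hl : l.getLast? = some ⊤) : ∃ K : List γ, l = ext K := by
  induction l with
  | nil => simp at hl
  | cons a l ih =>
    cases l with
    | nil => exact ⟨[], by simpa [ext] using hl⟩
    | cons b l =>
      rw [List.isChain_cons_cons] at hc
      obtain ⟨K, hK⟩ := ih hc.2 (by simpa using hl)
      obtain ⟨a', rfl⟩ := WithTop.ne_top_iff_exists.1 hc.1.lt.ne_top
      exact ⟨a' :: K, by rw [ext_cons, hK]⟩

theorem covIn_univ {γ : Type*} [PartialOrder γ] :
    (CovIn (Set.univ : Set γ)) = (· ⋖ ·) := by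
  funext a b
  apply propext
  constructor
  · rintro ⟨-, -, h, h'⟩
    exact ⟨h, fun c h1 h2 => h' c trivial ⟨h1, h2⟩⟩
  · rintro ⟨h, h'⟩
    exact ⟨trivial, trivial, h, fun c _ h2 => h' h2.1 h2.2⟩

theorem maxChain_iff {γ : Type*} [PartialOrder γ] (b : γ) (hb : ∀ x, b ≤ x)
    (l : List (WithTop γ)) :
    IsMaximalChain l ↔ ∃ K : List γ, l = ext (b :: K) ∧ (ext (b :: K)).IsChain (· ⋖ ·) := by
  have hb' : ∀ x : WithTop γ, (b : WithTop γ) ≤ x := by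
    intro x
    induction x with
    | top => exact le_top
    | coe x => exact WithTop.coe_le_coe.2 (hb x)
  constructor
  · rintro ⟨h0, -, h2, h3, h4⟩
    rw [covIn_univ] at h2
    obtain ⟨K, rfl⟩ := exists_ext l h2 (by
      rw [List.getLast?_eq_some_getLast h0]
      have := h4 _ (List.getLast?_eq_some_getLast h0) ⊤ trivial
      rw [not_lt_top_iff.1 this])
    cases K with
    | nil => exact absurd (WithTop.coe_lt_top b) (h3 ⊤ rfl b trivial)
    | cons a K =>
      have : b = a := by
        have h := h3 a rfl b trivial
        have h' := (hb' a).lt_or_eq.resolve_left h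
        exact WithTop.coe_injective h'
      subst this
      exact ⟨K, rfl, h2⟩
  · rintro ⟨K, rfl, h⟩
    refine ⟨by simp [ext], fun _ _ => trivial, by rw [covIn_univ]; exact h, ?_, ?_⟩
    · intro x hx c _ hc
      rw [ext_cons] at hx
      simp only [List.head?_cons, Option.some.injEq] at hx
      subst hx
      exact absurd (hb' c) hc.not_ge
    · intro x hx c _ hc
      rw [ext_getLast] at hx
      simp only [Option.some.injEq] at hx
      subst hx
      exact not_top_lt hc

section Rank
variable {α : Type*} [PartialOrder α] [Fintype α] [OrderBot α]

theorem exists_chain (x : α) : ∃ l : List α, l.IsChain (· ⋖ ·) ∧ l.head? = some ⊥ ∧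
    l.getLast? = some x := by
  refine WellFoundedLT.induction (motive := fun x : α => ∃ l : List α, l.IsChain (· ⋖ ·) ∧
    l.head? = some ⊥ ∧ l.getLast? = some x) x ?_
  intro x ih
  by_cases hx : x = ⊥
  · exact ⟨[⊥], by simp [hx]⟩
  · obtain ⟨y, -, hy⟩ := exists_le_covBy_of_lt (bot_lt_iff_ne_bot.2 hx)
    obtain ⟨l, h1, h2, h3⟩ := ih y hy.lt
    refine ⟨l ++ [x], ?_, ?_, by simp⟩
    · rw [List.isChain_append]
      refine ⟨h1, by simp, ?_⟩
      intro a ha b hb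
      rw [h3] at ha
      simp at ha hb
      subst ha; subst hb; exact hy
    · cases l <;> simp_all

theorem chain_max {α : Type*} [PartialOrder α] [OrderBot α] {x : α} {l : List α} (h : l.IsChain (· ⋖ ·)) (h1 : l.head? = some ⊥)
    (h2 : l.getLast? = some x) : IsMaxChainIn (Set.Iic x) l := by
  have h0 : l ≠ [] := by rintro rfl; simp at h1
  have hp : l.Pairwise (· < ·) := (h.imp (fun _ _ h => h.lt)).pairwise
  have hm : ∀ a ∈ l, a ≤ x := by
    obtain ⟨l', rfl⟩ : ∃ l', l = l' ++ [x] := by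
      rcases List.eq_nil_or_concat l with rfl | ⟨l', b, rfl⟩
      · exact absurd rfl h0
      · simp at h2; exact ⟨l', by simp [h2]⟩
    intro a ha
    rw [List.pairwise_append] at hp
    rcases List.mem_append.1 ha with ha | ha
    · exact (hp.2.2 a ha x (by simp)).le
    · simp at ha; exact ha.le
  refine ⟨h0, hm, ?_, ?_, ?_⟩
  · show l.IsChain _
    clear h0 h1 h2 hp
    induction l with
    | nil => simp
    | cons a l ih =>
      cases l with
      | nil => simp
      | cons b l =>
        rw [List.isChain_cons_cons] at h ⊢
        exact ⟨⟨hm a (by simp), hm b (by simp), h.1.lt, fun c _ hc => h.1.2 hc.1 hc.2⟩,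
          ih h.2 (fun c hc => hm c (List.mem_cons_of_mem _ hc))⟩
  · intro y hy c _
    rw [h1] at hy
    simp at hy
    subst hy
    exact not_lt_bot
  · intro y hy c hc hlt
    rw [h2] at hy
    simp at hy
    subst hy
    exact absurd hc hlt.not_ge




theorem rank_cov {rP : α → ℕ} (hrP : IsRankFunction rP) {x y : α} (h : x ⋖ y) : rP y = rP x + 1 := by
  obtain ⟨l, h1, h2, h3⟩ := exists_chain x
  have e1 := hrP x l (chain_max h1 h2 h3)
  have e2 := hrP y (l ++ [y]) (chain_max (by
      rw [List.isChain_append]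
      refine ⟨h1, by simp, ?_⟩
      intro a ha b hb
      rw [h3] at ha
      simp at ha hb
      subst ha; subst hb; exact h) (by cases l <;> simp_all) (by simp))
  simp at e2
  omega

theorem rank_mono {rP : α → ℕ} (hrP : IsRankFunction rP) {x y : α} (h : x ≤ y) : rP x ≤ rP y := by
  refine WellFoundedLT.induction (motive := fun y : α => x ≤ y → rP x ≤ rP y) y ?_ h
  intro y ih h
  rcases h.eq_or_lt with rfl | h
  · exact le_rfl
  · obtain ⟨z, hz, hzy⟩ := exists_le_covBy_of_lt h
    have := ih z hzy.lt hz
    have := rank_cov hrP hzy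
    omega

theorem rank_le {rP : α → ℕ} (hrP : IsRankFunction rP) {n : ℕ} (hlen : HasLength α n) (x : α) : rP x ≤ n := by
  obtain ⟨l, h1, h2, h3⟩ := exists_chain x
  have e1 := hrP x l (chain_max h1 h2 h3)
  have := hlen.2 l (h1.imp (fun _ _ h => h.lt))
  omega

end Rank

/- ### Counting words -/

universe v

section Words
variable {L : Type*} [PartialOrder L]

/-- The bit attached to a step in the tree. -/
noncomputable def bit {t : ℕ} (s : Option (Fin t)) : WithBot PUnit.{v+1} :=
  s.elim ⊥ (fun _ => ((PUnit.unit : PUnit.{v+1}) : WithBot PUnit.{v+1}))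

/-- Number of compatible sequences of tree steps over a given word. -/
noncomputable def G (t : ℕ) : (L × WithBot PUnit.{v+1} → Prop) → List L → ℕ
  | _, [] => 1
  | p, [c] => if p (c, ⊥) then 1 else 0
  | p, c :: d :: w => ∑ s : Option (Fin t),
      if p (c, bit s) then G t (fun b => ¬ ((c, bit s) : L × WithBot PUnit.{v+1}) ≤ b) (d :: w) else 0

/-- Number of ascents of a list. -/
noncomputable def asc : List L → ℕ
  | [] => 0
  | [_] => 0
  | c :: d :: w => (if c ≤ d then 1 else 0) + asc (d :: w)

/-- No double ascent. -/
def NDA : List L → Prop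
  | [] => True
  | [_] => True
  | [_, _] => True
  | c :: d :: e :: w => ¬ (c ≤ d ∧ d ≤ e) ∧ NDA (d :: e :: w)

/-- Indicator of a final ascent. -/
noncomputable def lastAsc : List L → ℕ
  | [] => 0
  | [_] => 0
  | [c, d] => if c ≤ d then 1 else 0
  | _ :: d :: e :: w => lastAsc (d :: e :: w)

theorem G_zero (t : ℕ) (c d : L) (w : List L) (h : c ≤ d) :
    G t (fun b => ¬ ((c, ⊥) : L × WithBot PUnit.{v+1}) ≤ b) (d :: w) = 0 := by
  cases w with
  | nil => simp [G, h]
  | cons e w => simp [G, h]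

theorem G_free (t : ℕ) (c d : L) (x : WithBot PUnit.{v+1}) (w : List L) (h : ¬ c ≤ d) :
    G t (fun b => ¬ ((c, x) : L × WithBot PUnit.{v+1}) ≤ b) (d :: w) =
      G t (fun _ : L × WithBot PUnit.{v+1} => True) (d :: w) := by
  cases w with
  | nil => simp [G, h]
  | cons e w => simp [G, h]

theorem G_step (t : ℕ) (c d : L) (w : List L) :
    G t (fun _ : L × WithBot PUnit.{v+1} => True) (c :: d :: w) = if c ≤ d then
      t * G t (fun b => ¬ ((c, ((PUnit.unit : PUnit.{v+1}) : WithBot PUnit.{v+1})) :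
        L × WithBot PUnit.{v+1}) ≤ b) (d :: w)
      else (1 + t) * G t (fun _ : L × WithBot PUnit.{v+1} => True) (d :: w) := by
  split_ifs with h
  · simp only [G, if_true, Fintype.sum_option, bit, Option.elim]
    rw [G_zero t c d w h]
    simp
  · simp only [G, if_true, Fintype.sum_option, bit, Option.elim]
    rw [G_free t c d _ w h, G_free t c d _ w h]
    simp [add_mul]

theorem G_one (t : ℕ) (c d e : L) (w : List L) (h : c ≤ d) :
    G t (fun b => ¬ ((c, ((PUnit.unit : PUnit.{v+1}) : WithBot PUnit.{v+1})) :
        L × WithBot PUnit.{v+1}) ≤ b) (d :: e :: w) =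
      if d ≤ e then 0 else G t (fun _ : L × WithBot PUnit.{v+1} => True) (e :: w) := by
  simp only [G, Fintype.sum_option, bit, Option.elim, Prod.mk_le_mk, h, true_and, le_refl,
    not_true_eq_false, if_false, Finset.sum_const_zero, add_zero]
  rw [if_pos (by simp)]
  split_ifs with h'
  · exact G_zero t d e w h'
  · exact G_free t d e _ w h'

theorem G_closed_aux (t : ℕ) (N : ℕ) : ∀ (c : L) (w : List L), w.length ≤ N →
    (NDA (c :: w) → ∃ e, e + 2 * asc (c :: w) = w.length + lastAsc (c :: w) ∧
      G t (fun _ : L × WithBot PUnit.{v+1} => True) (c :: w) = t ^ asc (c :: w) * (1 + t) ^ e) ∧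
    (¬ NDA (c :: w) → G t (fun _ : L × WithBot PUnit.{v+1} => True) (c :: w) = 0) := by
  induction N using Nat.strong_induction_on with
  | _ N ih =>
  intro c w hw
  match w, hw with
  | [], _ => exact ⟨fun _ => ⟨0, by simp [asc, lastAsc, G]⟩, fun h => absurd trivial h⟩
  | [d], _ =>
    refine ⟨fun _ => ?_, fun h => absurd trivial h⟩
    rw [G_step]
    by_cases h : c ≤ d
    · exact ⟨0, by simp [asc, lastAsc, h], by simp [asc, G, h]⟩
    · exact ⟨1, by simp [asc, lastAsc, h], by simp [asc, G, h]⟩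
  | d :: e :: w, hw =>
    simp only [List.length_cons] at hw
    rw [G_step]
    by_cases h : c ≤ d
    · rw [if_pos h, G_one t c d e w h]
      by_cases h' : d ≤ e
      · simp [NDA, h, h']
      · rw [if_neg h']
        have key : NDA (c :: d :: e :: w) ↔ NDA (e :: w) := by
          cases w <;> simp [NDA, h']
        have kl : w ≠ [] → lastAsc (c :: d :: e :: w) = lastAsc (e :: w) := by
          cases w <;> simp [lastAsc]
        have kl' : w = [] → lastAsc (c :: d :: e :: w) = lastAsc (e :: w) := by
          rintro rfl; simp [lastAsc, h']
        have kl2 : lastAsc (c :: d :: e :: w) = lastAsc (e :: w) := by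
          by_cases hw : w = []
          · exact kl' hw
          · exact kl hw
        have ka : asc (c :: d :: e :: w) = 1 + asc (e :: w) := by simp [asc, h, h']
        obtain ⟨i1, i2⟩ := ih (N - 1) (by omega) e w (by omega)
        rw [key, kl2, ka]
        refine ⟨fun hn => ?_, fun hn => by rw [i2 hn, mul_zero]⟩
        obtain ⟨k, hk, hk'⟩ := i1 hn
        refine ⟨k, by simp only [List.length_cons]; omega, ?_⟩
        rw [hk']; ring
    · rw [if_neg h]
      have key : NDA (c :: d :: e :: w) ↔ NDA (d :: e :: w) := by simp [NDA, h]
      have kl2 : lastAsc (c :: d :: e :: w) = lastAsc (d :: e :: w) := by simp [lastAsc]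
      have ka : asc (c :: d :: e :: w) = asc (d :: e :: w) := by simp [asc, h]
      obtain ⟨i1, i2⟩ := ih (N - 1) (by omega) d (e :: w) (by simp only [List.length_cons]; omega)
      rw [key, kl2, ka]
      refine ⟨fun hn => ?_, fun hn => by rw [i2 hn, mul_zero]⟩
      obtain ⟨k, hk, hk'⟩ := i1 hn
      simp only [List.length_cons] at hk
      refine ⟨k + 1, by simp only [List.length_cons]; omega, ?_⟩
      rw [hk']; ring

theorem asc_ofFn (m : ℕ) (w : Fin (m + 1) → L) : asc (List.ofFn w) = ascF w := by
  induction m with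
  | zero => simp [asc, ascF]
  | succ m ih =>
    rw [List.ofFn_succ, List.ofFn_succ, asc, ← List.ofFn_succ (f := fun i => w i.succ), ih]
    unfold ascF
    rw [Finset.card_filter, Finset.card_filter]
    exact (Fin.sum_univ_succ (n := m) (fun i : Fin (m + 1) =>
      if w ⟨(i : ℕ), by omega⟩ ≤ w ⟨(i : ℕ) + 1, by omega⟩ then 1 else 0)).symm

theorem NDA_ofFn (m : ℕ) (w : Fin (m + 1) → L) : NDA (List.ofFn w) ↔ NDAF w := by
  induction m with
  | zero =>
    simp only [List.ofFn_succ, List.ofFn_zero, NDA, NDAF, true_iff]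
    intro i h; omega
  | succ m ih =>
    cases m with
    | zero =>
      simp only [List.ofFn_succ, List.ofFn_zero, NDA, NDAF, true_iff]
      intro i h; omega
    | succ m =>
      rw [List.ofFn_succ, List.ofFn_succ, List.ofFn_succ, NDA,
        ← List.ofFn_succ (f := fun i => w i.succ.succ), ← List.ofFn_succ (f := fun i => w i.succ), ih]
      constructor
      · rintro ⟨h1, h2⟩ i h
        cases i with
        | zero => exact h1
        | succ i => exact h2 i (by omega)
      · intro h
        exact ⟨h 0 (by omega), fun i hi => h (i + 1) (by omega)⟩

theorem lastAsc_ofFn (m : ℕ) (w : Fin (m + 2) → L) : lastAsc (List.ofFn w) =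
    if w ⟨m, by omega⟩ ≤ w ⟨m + 1, by omega⟩ then 1 else 0 := by
  induction m with
  | zero => simp [lastAsc]
  | succ m ih =>
    rw [List.ofFn_succ, List.ofFn_succ, List.ofFn_succ, lastAsc,
        ← List.ofFn_succ (f := fun i => w i.succ.succ), ← List.ofFn_succ (f := fun i => w i.succ), ih]
    rfl

theorem G_closed (t m : ℕ) (hm : 0 < m) (w : Fin (m + 1) → L) :
    G t (fun _ : L × WithBot PUnit.{v+1} => True) (List.ofFn w) =
      (if NDAF w ∧ ¬w ⟨m - 1, by omega⟩ ≤ w ⟨m, by omega⟩ then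
        t ^ ascF w * (1 + t) ^ (m - 2 * ascF w) else 0) +
      (if NDAF w ∧ w ⟨m - 1, by omega⟩ ≤ w ⟨m, by omega⟩ then
        t ^ ascF w * (1 + t) ^ (m + 1 - 2 * ascF w) else 0) := by
  obtain ⟨m, rfl⟩ : ∃ k, m = k + 1 := ⟨m - 1, by omega⟩
  have h := G_closed_aux t (m + 1) (w 0) (List.ofFn fun i => w i.succ) (by simp)
  rw [← List.ofFn_succ (f := w), NDA_ofFn, asc_ofFn, lastAsc_ofFn, List.length_ofFn] at h
  simp only [Nat.add_sub_cancel]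
  by_cases hN : NDAF w
  · obtain ⟨e, he, hG⟩ := h.1 hN
    rw [hG]
    by_cases hl : w ⟨m, by omega⟩ ≤ w ⟨m + 1, by omega⟩
    · simp only [hl, if_true] at he
      simp only [hN, hl, not_true_eq_false, and_false, if_false, and_self, if_true, zero_add]
      congr 2; omega
    · simp only [hl, if_false] at he
      simp only [hN, hl, not_false_eq_true, and_false, if_false, and_self, if_true, add_zero]
      congr 2; omega
  · rw [h.2 hN]; simp [hN]

end Words

/- ### The Rees product -/

section ReesPart

set_option linter.unusedSectionVars false

variable {α : Type*} [PartialOrder α] [Fintype α] [OrderBot α]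

instance finTtn (t n : ℕ) : Finite (Ttn t n) :=
  (List.finite_length_le (Fin t) n).to_subtype

instance finRees (rP : α → ℕ) (t n : ℕ) : Finite (Rees rP (rankT t n)) :=
  inferInstanceAs (Finite {x : α × Ttn t n // rankT t n x.2 ≤ rP x.1})

theorem rees_le {rP : α → ℕ} {t n : ℕ} {z z' : Rees rP (rankT t n)} :
    z ≤ z' ↔ z.1.1 ≤ z'.1.1 ∧ z.1.2.1 <+: z'.1.2.1 ∧
      z'.1.2.1.length + rP z.1.1 ≤ rP z'.1.1 + z.1.2.1.length := Iff.rfl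

theorem rees_ext {rP : α → ℕ} {t n : ℕ} {z z' : Rees rP (rankT t n)}
    (h1 : z.1.1 = z'.1.1) (h2 : z.1.2.1 = z'.1.2.1) : z = z' :=
  Subtype.ext (Prod.ext h1 (Subtype.ext h2))

theorem rees_lt_fst {rP : α → ℕ} {t n : ℕ} {z z' : Rees rP (rankT t n)} (h : z < z') :
    z.1.1 < z'.1.1 := by
  have hle := rees_le.1 h.le
  refine lt_of_le_of_ne hle.1 fun he => h.ne (rees_ext he ?_)
  have h3 := hle.2.2
  rw [he] at h3
  exact hle.2.1.eq_of_length (le_antisymm hle.2.1.length_le (by omega))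

theorem rees_isMax {rP : α → ℕ} {t n : ℕ} (hrP : IsRankFunction rP)
    (z : Rees rP (rankT t n)) : IsMax z ↔ IsMax z.1.1 := by
  constructor
  · intro h
    rw [isMax_iff_forall_not_lt]
    intro y hy
    have hm := rank_mono hrP hy.le
    have hz := z.2
    let z' : Rees rP (rankT t n) := ⟨(y, z.1.2), hz.trans hm⟩
    have hle : z ≤ z' := rees_le.2 ⟨hy.le, List.prefix_refl _, by simp only [z']; omega⟩
    exact absurd (h hle).1 hy.not_ge
  · intro h
    rw [isMax_iff_forall_not_lt]
    intro y hy
    exact absurd (rees_lt_fst hy) h.not_lt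

/-- The step in the Rees product above a cover of `P`. -/
def step {rP : α → ℕ} {t n : ℕ} (hrP : IsRankFunction rP) (hlen : HasLength α n)
    (z : Rees rP (rankT t n)) (y : α) (h : z.1.1 ⋖ y) (s : Option (Fin t)) :
    Rees rP (rankT t n) :=
  have hz : z.1.2.1.length ≤ rP z.1.1 := z.2
  have hc := rank_cov hrP h
  have hs : (z.1.2.1 ++ s.toList).length ≤ rP y := by
    cases s <;> simp <;> omega
  ⟨(y, ⟨z.1.2.1 ++ s.toList, hs.trans (rank_le hrP hlen y)⟩), hs⟩

theorem step_fst {rP : α → ℕ} {t n : ℕ} (hrP : IsRankFunction rP) (hlen : HasLength α n)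
    (z : Rees rP (rankT t n)) (y : α) (h : z.1.1 ⋖ y) (s : Option (Fin t)) :
    (step hrP hlen z y h s).1.1 = y := rfl

theorem step_snd {rP : α → ℕ} {t n : ℕ} (hrP : IsRankFunction rP) (hlen : HasLength α n)
    (z : Rees rP (rankT t n)) (y : α) (h : z.1.1 ⋖ y) (s : Option (Fin t)) :
    (step hrP hlen z y h s).1.2.1 = z.1.2.1 ++ s.toList := rfl

theorem step_inj {rP : α → ℕ} {t n : ℕ} (hrP : IsRankFunction rP) (hlen : HasLength α n)
    (z : Rees rP (rankT t n)) (y : α) (h : z.1.1 ⋖ y) (s s' : Option (Fin t))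
    (he : step hrP hlen z y h s = step hrP hlen z y h s') : s = s' := by
  have h2 : z.1.2.1 ++ s.toList = z.1.2.1 ++ s'.toList := by
    rw [← step_snd hrP hlen z y h s, he, step_snd]
  have := List.append_cancel_left h2
  cases s <;> cases s' <;> simp_all

theorem step_cov {rP : α → ℕ} {t n : ℕ} (hrP : IsRankFunction rP) (hlen : HasLength α n)
    (z : Rees rP (rankT t n)) (y : α) (h : z.1.1 ⋖ y) (s : Option (Fin t)) :
    z ⋖ step hrP hlen z y h s := by
  have hc := rank_cov hrP h
  constructor
  · refine lt_of_le_of_ne (rees_le.2 ⟨h.le, ?_, ?_⟩) ?_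
    · rw [step_snd]; exact List.prefix_append _ _
    · rw [step_snd, step_fst]; cases s <;> simp <;> omega
    · intro he
      have : z.1.1 = y := by rw [← step_fst hrP hlen z y h s, ← he]
      exact h.ne this
  · intro c h1 h2
    exact h.2 (rees_lt_fst h1) (rees_lt_fst h2)

theorem cov_step {rP : α → ℕ} {t n : ℕ} (hrP : IsRankFunction rP) (hlen : HasLength α n)
    (z z' : Rees rP (rankT t n)) (h : z ⋖ z') :
    ∃ (hc : z.1.1 ⋖ z'.1.1) (s : Option (Fin t)), z' = step hrP hlen z z'.1.1 hc s := by
  obtain ⟨y, hy, hyz⟩ := exists_covBy_le_of_lt (rees_lt_fst h.lt)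
  have hc := rank_cov hrP hy
  have hm := rank_mono hrP hyz
  obtain ⟨-, ⟨r, hr⟩, hl⟩ := rees_le.1 h.le
  rw [← hr] at hl
  simp only [List.length_append] at hl
  have key : ∀ s : Option (Fin t), (z.1.2.1 ++ s.toList) <+: z'.1.2.1 →
      r.length + rP y ≤ rP z'.1.1 + s.toList.length → 
      ∃ (hc : z.1.1 ⋖ z'.1.1) (s : Option (Fin t)), z' = step hrP hlen z z'.1.1 hc s := by
    intro s h1 h2
    have hle : step hrP hlen z y hy s ≤ z' := by
      refine rees_le.2 ⟨hyz, h1, ?_⟩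
      rw [step_snd, step_fst, ← hr]
      simp only [List.length_append]
      omega
    rcases hle.eq_or_lt with he | hlt
    · subst he
      exact ⟨hy, s, rfl⟩
    · exact absurd hlt (h.2 (step_cov hrP hlen z y hy s).lt)
  cases r with
  | nil => exact key none (by simp [← hr]) (by simpa using hm)
  | cons a r =>
    refine key (some a) ⟨r, by simp [← hr]⟩ ?_
    simp only [List.length_cons, Option.toList_some, List.length_nil] at hl ⊢
    omega

variable {L : Type*} [PartialOrder L]

/-- Labels on `P⁺`. -/
def labA (lab : WithBot (WithTop α) → WithBot (WithTop α) → L) (a b : WithTop α) : L :=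
  lab (a : WithBot (WithTop α)) (b : WithBot (WithTop α))

/-- Labels on `(P ∗ T)⁺`. -/
noncomputable def labZ (rP : α → ℕ) (t n : ℕ)
    (lab : WithBot (WithTop α) → WithBot (WithTop α) → L)
    (a b : WithTop (Rees rP (rankT t n))) : L × WithBot PUnit.{v+1} :=
  reesLab rP (rankT t n) lab (fun _ _ => PUnit.unit)
    (a : WithBot (WithTop (Rees rP (rankT t n)))) (b : WithBot (WithTop (Rees rP (rankT t n))))

theorem labZ_top (rP : α → ℕ) (t n : ℕ)
    (lab : WithBot (WithTop α) → WithBot (WithTop α) → L) (z : Rees rP (rankT t n)) :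
    labZ.{v} rP t n lab (z : WithTop _) ⊤ = (labA lab (z.1.1 : WithTop α) ⊤, ⊥) := by
  unfold labZ reesLab labA
  refine Prod.ext rfl ?_
  exact if_neg (by exact not_lt_bot)

theorem labZ_step {rP : α → ℕ} {t n : ℕ} (hrP : IsRankFunction rP) (hlen : HasLength α n)
    (lab : WithBot (WithTop α) → WithBot (WithTop α) → L)
    (z : Rees rP (rankT t n)) (y : α) (h : z.1.1 ⋖ y) (s : Option (Fin t)) :
    labZ.{v} rP t n lab (z : WithTop _) ((step hrP hlen z y h s : Rees rP (rankT t n)) : WithTop _)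
      = (labA lab (z.1.1 : WithTop α) (y : WithTop α), bit s) := by
  unfold labZ reesLab labA
  refine Prod.ext rfl ?_
  cases s with
  | none =>
    refine if_neg ?_
    intro hlt
    have h2 : z.1.2 < (step hrP hlen z y h none).1.2 := hlt
    refine h2.ne (Subtype.ext ?_)
    rw [step_snd]; simp
  | some a =>
    refine if_pos ?_
    show z.1.2 < (step hrP hlen z y h (some a)).1.2
    refine lt_of_le_of_ne ?_ ?_
    · show z.1.2.1 <+: (step hrP hlen z y h (some a)).1.2.1
      rw [step_snd]; exact List.prefix_append _ _
    · intro he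
      have := congrArg (fun q : Ttn t n => q.1.length) he
      simp only [step_snd] at this
      simp at this

/-- Ascent free words with a condition on the first letter. -/
def AFrom {Λ : Type*} [Preorder Λ] (p : Λ → Prop) (w : List Λ) : Prop :=
  (∀ a ∈ w.head?, p a) ∧ w.IsChain (fun a b => ¬ a ≤ b)

theorem AFrom_cons {Λ : Type*} [Preorder Λ] (p : Λ → Prop) (a : Λ) (w : List Λ) :
    AFrom p (a :: w) ↔ p a ∧ AFrom (fun b => ¬ a ≤ b) w := by
  unfold AFrom
  rw [List.isChain_cons]
  simp

theorem labelSeq_cons_cons {γ Λ : Type*} (f : γ → γ → Λ) (a b : γ) (l : List γ) :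
    labelSeq f (a :: b :: l) = f a b :: labelSeq f (b :: l) := rfl

/-- The lifts of a chain of `P⁺` starting at a given element. -/
def lifts {rP : α → ℕ} {t n : ℕ} (lab : WithBot (WithTop α) → WithBot (WithTop α) → L)
    (p : L × WithBot PUnit.{v+1} → Prop) (z : Rees rP (rankT t n)) (k : List α) :
    Set (List (Rees rP (rankT t n))) :=
  {K | K.map (fun z => z.1.1) = k ∧ (ext (z :: K)).IsChain (· ⋖ ·) ∧
    AFrom p (labelSeq (labZ.{v} rP t n lab) (ext (z :: K)))}

theorem lifts_finite {rP : α → ℕ} {t n : ℕ}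
    (lab : WithBot (WithTop α) → WithBot (WithTop α) → L)
    (p : L × WithBot PUnit.{v+1} → Prop) (z : Rees rP (rankT t n)) (k : List α) :
    (lifts lab p z k).Finite := by
  refine (List.finite_length_eq (Rees rP (rankT t n)) k.length).subset ?_
  rintro K ⟨rfl, -⟩
  simp

theorem lifts_card {rP : α → ℕ} {t n : ℕ} (hrP : IsRankFunction rP) (hlen : HasLength α n)
    (lab : WithBot (WithTop α) → WithBot (WithTop α) → L) (k : List α) :
    ∀ (p : L × WithBot PUnit.{v+1} → Prop) (z : Rees rP (rankT t n)),
    (ext (z.1.1 :: k)).IsChain (· ⋖ ·) →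
    Nat.card (lifts lab p z k) = G t p (labelSeq (labA lab) (ext (z.1.1 :: k))) := by
  induction k with
  | nil =>
    intro p z hk
    have hmax : IsMax z := by
      rw [rees_isMax hrP]
      rw [ext_cons, ext_nil, List.isChain_cons_cons] at hk
      exact WithTop.coe_covBy_top.1 hk.1
    have hs : lifts lab p z [] = {K | K = [] ∧ p (labA lab (z.1.1 : WithTop α) ⊤, ⊥)} := by
      ext K
      simp only [lifts, List.map_eq_nil_iff, Set.mem_setOf_eq]
      refine and_congr_right ?_
      rintro rfl
      rw [ext_cons, ext_nil, labelSeq_cons_cons, labZ_top, AFrom_cons, List.isChain_cons_cons,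
        WithTop.coe_covBy_top]
      simp [hmax, AFrom, labelSeq]
    rw [hs]
    simp only [ext_cons, ext_nil, labelSeq, List.tail_cons, List.zipWith_cons_cons,
      List.zipWith_nil_right, G]
    split_ifs with hp
    · simp [hp]
    · simp [hp]
  | cons y k ih =>
    intro p z hk
    rw [ext_cons, ext_cons, List.isChain_cons_cons, WithTop.coe_covBy_coe] at hk
    obtain ⟨hc, hk⟩ := hk
    have hG : G t p (labelSeq (labA lab) (ext (z.1.1 :: y :: k))) = ∑ s : Option (Fin t),
        if p (labA lab (z.1.1 : WithTop α) (y : WithTop α), bit s) then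
          G t (fun b => ¬ ((labA lab (z.1.1 : WithTop α) (y : WithTop α), bit s) :
            L × WithBot PUnit.{v+1}) ≤ b) (labelSeq (labA lab) (ext (y :: k))) else 0 := by
      rw [ext_cons, ext_cons, labelSeq_cons_cons]
      obtain ⟨d, w, hd⟩ : ∃ d w, labelSeq (labA lab) ((y : WithTop α) :: ext k) = d :: w := by
        cases k <;> exact ⟨_, _, rfl⟩
      rw [hd, G]
    rw [hG]
    have hbij : Nat.card (Σ s : Option (Fin t), {K : List (Rees rP (rankT t n)) //
        p (labA lab (z.1.1 : WithTop α) (y : WithTop α), bit s) ∧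
        K ∈ lifts lab (fun b => ¬ ((labA lab (z.1.1 : WithTop α) (y : WithTop α), bit s) :
            L × WithBot PUnit.{v+1}) ≤ b) (step hrP hlen z y hc s) k}) =
        Nat.card (lifts lab p z (y :: k)) := by
      refine Nat.card_eq_of_bijective (fun x => ⟨step hrP hlen z y hc x.1 :: x.2.1, ?_⟩) ⟨?_, ?_⟩
      · obtain ⟨s, K, hp, h1, h2, h3⟩ := x
        refine ⟨by simp only [List.map_cons, h1, step_fst], ?_, ?_⟩
        · rw [ext_cons, ext_cons, List.isChain_cons_cons, WithTop.coe_covBy_coe]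
          exact ⟨step_cov hrP hlen z y hc s, h2⟩
        · rw [ext_cons, ext_cons, labelSeq_cons_cons, labZ_step, AFrom_cons]
          exact ⟨hp, h3⟩
      · rintro ⟨s, K, hK⟩ ⟨s', K', hK'⟩ he
        simp only [Subtype.mk.injEq, List.cons.injEq] at he
        obtain ⟨he1, he2⟩ := he
        have := step_inj _ _ _ _ _ _ _ he1
        subst this
        subst he2
        rfl
      · rintro ⟨K, h1, h2, h3⟩
        cases K with
        | nil => simp at h1
        | cons z' K =>
          simp only [List.map_cons, List.cons.injEq] at h1
          obtain ⟨rfl, h1'⟩ := h1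
          rw [ext_cons, ext_cons, List.isChain_cons_cons, WithTop.coe_covBy_coe] at h2
          obtain ⟨hc', s, hs⟩ := cov_step hrP hlen z z' h2.1
          rw [ext_cons, ext_cons, labelSeq_cons_cons, AFrom_cons] at h3
          have hl := labZ_step.{v} hrP hlen lab z z'.1.1 hc s
          rw [← hs] at hl
          rw [hl] at h3
          refine ⟨⟨s, K, h3.1, h1', ?_, ?_⟩, ?_⟩
          · rw [← hs]; exact h2.2
          · rw [← hs]; exact h3.2
          · apply Subtype.ext
            show _ :: K = z' :: K
            rw [← hs]
    rw [← hbij]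
    have hfin : ∀ s : Option (Fin t), Finite {K : List (Rees rP (rankT t n)) //
        p (labA lab (z.1.1 : WithTop α) (y : WithTop α), bit s) ∧
        K ∈ lifts lab (fun b => ¬ ((labA lab (z.1.1 : WithTop α) (y : WithTop α), bit s) :
            L × WithBot PUnit.{v+1}) ≤ b) (step hrP hlen z y hc s) k} := fun s =>
      ((lifts_finite lab _ (step hrP hlen z y hc s) k).subset (fun K hK => hK.2)).to_subtype
    rw [Nat.card_sigma]
    refine Finset.sum_congr rfl fun s _ => ?_
    split_ifs with hp
    · have := ih (fun b => ¬ ((labA lab (z.1.1 : WithTop α) (y : WithTop α), bit s) :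
            L × WithBot PUnit.{v+1}) ≤ b) (step hrP hlen z y hc s) hk
      rw [step_fst] at this
      rw [← this]
      simp only [hp, true_and]
    · simp [hp]

/-- The chains of `P⁺` with `m + 2` elements, encoded by lists of elements of `P`. -/
def chains (α : Type*) [PartialOrder α] [OrderBot α] (m : ℕ) : Set (List α) :=
  {k | (ext ((⊥ : α) :: k)).IsChain (· ⋖ ·) ∧ k.length = m}

theorem chain_fst {rP : α → ℕ} {t n : ℕ} (hrP : IsRankFunction rP) (hlen : HasLength α n)
    (K : List (Rees rP (rankT t n))) (h : (ext K).IsChain (· ⋖ ·)) :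
    (ext (K.map (fun z => z.1.1))).IsChain (· ⋖ ·) := by
  induction K with
  | nil => simp [ext_nil]
  | cons z K ih =>
    cases K with
    | nil =>
      simp only [List.map_cons, List.map_nil, ext_cons, ext_nil, List.isChain_cons_cons,
        WithTop.coe_covBy_top] at h ⊢
      exact ⟨(rees_isMax hrP z).1 h.1, List.isChain_singleton _⟩
    | cons z' K =>
      simp only [List.map_cons, ext_cons, List.isChain_cons_cons,
        WithTop.coe_covBy_coe] at h ih ⊢
      exact ⟨(cov_step hrP hlen z z' h.1).1, ih h.2⟩

/-- The bottom element of the Rees product. -/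
def zbot (rP : α → ℕ) (t n : ℕ) : Rees rP (rankT t n) := ⟨(⊥, ⊥), Nat.zero_le _⟩

theorem zbot_le {rP : α → ℕ} {t n : ℕ} (hrP : IsRankFunction rP) (z : Rees rP (rankT t n)) :
    zbot rP t n ≤ z := by
  have hz : z.1.2.1.length ≤ rP z.1.1 := z.2
  refine rees_le.2 ⟨bot_le, List.nil_prefix, ?_⟩
  have : rP ⊥ = 0 := by
    have := hrP ⊥ [⊥] (chain_max (by simp) rfl rfl)
    simp at this
    omega
  show z.1.2.1.length + rP ⊥ ≤ _
  omega

theorem left_card {rP : α → ℕ} {t n : ℕ} (hrP : IsRankFunction rP) (hlen : HasLength α n)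
    (lab : WithBot (WithTop α) → WithBot (WithTop α) → L) (m : ℕ) [Fintype (chains α m)] :
    Nat.card {l : List (WithTop (Rees rP (rankT t n))) //
        IsMaximalChain l ∧ (labelSeq (labZ.{v} rP t n lab) l).IsChain (fun a b => ¬ a ≤ b) ∧
          l.length = m + 2} =
    ∑ k : chains α m, G t (fun _ : L × WithBot PUnit.{v+1} => True)
      (labelSeq (labA lab) (ext ((⊥ : α) :: k.1))) := by
  have hfin : ∀ k : chains α m, Finite (lifts lab (fun _ : L × WithBot PUnit.{v+1} => True)
      (zbot rP t n) k.1) := fun k => (lifts_finite lab _ _ _).to_subtype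
  have h1 : ∀ k : chains α m, G t (fun _ : L × WithBot PUnit.{v+1} => True)
      (labelSeq (labA lab) (ext ((⊥ : α) :: k.1))) =
      Nat.card (lifts lab (fun _ : L × WithBot PUnit.{v+1} => True) (zbot rP t n) k.1) :=
    fun k => (lifts_card hrP hlen lab k.1 _ (zbot rP t n) k.2.1).symm
  simp only [h1]
  rw [← Nat.card_sigma]
  symm
  refine Nat.card_eq_of_bijective (fun x => ⟨ext (zbot rP t n :: x.2.1), ?_⟩) ⟨?_, ?_⟩
  · obtain ⟨⟨k, hk1, hk2⟩, K, h1, h2, h3⟩ := x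
    refine ⟨(maxChain_iff _ (zbot_le hrP) _).2 ⟨K, rfl, h2⟩, h3.2, ?_⟩
    simp only at h1
    have h4 : K.length = m := by rw [← hk2, ← h1, List.length_map]
    rw [ext_length, List.length_cons]
    show K.length + 1 + 1 = m + 2
    rw [h4]
  · rintro ⟨⟨k, hk⟩, K, hK⟩ ⟨⟨k', hk'⟩, K', hK'⟩ he
    simp only [Subtype.mk.injEq] at he
    have := ext_inj he
    simp only [List.cons.injEq, true_and] at this
    subst this
    have e1 := hK.1
    have e2 := hK'.1
    simp only at e1 e2
    subst e1
    subst e2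
    rfl
  · rintro ⟨l, h1, h2, h3⟩
    obtain ⟨K, rfl, hK⟩ := (maxChain_iff _ (zbot_le hrP) _).1 h1
    rw [ext_length, List.length_cons] at h3
    have hc := chain_fst hrP hlen _ hK
    exact ⟨⟨⟨K.map (fun z : Rees rP (rankT t n) => z.1.1), hc, by rw [List.length_map]; omega⟩, K, rfl, hK,
      fun _ _ => trivial, h2⟩, rfl⟩

theorem chains_finite (α : Type*) [PartialOrder α] [OrderBot α] [Fintype α] (m : ℕ) :
    (chains α m).Finite :=
  (List.finite_length_eq α m).subset fun _ h => h.2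

theorem right_card (lab : WithBot (WithTop α) → WithBot (WithTop α) → L) (m : ℕ)
    [Fintype (chains α m)] (w : Fin (m + 1) → L) :
    Nat.card {l : List (WithTop α) // IsMaximalChain l ∧ l.length = m + 2 ∧
      labelSeq (labA lab) l = List.ofFn w} =
    ∑ k : chains α m, if labelSeq (labA lab) (ext ((⊥ : α) :: k.1)) = List.ofFn w then 1 else 0 := by
  rw [← Finset.card_filter, ← Fintype.card_subtype, ← Nat.card_eq_fintype_card]
  symm
  refine Nat.card_eq_of_bijective (fun x => ⟨ext ((⊥ : α) :: x.1.1), ?_⟩) ⟨?_, ?_⟩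
  · obtain ⟨⟨k, h1, h2⟩, h3⟩ := x
    exact ⟨(maxChain_iff _ (fun _ => bot_le) _).2 ⟨k, rfl, h1⟩,
      by simp only [ext_length, List.length_cons, h2], h3⟩
  · rintro ⟨⟨k, hk⟩, h⟩ ⟨⟨k', hk'⟩, h'⟩ he
    simp only [Subtype.mk.injEq] at he
    have := ext_inj he
    simp only [List.cons.injEq, true_and] at this
    subst this
    rfl
  · rintro ⟨l, h1, h2, h3⟩
    obtain ⟨K, rfl, hK⟩ := (maxChain_iff _ (fun _ => bot_le) _).1 h1
    rw [ext_length, List.length_cons] at h2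
    exact ⟨⟨⟨K, hK, by omega⟩, h3⟩, rfl⟩

theorem labelSeq_length {γ Λ : Type*} (f : γ → γ → Λ) (l : List γ) :
    (labelSeq f l).length = l.length - 1 := by
  simp [labelSeq]

theorem sum_words [Fintype L] (lab : WithBot (WithTop α) → WithBot (WithTop α) → L) (m : ℕ)
    [Fintype (chains α m)] (g : List L → ℕ) :
    ∑ k : chains α m, g (labelSeq (labA lab) (ext ((⊥ : α) :: k.1))) =
    ∑ w : Fin (m + 1) → L, Nat.card {l : List (WithTop α) // IsMaximalChain l ∧ l.length = m + 2 ∧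
      labelSeq (labA lab) l = List.ofFn w} * g (List.ofFn w) := by
  simp only [right_card, Finset.sum_mul]
  rw [Finset.sum_comm]
  refine Finset.sum_congr rfl fun k _ => ?_
  obtain ⟨w, hw⟩ : ∃ w : Fin (m + 1) → L,
      labelSeq (labA lab) (ext ((⊥ : α) :: k.1)) = List.ofFn w := by
    have hl : (labelSeq (labA lab) (ext ((⊥ : α) :: k.1))).length = m + 1 := by
      rw [labelSeq_length, ext_length, List.length_cons, k.2.2]; rfl
    refine ⟨fun i => (labelSeq (labA lab) (ext ((⊥ : α) :: k.1))).get (i.cast hl.symm), ?_⟩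
    apply List.ext_get
    · simp [hl]
    · intro i h1 h2; simp [-List.ofFn_succ]
  rw [hw, Finset.sum_eq_single w]
  · simp
  · intro b _ hb
    rw [if_neg, zero_mul]
    intro he
    exact hb (List.ofFn_injective he).symm
  · simp

theorem chains_zero {n : ℕ} (hn : 0 < n) (hlen : HasLength α n) : chains α 0 = ∅ := by
  ext k
  simp only [Set.mem_empty_iff_false, iff_false]
  rintro ⟨h1, h2⟩
  obtain rfl := List.length_eq_zero_iff.1 h2
  rw [ext_cons, ext_nil, List.isChain_cons_cons, WithTop.coe_covBy_top] at h1
  obtain ⟨⟨l, hl, hl'⟩, -⟩ := hlen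
  match l, hl, hl' with
  | [], _, h => simp at h
  | [_], _, h => simp at h; omega
  | a :: b :: l, h, _ =>
    have hab : a < b := (List.isChain_cons_cons.1 h).1
    exact h1.1.not_lt (bot_le.trans_lt hab)

theorem labelSeq_bind {γ Λ : Type*} (f : WithBot γ → WithBot γ → Λ) (l : List γ) :
    labelSeq f (l >>= fun a => pure (a : WithBot γ)) =
      labelSeq (fun a b : γ => f (a : WithBot γ) (b : WithBot γ)) l := by
  have : (l >>= fun a => pure (a : WithBot γ)) = l.map WithBot.some := by
    induction l with
    | nil => rfl
    | cons a l ih => exact congrArg (List.cons (a : WithBot γ)) ih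
  rw [this]
  unfold labelSeq
  rw [← List.map_tail, List.zipWith_map]

end ReesPart

end ReesAux

/-- Linusson–Shareshian–Wachs. Let `P` be a finite semipure poset of
length `n` with a unique minimum element, `λ_P` an EL-labeling of `P̂`, and let `λ` be
the Rees-product EL-labeling of `(P ∗ T_{t,n})^` built from `λ_P` and the constant
semi-EL-labeling of `T_{t,n}`, restricted to `(P ∗ T_{t,n})⁺` (identified with the
interval of `(P ∗ T_{t,n})^` above the bottom).  For `m ∈ ℕ`, the number of ascent-free
maximal chains of `(P ∗ T_{t,n})⁺` of length `m + 1` (i.e. with `m + 2` elements) equals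
the sum over all `w ∈ L_P^{m+1}` with no double ascent and `w_m ≰ w_{m+1}` of
`c(w) t^{asc w} (1+t)^{m-2 asc w}`, plus the sum over all `w ∈ L_P^{m+1}` with no double
ascent and `w_m ≤ w_{m+1}` of `c(w) t^{asc w} (1+t)^{m+1-2 asc w}`, where `c(w)` is the
number of maximal chains of `P⁺` of length `m + 1` with label sequence `w` (an edge of
`P` being labeled by the restriction of `λ_P`, and the edge into the adjoined maximum of
`P⁺` from `x` being labeled `λ_P(x, 1̂)`). -/
theorem statement_4 {α L : Type*} [PartialOrder α] [Fintype α] [OrderBot α]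
    [PartialOrder L] [Fintype L]
    (t n : ℕ) (ht : 0 < t) (hn : 0 < n)
    (rP : α → ℕ) (hrP : IsRankFunction rP) (hlen : HasLength α n)
    (lab : WithBot (WithTop α) → WithBot (WithTop α) → L)
    (hEL : IsELLabeling lab) (m : ℕ) :
    Nat.card {l : List (WithTop (Rees rP (rankT t n))) //
        IsMaximalChain l ∧
          AscentFree (fun a b =>
            reesLab rP (rankT t n) lab (fun _ _ => PUnit.unit)
              (a : WithBot (WithTop (Rees rP (rankT t n))))
              (b : WithBot (WithTop (Rees rP (rankT t n))))) l ∧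
          l.length = m + 2} =
      (∑ w : Fin (m + 1) → L,
        if NDAF w ∧ ¬w ⟨m - 1, by omega⟩ ≤ w ⟨m, by omega⟩ then
          Nat.card {l : List (WithTop α) // IsMaximalChain l ∧ l.length = m + 2 ∧
              labelSeq (fun a b => lab (a : WithBot (WithTop α))
                (b : WithBot (WithTop α))) l = List.ofFn w} *
            t ^ ascF w * (1 + t) ^ (m - 2 * ascF w)
        else 0) +
      ∑ w : Fin (m + 1) → L,
        if NDAF w ∧ w ⟨m - 1, by omega⟩ ≤ w ⟨m, by omega⟩ then
          Nat.card {l : List (WithTop α) // IsMaximalChain l ∧ l.length = m + 2 ∧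
              labelSeq (fun a b => lab (a : WithBot (WithTop α))
                (b : WithBot (WithTop α))) l = List.ofFn w} *
            t ^ ascF w * (1 + t) ^ (m + 1 - 2 * ascF w)
        else 0 := by

  have := (ReesAux.chains_finite α m).fintype
  simp only [AscentFree, ReesAux.labelSeq_bind]
  refine (ReesAux.left_card (t := t) hrP hlen lab m).trans ?_
  rcases Nat.eq_zero_or_pos m with rfl | hm
  · have he := ReesAux.chains_zero hn hlen
    have hE : IsEmpty (ReesAux.chains α 0) := by rw [he]; infer_instance
    have hR := ReesAux.right_card lab 0
    simp only [Finset.univ_eq_empty, Finset.sum_empty] at hR ⊢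
    unfold ReesAux.labA at hR
    simp only [hR, zero_mul, ite_self, Finset.sum_const_zero, add_zero]
  · rw [ReesAux.sum_words lab m (ReesAux.G t _), ← Finset.sum_add_distrib]
    refine Finset.sum_congr rfl fun w _ => ?_
    rw [ReesAux.G_closed t m hm w, mul_add, mul_ite, mul_ite, mul_zero, ← mul_assoc, ← mul_assoc]
    rfl
end

section
/- For every n ≥ 0, the identity Σ_{σ ∈ S_n} q^{aid(σ)} t^{des(σ)} = Σ_{σ ∈ S_n} q^{maj(σ)} t^{exc(σ)} holds in ℤ[q,t]; that is, the pair of statistics (aid, des) is equidistributed with the pair (maj, exc) on the symmetric group S_n. -/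
attribute [local instance] Classical.propDecidable

open Polynomial

/-- The number of descents of the word `w = w₁ ⋯ w_m`:
indices `i ∈ [m-1]` with `w_i > w_{i+1}`. -/
noncomputable def desF {m : ℕ} (w : Fin m → ℕ) : ℕ :=
  (Finset.univ.filter fun i : Fin (m - 1) =>
      w ⟨(i : ℕ) + 1, by have := i.2; omega⟩ < w ⟨(i : ℕ), by have := i.2; omega⟩).card

/-- The major index of the word `w = w₁ ⋯ w_m`: the sum of the (1-indexed) descent
positions. -/
noncomputable def majF {m : ℕ} (w : Fin m → ℕ) : ℕ :=
  ∑ i ∈ (Finset.univ.filter fun i : Fin (m - 1) =>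
      w ⟨(i : ℕ) + 1, by have := i.2; omega⟩ < w ⟨(i : ℕ), by have := i.2; omega⟩),
    ((i : ℕ) + 1)

/-- The number of inversions of the word `w`: pairs of positions `i < j` with
`w_i > w_j`. -/
noncomputable def invW {m : ℕ} (w : Fin m → ℕ) : ℕ :=
  (Finset.univ.filter fun p : Fin m × Fin m => p.1 < p.2 ∧ w p.2 < w p.1).card

/-- The number of admissible inversions of the word `w`: inversions `(w_i, w_j)`
(`i < j`, `w_i > w_j`) such that either `i > 1` and `w_{i-1} < w_i`, or there is a `k`
with `i < k < j` and `w_i < w_k`. -/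
noncomputable def aiW {m : ℕ} (w : Fin m → ℕ) : ℕ :=
  (Finset.univ.filter fun p : Fin m × Fin m =>
      p.1 < p.2 ∧ w p.2 < w p.1 ∧
        ((0 < (p.1 : ℕ) ∧ w ⟨(p.1 : ℕ) - 1, by have := p.1.2; omega⟩ < w p.1) ∨
          ∃ k : Fin m, p.1 < k ∧ k < p.2 ∧ w p.1 < w k)).card

/-- The permutation `σ ∈ S_n` viewed as the word `σ(1) σ(2) ⋯ σ(n)`. -/
def permWord {n : ℕ} (σ : Equiv.Perm (Fin n)) : Fin n → ℕ := fun i => (σ i : ℕ)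

/-- The number of excedances of `σ ∈ S_n`: positions `i` with `σ(i) > i`. -/
noncomputable def excP {n : ℕ} (σ : Equiv.Perm (Fin n)) : ℕ :=
  (Finset.univ.filter fun i : Fin n => (i : ℕ) < (σ i : ℕ)).card

/-- `aid σ = ai σ + des σ`: the number of admissible inversions of `σ` plus the number
of descents of `σ`. -/
noncomputable def aidP {n : ℕ} (σ : Equiv.Perm (Fin n)) : ℕ :=
  aiW (permWord σ) + desF (permWord σ)


/-! ### The linear functional on compositions -/
section Functional
variable {K : Type*} [Field K]

noncomputable def lsT (q : K) : ℕ → (List ℕ → K) → K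
  | 0, f => f []
  | n + 1, f => (1 - q ^ (n + 1))⁻¹ *
      ∑ k : Fin (n + 1), q ^ (n - (k : ℕ)) * lsT q (n - (k : ℕ)) (fun l => f (((k : ℕ) + 1) :: l))
  termination_by n => n

theorem lsT_zero (q : K) (f : List ℕ → K) : lsT q 0 f = f [] := by
  rw [lsT]

theorem lsT_succ (q : K) (n : ℕ) (f : List ℕ → K) : lsT q (n + 1) f = (1 - q ^ (n + 1))⁻¹ *
      ∑ k ∈ Finset.range (n + 1), q ^ (n - k) * lsT q (n - k) (fun l => f ((k + 1) :: l)) := by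
  rw [lsT, Finset.sum_range]

theorem lsT_sum (q : K) {ι : Type*} (s : Finset ι) (c : ι → K) (n : ℕ) :
    ∀ (f : ι → List ℕ → K),
    lsT q n (fun l => ∑ i ∈ s, c i * f i l) = ∑ i ∈ s, c i * lsT q n (f i) := by
  induction n using Nat.strong_induction_on with
  | _ n ih =>
    intro f
    cases n with
    | zero => simp [lsT_zero]
    | succ n =>
      simp only [lsT_succ]
      rw [Finset.sum_congr rfl (fun k hk => by
        rw [ih (n - k) (by omega) (fun i l => f i ((k + 1) :: l))])]
      simp only [Finset.mul_sum]
      rw [Finset.sum_comm]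
      refine Finset.sum_congr rfl fun i _ => Finset.sum_congr rfl fun k _ => ?_
      ring

theorem lsT_congr (q : K) (n : ℕ) :
    ∀ (f g : List ℕ → K), (∀ l, l.sum = n → f l = g l) → lsT q n f = lsT q n g := by
  induction n using Nat.strong_induction_on with
  | _ n ih =>
    intro f g h
    cases n with
    | zero => simp [lsT_zero, h [] rfl]
    | succ n =>
      simp only [lsT_succ]
      congr 1
      refine Finset.sum_congr rfl fun k hk => ?_
      rw [ih (n - k) (by omega)]
      intro l hl
      apply h
      have := Finset.mem_range.1 hk
      simp [hl]; omega

/-- `(q;q)_n` -/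
def qf (q : K) (n : ℕ) : K := ∏ i ∈ Finset.range n, (1 - q ^ (i + 1))

theorem qf_succ (q : K) (n : ℕ) : qf q (n + 1) = qf q n * (1 - q ^ (n + 1)) := by
  simp [qf, Finset.prod_range_succ]

theorem qf_zero (q : K) : qf q 0 = 1 := by simp [qf]

theorem one_sub_ne {q : K} (hq : ∀ n : ℕ, q ^ (n + 1) ≠ 1) (n : ℕ) : 1 - q ^ (n + 1) ≠ 0 :=
  fun h => hq n (sub_eq_zero.1 h).symm

theorem qf_ne {q : K} (hq : ∀ n : ℕ, q ^ (n + 1) ≠ 1) (n : ℕ) : qf q n ≠ 0 :=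
  Finset.prod_ne_zero_iff.2 fun i _ => one_sub_ne hq i

/-- `D` is contained in the set of block boundaries of `l`. -/
def satL (D : Finset ℕ) : List ℕ → Prop
  | [] => True
  | k :: l => (∀ i, l.sum < i → i < l.sum + k → i ∉ D) ∧ satL D l

theorem satL_congr (D D' : Finset ℕ) (l : List ℕ) (h : ∀ i < l.sum, 0 < i → (i ∈ D ↔ i ∈ D')) :
    satL D l ↔ satL D' l := by
  induction l with
  | nil => simp [satL]
  | cons k l ih =>
    simp only [satL]
    rw [ih (fun i hi => h i (by simp; omega))]
    refine and_congr_left fun _ => forall_congr' fun i => forall_congr' fun h1 =>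
      forall_congr' fun h2 => not_congr (h i (by simp; omega) (by omega))

/-- The functional on the indicator of compositions refining `D`. -/
theorem lsT_sat {q : K} (hq : ∀ n : ℕ, q ^ (n + 1) ≠ 1) (D : Finset ℕ) (n : ℕ) :
    lsT q n (fun l => if satL D l then 1 else 0) * qf q n =
      q ^ (∑ i ∈ (Finset.Ico 1 n).filter (· ∈ D), i) := by
  induction n using Nat.strong_induction_on with
  | _ n ih =>
    cases n with
    | zero => simp [lsT_zero, satL, qf_zero]
    | succ n =>
      rw [lsT_succ, qf_succ]
      have h1 := one_sub_ne hq n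
      have : ∀ a b c : K, (1 - q ^ (n + 1))⁻¹ * a * (b * (1 - q ^ (n + 1))) = a * b := by
        intro a b c; field_simp
      rw [this _ _ 1]
      -- telescoping
      have key : ∀ m ≤ n, (∑ k ∈ Finset.range (m + 1), q ^ k * lsT q k
          (fun l => if satL D ((n - k + 1) :: l) then 1 else 0)) * qf q m =
          if (∀ i, m < i → i < n + 1 → i ∉ D) then
            q ^ (∑ i ∈ (Finset.Ico 1 (m + 1)).filter (· ∈ D), i) else 0 := by
        intro m
        induction m with
        | zero =>
          intro _
          simp [lsT_zero, satL, qf_zero]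
        | succ m ihm =>
          intro hm
          rw [Finset.sum_range_succ, add_mul]
          have e2 : lsT q (m + 1) (fun l => if satL D ((n - (m + 1) + 1) :: l) then (1 : K) else 0)
              * qf q (m + 1) = if (∀ i, m + 1 < i → i < n + 1 → i ∉ D) then
               q ^ (∑ i ∈ (Finset.Ico 1 (m + 1)).filter (· ∈ D), i) else 0 := by
            rw [lsT_congr q (m + 1) _ (fun l => if (∀ i, m + 1 < i → i < n + 1 → i ∉ D) then
              (if satL D l then (1 : K) else 0) else 0)]
            · split_ifs with h
              · exact ih (m + 1) (by omega)
              · have := lsT_sum q (∅ : Finset ℕ) (fun _ => (0 : K)) (m + 1) (fun _ _ => 0)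
                simp at this
                simp [this]
            · intro l hl
              have : m + 1 + (n - (m + 1) + 1) = n + 1 := by omega
              simp only [satL, hl, this]
              split_ifs <;> tauto
          have e3 := ihm (by omega)
          rw [mul_assoc (q ^ (m + 1)), e2, qf_succ, ← mul_assoc, e3]
          have e4 : (∀ i, m < i → i < n + 1 → i ∉ D) ↔
              (m + 1 ∉ D ∧ ∀ i, m + 1 < i → i < n + 1 → i ∉ D) := by
            constructor
            · intro h
              exact ⟨h _ (by omega) (by omega), fun i hi => h i (by omega)⟩
            · rintro ⟨h, h'⟩ i hi hi2
              rcases Nat.lt_or_ge (m + 1) i with h3 | h3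
              · exact h' i h3 hi2
              · have : i = m + 1 := by omega
                rwa [this]
          rw [← Finset.insert_Ico_right_eq_Ico_add_one (show 1 ≤ m + 1 by omega), Finset.filter_insert]
          by_cases hD : m + 1 ∈ D
          · have h4 : ¬ (∀ i, m < i → i < n + 1 → i ∉ D) := fun h => (e4.1 h).1 hD
            simp only [h4, hD, if_true, if_false]
            split_ifs
            · rw [Finset.sum_insert (by simp)]; ring
            · ring
          · simp only [e4, hD, if_false, not_false_iff, true_and]
            split_ifs
            · ring
            · ring
      have k2 := key n le_rfl
      rw [← Finset.sum_range_reflect] at k2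
      rw [if_pos (by intro i h h'; omega)] at k2
      rw [← k2]
      congr 1
      refine Finset.sum_congr rfl fun k hk => ?_
      have := Finset.mem_range.1 hk
      have e : n + 1 - 1 - k = n - k := by omega
      have e' : n - (n - k) + 1 = k + 1 := by omega
      rw [e, e']

/-! ### Power series part -/
open PowerSeries

noncomputable def lsVn (q t : K) : ℕ → K
  | 0 => 0
  | n + 1 => (1 - q ^ (n + 1))⁻¹ * ((t - q ^ n) * lsVn q t n + if n = 0 then 1 else 0)

noncomputable def lsV (q t : K) : K⟦X⟧ := PowerSeries.mk (lsVn q t)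

theorem lsV_eq {q : K} (hq : ∀ n : ℕ, q ^ (n + 1) ≠ 1) (t : K) :
    lsV q t * (1 - PowerSeries.C t * PowerSeries.X) = PowerSeries.X + (1 - PowerSeries.X) * rescale q (lsV q t) := by
  ext n
  cases n with
  | zero =>
    have : PowerSeries.coeff 0 (rescale q (lsV q t)) = 0 := by
      rw [coeff_rescale]; simp [lsV, lsVn]
    rw [PowerSeries.coeff_zero_eq_constantCoeff_apply] at this
    simp [this]
    simp [lsV, lsVn]
  | succ n =>
    have h1 := one_sub_ne hq n
    have h2 : (lsV q t * (1 - PowerSeries.C t * PowerSeries.X)) = lsV q t - PowerSeries.C t * (lsV q t * PowerSeries.X) := by ring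
    have h3 : (PowerSeries.X + (1 - PowerSeries.X) * rescale q (lsV q t)) =
      PowerSeries.X + rescale q (lsV q t) - rescale q (lsV q t) * PowerSeries.X := by ring
    rw [h2, h3]
    simp only [map_sub, map_add, PowerSeries.coeff_C_mul, PowerSeries.coeff_succ_mul_X, coeff_rescale, lsV, PowerSeries.coeff_mk,
      lsVn, PowerSeries.coeff_X]
    simp only [Nat.add_eq_right]
    generalize (if n = 0 then (1 : K) else 0) = e
    field_simp
    ring

/-- The inverse of `1 - t PowerSeries.X`. -/
noncomputable def lsW {R : Type*} [CommRing R] (t : R) : R⟦X⟧ := PowerSeries.mk fun n => t ^ n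

theorem lsW_mul {R : Type*} [CommRing R] (t : R) : lsW t * (1 - PowerSeries.C t * PowerSeries.X) = 1 := by
  ext n
  have h2 : (lsW t * (1 - PowerSeries.C t * PowerSeries.X)) = lsW t - PowerSeries.C t * (lsW t * PowerSeries.X) := by ring
  rw [h2]
  cases n with
  | zero => simp [lsW]
  | succ n =>
    simp [lsW, PowerSeries.coeff_succ_mul_X, PowerSeries.coeff_one]; ring

noncomputable def lsP {R : Type*} [CommRing R] (t : R) (s i : ℕ) : R⟦X⟧ :=
  PowerSeries.X ^ (s - i) * (1 - PowerSeries.X) ^ i * lsW t ^ s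

theorem lsV_pow {q : K} (hq : ∀ n : ℕ, q ^ (n + 1) ≠ 1) (t : K) (s : ℕ) :
    lsV q t ^ s = ∑ i ∈ Finset.range (s + 1), PowerSeries.C (s.choose i : K) *
      (lsP t s i * rescale q (lsV q t ^ i)) := by
  have h : lsV q t = (PowerSeries.X + (1 - PowerSeries.X) * rescale q (lsV q t)) * lsW t := by
    rw [← lsV_eq hq, mul_assoc, mul_comm _ (lsW t), lsW_mul, mul_one]
  conv_lhs => rw [h]
  rw [add_comm, mul_pow, add_pow, Finset.sum_mul]
  refine Finset.sum_congr rfl fun i _ => ?_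
  simp only [lsP, map_pow, map_natCast, mul_pow]
  ring

noncomputable def lsv (t : K) : ℕ → List ℕ → K
  | s, [] => if s = 0 then 1 else 0
  | s, k :: l => ∑ i ∈ Finset.range (s + 1), (s.choose i * PowerSeries.coeff k (lsP t s i)) * lsv t i l

theorem lsv_nil (t : K) (s : ℕ) : lsv t s [] = if s = 0 then 1 else 0 := by
  rw [lsv]

theorem lsv_cons (t : K) (s k : ℕ) (l : List ℕ) : lsv t s (k :: l) =
    ∑ i ∈ Finset.range (s + 1), (s.choose i * PowerSeries.coeff k (lsP t s i)) * lsv t i l := by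
  rw [lsv]

theorem lsv_eq_zero (t : K) (l : List ℕ) : ∀ s, l.sum < s → lsv t s l = 0 := by
  induction l with
  | nil => intro s hs; simp at hs; rw [lsv_nil, if_neg (by omega)]
  | cons k l ih =>
    intro s hs
    rw [lsv_cons]
    refine Finset.sum_eq_zero fun i hi => ?_
    simp at hs
    rcases Nat.lt_or_ge l.sum i with h | h
    · rw [ih i h, mul_zero]
    · have : PowerSeries.coeff k (lsP t s i) = 0 := by
        rw [lsP, mul_assoc, PowerSeries.coeff_X_pow_mul', if_neg (by omega)]
      rw [this]; simp

theorem lsT_lsv {q : K} (hq : ∀ n : ℕ, q ^ (n + 1) ≠ 1) (t : K) (n : ℕ) :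
    ∀ s, lsT q n (lsv t s) = PowerSeries.coeff n (lsV q t ^ s) := by
  induction n using Nat.strong_induction_on with
  | _ n ih =>
    intro s
    cases n with
    | zero =>
      simp [lsT_zero, lsv_nil, lsV, lsVn, zero_pow_eq]
    | succ n =>
      have h1 := one_sub_ne hq n
      rw [lsT_succ, inv_mul_eq_iff_eq_mul₀ h1]
      have h2 := congrArg (PowerSeries.coeff (n + 1)) (lsV_pow hq t s)
      simp only [map_sum, PowerSeries.coeff_C_mul] at h2
      simp only [PowerSeries.coeff_mul, coeff_rescale,
        Finset.Nat.sum_antidiagonal_eq_sum_range_succ_mk] at h2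
      simp only [Finset.sum_range_succ' _ (n + 1)] at h2
      simp only [mul_add, Finset.sum_add_distrib] at h2
      have h3 : ∑ i ∈ Finset.range (s + 1), (s.choose i : K) * (PowerSeries.coeff 0 (lsP t s i) *
          (q ^ (n + 1 - 0) * PowerSeries.coeff (n + 1 - 0) (lsV q t ^ i))) =
          q ^ (n + 1) * PowerSeries.coeff (n + 1) (lsV q t ^ s) := by
        rw [Finset.sum_range_succ, Finset.sum_eq_zero]
        · simp [lsP, lsW]
        · intro i hi
          have := Finset.mem_range.1 hi
          have : PowerSeries.coeff 0 (lsP t s i) = 0 := by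
            rw [lsP, mul_assoc, PowerSeries.coeff_X_pow_mul', if_neg (by omega)]
          rw [this]; ring
      rw [h3] at h2
      rw [sub_mul, one_mul, sub_eq_of_eq_add h2]
      rw [Finset.sum_congr rfl (fun k hk => by
        rw [show (fun l => lsv t s ((k + 1) :: l)) = _ from funext (lsv_cons t s (k + 1)),
          lsT_sum, Finset.sum_congr rfl fun i _ => by rw [ih (n - k) (by omega)]])]
      simp only [Finset.mul_sum]
      rw [Finset.sum_comm]
      refine Finset.sum_congr rfl fun i _ => Finset.sum_congr rfl fun k hk => ?_
      rw [show n + 1 - (k + 1) = n - k by omega]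
      ring

noncomputable def lsb (q t : K) (n : ℕ) : K := ∑ i ∈ Finset.range (n + 1), PowerSeries.coeff n (lsV q t ^ i)

theorem lsb_mul (q t : K) : PowerSeries.mk (lsb q t) * (1 - lsV q t) = 1 := by
  have hV : PowerSeries.X ∣ lsV q t := by
    rw [PowerSeries.X_dvd_iff]; simp [lsV, lsVn]
  have hc : ∀ n i, n < i → PowerSeries.coeff n (lsV q t ^ i) = 0 := fun n i h =>
    PowerSeries.X_pow_dvd_iff.1 (pow_dvd_pow_of_dvd hV i) n h
  have hb : ∀ n N, n ≤ N → PowerSeries.coeff n (PowerSeries.mk (lsb q t)) =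
      PowerSeries.coeff n (∑ i ∈ Finset.range (N + 1), lsV q t ^ i) := by
    intro n N h
    rw [PowerSeries.coeff_mk, map_sum, lsb]
    apply Finset.sum_subset
    · intro x; simp; omega
    · intro x _ hx; apply hc; simp at hx; omega
  ext n
  have : PowerSeries.coeff n (PowerSeries.mk (lsb q t) * (1 - lsV q t)) =
      PowerSeries.coeff n ((∑ i ∈ Finset.range (n + 1), lsV q t ^ i) * (1 - lsV q t)) := by
    rw [PowerSeries.coeff_mul, PowerSeries.coeff_mul]
    refine Finset.sum_congr rfl fun x hx => ?_
    rw [hb x.1 n (by have := Finset.HasAntidiagonal.mem_antidiagonal.1 hx; omega)]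
  rw [this, geom_sum_mul_neg, map_sub, hc n (n + 1) (by omega), sub_zero]

theorem lsb_rec {q : K} (hq : ∀ n : ℕ, q ^ (n + 1) ≠ 1) (t : K) (n : ℕ) :
    (1 - q ^ (n + 1)) * lsb q t (n + 1) = lsb q t n - t * q ^ n * lsb q t n +
      t * ∑ k ∈ Finset.range (n + 1), lsb q t k * (q ^ (n - k) * lsb q t (n - k)) := by
  set F := PowerSeries.mk (lsb q t) with hF
  have h1 := lsb_mul q t
  rw [← hF] at h1
  have h2 : rescale q F * (1 - rescale q (lsV q t)) = 1 := by
    rw [← map_one (rescale q), ← map_sub, ← map_mul, h1]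
  have h3 := lsV_eq hq t
  have h4 : F - F * PowerSeries.X = rescale q F - PowerSeries.C t * (rescale q F * PowerSeries.X) + PowerSeries.C t * ((F * rescale q F) * PowerSeries.X) := by
    linear_combination (F * rescale q F) * h3 + (rescale q F * (1 - PowerSeries.C t * PowerSeries.X)) * h1 -
      (F * (1 - PowerSeries.X)) * h2
  have h5 := congrArg (PowerSeries.coeff (n + 1)) h4
  simp only [map_sub, map_add, PowerSeries.coeff_C_mul, PowerSeries.coeff_succ_mul_X] at h5
  simp only [coeff_rescale, PowerSeries.coeff_mul,
        Finset.Nat.sum_antidiagonal_eq_sum_range_succ_mk, hF, PowerSeries.coeff_mk] at h5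
  linear_combination h5

theorem lsb_zero (q t : K) : lsb q t 0 = 1 := by simp [lsb]

end Functional

section Elim
variable {R : Type*} [CommRing R]

noncomputable def lsL (t p : R) {m : ℕ} (b : Fin m) : MvPolynomial (Fin m) R :=
  ∑ a : Fin m, MvPolynomial.C (if a < b then p else if b < a then p + t - 1 else p + t) *
    MvPolynomial.X a

noncomputable def lsB (t p : R) {m : ℕ} (b : Fin m) (k : ℕ) : MvPolynomial (Fin m) R :=
  if k = 0 then 1 else lsL t p b ^ (k - 1) * (lsL t p b - MvPolynomial.C t * MvPolynomial.X b)

noncomputable def lsa (t p : R) {m : ℕ} (N : Fin m → ℕ) : R :=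
  MvPolynomial.coeff (Finsupp.equivFunOnFinite.symm N) (∏ b, lsB t p b (N b))

noncomputable def lsXbar (R : Type*) [CommRing R] (m : ℕ) : MvPolynomial (Fin m) R :=
  ∑ a : Fin m, MvPolynomial.X a

theorem fse_L_zero (t p : R) (m : ℕ) : MvPolynomial.finSuccEquiv R m (lsL t p 0) =
    Polynomial.C (MvPolynomial.C (p + t - 1) * lsXbar R m) +
      Polynomial.C (MvPolynomial.C (p + t)) * Polynomial.X := by
  rw [lsL, Fin.sum_univ_succ, map_add, map_sum, lsXbar, Finset.mul_sum, map_sum, add_comm]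
  congr 1
  · refine Finset.sum_congr rfl fun a _ => ?_
    rw [if_neg (by simp), if_pos (Fin.succ_pos a)]
    simp [MvPolynomial.finSuccEquiv_apply]
  · rw [if_neg (by simp), if_neg (by simp)]
    simp [MvPolynomial.finSuccEquiv_apply]

theorem fse_L_succ (t p : R) (m : ℕ) (b : Fin m) :
    MvPolynomial.finSuccEquiv R m (lsL t p b.succ) =
    Polynomial.C (lsL t p b) + Polynomial.C (MvPolynomial.C p) * Polynomial.X := by
  rw [lsL, Fin.sum_univ_succ, map_add, map_sum, lsL, map_sum, add_comm]
  congr 1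
  · refine Finset.sum_congr rfl fun a _ => ?_
    simp only [Fin.succ_lt_succ_iff]
    simp [MvPolynomial.finSuccEquiv_apply]
  · rw [if_pos (Fin.succ_pos b)]
    simp [MvPolynomial.finSuccEquiv_apply]

noncomputable def lsTheta (R : Type*) [CommRing R] (m : ℕ) :
    Polynomial (MvPolynomial (Fin m) R) →+* MvPolynomial (Fin m) (Polynomial R) :=
  Polynomial.eval₂RingHom (MvPolynomial.map Polynomial.C)
    (MvPolynomial.C Polynomial.X * lsXbar (Polynomial R) m)

theorem map_Xbar (m : ℕ) : MvPolynomial.map (Polynomial.C : R →+* Polynomial R) (lsXbar R m) =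
    lsXbar (Polynomial R) m := by
  simp [lsXbar]

theorem theta_L (t p : R) (m : ℕ) (b : Fin m) :
    lsTheta R m (MvPolynomial.finSuccEquiv R m (lsL t p b.succ)) =
      lsL (Polynomial.C t) (Polynomial.C p * (1 + Polynomial.X)) b := by
  rw [fse_L_succ]
  simp only [lsTheta, map_add, map_mul, Polynomial.coe_eval₂RingHom, Polynomial.eval₂_C,
    Polynomial.eval₂_X, lsL, map_sum, MvPolynomial.map_C, MvPolynomial.map_X, lsXbar,
    Finset.mul_sum]
  rw [← Finset.sum_add_distrib]
  refine Finset.sum_congr rfl fun a _ => ?_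
  rw [← mul_assoc, ← add_mul, ← MvPolynomial.C_mul, ← MvPolynomial.C_add]
  congr 2
  split_ifs <;> (try simp only [map_add, map_sub, map_one]) <;> ring

theorem theta_B (t p : R) (m : ℕ) (b : Fin m) (k : ℕ) :
    lsTheta R m (MvPolynomial.finSuccEquiv R m (lsB t p b.succ k)) =
      lsB (Polynomial.C t) (Polynomial.C p * (1 + Polynomial.X)) b k := by
  unfold lsB
  split_ifs
  · simp
  · rw [map_mul, map_mul, map_pow, map_pow, map_sub, map_sub, theta_L]
    congr 2
    simp [MvPolynomial.finSuccEquiv_apply, lsTheta]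

theorem coeff_theta (m : ℕ) (N : Fin m →₀ ℕ) (Q : Polynomial (MvPolynomial (Fin m) R)) (j : ℕ) :
    (MvPolynomial.coeff N (lsTheta R m Q)).coeff j =
      MvPolynomial.coeff N (lsXbar R m ^ j * Q.coeff j) := by
  induction Q using Polynomial.induction_on' with
  | add P Q hP hQ => simp [mul_add, hP, hQ]
  | monomial i c =>
    have : lsTheta R m (Polynomial.monomial i c) = MvPolynomial.C (Polynomial.X ^ i) *
        MvPolynomial.map Polynomial.C (lsXbar R m ^ i * c) := by
      simp only [lsTheta, Polynomial.coe_eval₂RingHom, Polynomial.eval₂_monomial, mul_pow, map_mul,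
        map_pow, map_Xbar]
      ring
    rw [this, MvPolynomial.coeff_C_mul, MvPolynomial.coeff_map, Polynomial.coeff_X_pow_mul',
      Polynomial.coeff_monomial]
    rcases lt_trichotomy i j with h | h | h
    · rw [if_pos h.le, Polynomial.coeff_C, if_neg (by omega), if_neg (by omega)]; simp
    · subst h; simp
    · rw [if_neg (by omega), if_neg (by omega)]; simp

theorem coeff_affine_pow {S : Type*} [CommRing S] (a d : S) (k i : ℕ) :
    ((Polynomial.C a + Polynomial.C d * Polynomial.X) ^ k).coeff i =
      a ^ (k - i) * d ^ i * (k.choose i : S) := by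
  rw [add_comm, add_pow, Polynomial.finsetSum_coeff]
  have : ∀ j, ((Polynomial.C d * Polynomial.X) ^ j * Polynomial.C a ^ (k - j) *
      (k.choose j : Polynomial S)).coeff i = if j = i then a ^ (k - i) * d ^ i * (k.choose i : S)
        else 0 := by
    intro j
    have e : ((Polynomial.C d * Polynomial.X) ^ j * Polynomial.C a ^ (k - j) *
      (k.choose j : Polynomial S)) = Polynomial.C (a ^ (k - j) * d ^ j * (k.choose j : S)) *
        Polynomial.X ^ j := by
      simp [mul_pow]; ring
    rw [e, Polynomial.coeff_C_mul_X_pow]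
    by_cases h : j = i
    · subst h; simp
    · rw [if_neg h, if_neg (fun h' => h h'.symm)]
  rw [Finset.sum_congr rfl (fun j _ => this j), Finset.sum_ite_eq']
  split_ifs with h
  · rfl
  · rw [Nat.choose_eq_zero_of_lt (by simpa using h)]; simp

theorem coeff_lsW_pow (d : R) (j n : ℕ) :
    PowerSeries.coeff n (lsW d ^ (j + 1)) = ((j + n).choose j : R) * d ^ n := by
  have : lsW d = PowerSeries.rescale d (PowerSeries.mk 1) := by
    ext n; simp [lsW, PowerSeries.coeff_rescale]
  rw [this, ← map_pow, PowerSeries.mk_one_pow_eq_mk_choose_add, PowerSeries.coeff_rescale]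
  simp [mul_comm]

theorem coeff_XW (d r : R) (k j : ℕ) :
    PowerSeries.coeff k ((PowerSeries.C r * PowerSeries.X) ^ j * lsW d ^ (j + 1)) =
      r ^ j * ((k.choose j : R) * d ^ (k - j)) := by
  rw [mul_pow, mul_assoc, ← map_pow, PowerSeries.coeff_C_mul, PowerSeries.coeff_X_pow_mul']
  split_ifs with h
  · rw [coeff_lsW_pow, Nat.add_sub_cancel' h]
  · rw [Nat.choose_eq_zero_of_lt (by omega)]; simp

theorem coeff_B_zero (t p : R) (m k j : ℕ) (hj : j ≤ k) :
    (MvPolynomial.finSuccEquiv R m (lsB t p 0 k)).coeff (k - j) =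
      MvPolynomial.C (PowerSeries.coeff k ((1 - PowerSeries.C t * PowerSeries.X) *
        ((PowerSeries.C (p + t - 1) * PowerSeries.X) ^ j * lsW (p + t) ^ (j + 1)))) *
          lsXbar R m ^ j := by
  cases k with
  | zero =>
    have : j = 0 := by omega
    subst this
    simp [lsB, lsW]
  | succ k =>
    rw [lsB, if_neg (by omega), map_mul, map_pow, map_sub, fse_L_zero]
    set A := Polynomial.C (MvPolynomial.C (p + t - 1) * lsXbar R m) +
      Polynomial.C (MvPolynomial.C (p + t)) * Polynomial.X with hA
    have e1 : MvPolynomial.finSuccEquiv R m (MvPolynomial.C t * MvPolynomial.X 0) =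
      Polynomial.C (MvPolynomial.C t) * Polynomial.X := by
      simp [MvPolynomial.finSuccEquiv_apply]
    rw [e1, show k + 1 - 1 = k by omega,
      show A ^ k * (A - Polynomial.C (MvPolynomial.C t) * Polynomial.X) =
       A ^ (k + 1) - Polynomial.C (MvPolynomial.C t) * (A ^ k * Polynomial.X) by ring]
    rw [Polynomial.coeff_sub, Polynomial.coeff_C_mul, hA, coeff_affine_pow]
    rw [sub_mul, one_mul, mul_assoc (PowerSeries.C t) PowerSeries.X, mul_comm PowerSeries.X (_ * _ ^ (j + 1)), map_sub (PowerSeries.coeff (k + 1)), PowerSeries.coeff_C_mul,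
      PowerSeries.coeff_succ_mul_X, coeff_XW, coeff_XW, Nat.choose_symm hj,
      show k + 1 - (k + 1 - j) = j by omega]
    rcases Nat.lt_or_ge k j with h | h
    · have : j = k + 1 := by omega
      subst this
      simp [mul_pow]
    · rw [show k + 1 - j = (k - j) + 1 by omega, Polynomial.coeff_mul_X, coeff_affine_pow,
        Nat.choose_symm h, show k - (k - j) = j by omega]
      simp only [map_sub, map_mul, map_pow, map_natCast, mul_pow, map_add, map_one]
      ring

theorem lsa_cons (t p : R) {m : ℕ} (k : ℕ) (N : Fin m → ℕ) :
    lsa t p (Fin.cons k N : Fin (m + 1) → ℕ) = ∑ j ∈ Finset.range (k + 1),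
      PowerSeries.coeff k ((1 - PowerSeries.C t * PowerSeries.X) *
        ((PowerSeries.C (p + t - 1) * PowerSeries.X) ^ j * lsW (p + t) ^ (j + 1))) *
      (lsa (Polynomial.C t) (Polynomial.C p * (1 + Polynomial.X)) N).coeff j := by
  have e1 : (Finsupp.equivFunOnFinite.symm (Fin.cons k N : Fin (m + 1) → ℕ)) =
    Finsupp.cons k (Finsupp.equivFunOnFinite.symm N) := by
    ext i
    refine Fin.cases ?_ (fun i => ?_) i <;> simp
  rw [lsa, e1, ← MvPolynomial.finSuccEquiv_coeff_coeff, Fin.prod_univ_succ, map_mul, mul_comm,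
    Polynomial.coeff_mul, Finset.Nat.sum_antidiagonal_eq_sum_range_succ_mk, MvPolynomial.coeff_sum]
  simp only [Fin.cons_zero, Fin.cons_succ]
  refine Finset.sum_congr rfl fun j hj => ?_
  rw [coeff_B_zero t p m k j (by have := Finset.mem_range.1 hj; omega), mul_left_comm,
    MvPolynomial.coeff_C_mul, mul_comm (Polynomial.coeff _ _), ← coeff_theta, map_prod, map_prod]
  simp only [theta_B, lsa]

/-- truncated negative binomial series -/
theorem neg_binom_trunc (Y : R) (k i : ℕ) :
    Y ^ (k + 1) ∣ (1 - Y) ^ (i + 1) * (∑ l ∈ Finset.range (k + 1), ((i + l).choose i : R) * Y ^ l)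
      - 1 := by
  induction i with
  | zero =>
    have : (1 - Y) ^ (0 + 1) * (∑ l ∈ Finset.range (k + 1), ((0 + l).choose 0 : R) * Y ^ l) - 1 =
      Y ^ (k + 1) * (-1) := by
      have := mul_neg_geom_sum Y (k + 1)
      simp
      rw [this]; ring
    rw [this]
    exact dvd_mul_right _ _
  | succ i ih =>
    have h : ∀ k : ℕ, (1 - Y) * (∑ l ∈ Finset.range (k + 1), ((i + 1 + l).choose (i + 1) : R) * Y ^ l) =
      (∑ l ∈ Finset.range (k + 1), ((i + l).choose i : R) * Y ^ l) -
        ((i + 1 + k).choose (i + 1) : R) * Y ^ (k + 1) := by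
      intro k
      induction k with
      | zero => simp
      | succ k ihk =>
        rw [Finset.sum_range_succ, mul_add, ihk, Finset.sum_range_succ _ (k + 1)]
        have : (i + 1 + (k + 1)).choose (i + 1) = (i + (k + 1)).choose i +
          (i + 1 + k).choose (i + 1) := by
          rw [show i + 1 + (k + 1) = (i + 1 + k) + 1 by ring, Nat.choose_succ_succ,
            show i + (k + 1) = i + 1 + k by ring]
        rw [this]
        push_cast
        ring
    rw [pow_succ (1 - Y) (i + 1), mul_assoc, h]
    obtain ⟨z, hz⟩ := ih
    refine ⟨z - (1 - Y) ^ (i + 1) * ((i + 1 + k).choose (i + 1) : R), ?_⟩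
    linear_combination hz

theorem series_expand (t p : R) (k i : ℕ) :
    PowerSeries.coeff k ((1 - PowerSeries.C t * PowerSeries.X) *
      ((1 - PowerSeries.X) ^ i * lsW (p + t) ^ (i + 1))) =
    ∑ l ∈ Finset.range (k + 1), ((i + l).choose i : R) * p ^ l *
      PowerSeries.coeff k (lsP t (i + l) i) := by
  set W := lsW t with hW
  set D := lsW (p + t) with hD
  have hW1 : W * (1 - PowerSeries.C t * PowerSeries.X) = 1 := lsW_mul t
  have hD1 : D * (1 - PowerSeries.C (p + t) * PowerSeries.X) = 1 := lsW_mul (p + t)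
  set Y : PowerSeries R := PowerSeries.C p * PowerSeries.X * W with hY
  obtain ⟨z, hz⟩ := neg_binom_trunc Y k i
  have h1 : (1 - PowerSeries.C (p + t) * PowerSeries.X) =
      (1 - PowerSeries.C t * PowerSeries.X) * (1 - Y) := by
    rw [hY, map_add]
    linear_combination (PowerSeries.C p * PowerSeries.X) * hW1
  set S := ∑ l ∈ Finset.range (k + 1), ((i + l).choose i : PowerSeries R) * Y ^ l with hS
  have h2 : W ^ i * S = (1 - PowerSeries.C t * PowerSeries.X) * D ^ (i + 1) *
      ((1 - Y) ^ (i + 1) * S) := by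
    have h3 : (D * ((1 - PowerSeries.C t * PowerSeries.X) * (1 - Y))) ^ (i + 1) = 1 := by
      rw [← h1, hD1, one_pow]
    have h4 : (W * (1 - PowerSeries.C t * PowerSeries.X)) ^ i = 1 := by rw [hW1, one_pow]
    rw [mul_pow] at h3 h4
    rw [mul_pow] at h3
    calc W ^ i * S = W ^ i * S * (D ^ (i + 1) * ((1 - PowerSeries.C t * PowerSeries.X) ^ (i + 1) *
          (1 - Y) ^ (i + 1))) := by rw [h3, mul_one]
      _ = (W ^ i * (1 - PowerSeries.C t * PowerSeries.X) ^ i) *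
          ((1 - PowerSeries.C t * PowerSeries.X) * D ^ (i + 1) * ((1 - Y) ^ (i + 1) * S)) := by ring
      _ = _ := by rw [h4, one_mul]
  have h5 : (1 - PowerSeries.C t * PowerSeries.X) * ((1 - PowerSeries.X) ^ i * D ^ (i + 1)) =
      (1 - PowerSeries.X) ^ i * (W ^ i * S) - PowerSeries.X ^ (k + 1) *
       ((1 - PowerSeries.X) ^ i * (1 - PowerSeries.C t * PowerSeries.X) * D ^ (i + 1) *
        (PowerSeries.C p * W) ^ (k + 1) * z) := by
    rw [h2, show (1 - Y) ^ (i + 1) * S = 1 + Y ^ (k + 1) * z by linear_combination hz]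
    rw [hY]; ring
  rw [h5, map_sub, PowerSeries.coeff_X_pow_mul', if_neg (by omega), sub_zero, hS, Finset.mul_sum,
    Finset.mul_sum, map_sum]
  refine Finset.sum_congr rfl fun l _ => ?_
  rw [← PowerSeries.coeff_C_mul]
  congr 1
  rw [lsP, hY, show i + l - i = l by omega]
  simp only [map_mul, map_pow, map_natCast]
  ring

theorem series_collapse (t p : R) (k i : ℕ) :
    ∑ j ∈ Finset.range (k + 1), PowerSeries.coeff k ((1 - PowerSeries.C t * PowerSeries.X) *
        ((PowerSeries.C (p + t - 1) * PowerSeries.X) ^ j * lsW (p + t) ^ (j + 1))) *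
          (i.choose j : R) =
    PowerSeries.coeff k ((1 - PowerSeries.C t * PowerSeries.X) *
      ((1 - PowerSeries.X) ^ i * lsW (p + t) ^ (i + 1))) := by
  set D := lsW (p + t) with hD
  have hD1 : D * (1 - PowerSeries.C (p + t) * PowerSeries.X) = 1 := lsW_mul (p + t)
  have h1 : (1 - PowerSeries.X) ^ i * D ^ (i + 1) = ∑ j ∈ Finset.range (i + 1),
      (PowerSeries.C (p + t - 1) * PowerSeries.X) ^ j * D ^ (j + 1) * (i.choose j : PowerSeries R) := by
    have : (1 - PowerSeries.X) * D = PowerSeries.C (p + t - 1) * PowerSeries.X * D + 1 := by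
      simp only [map_sub, map_one]; linear_combination hD1
    rw [pow_succ, ← mul_assoc, ← mul_pow, this, add_pow, Finset.sum_mul]
    refine Finset.sum_congr rfl fun j _ => ?_
    simp only [mul_pow, one_pow]
    ring
  rw [h1, Finset.mul_sum, map_sum]
  set f : ℕ → R := fun j => PowerSeries.coeff k ((1 - PowerSeries.C t * PowerSeries.X) *
        ((PowerSeries.C (p + t - 1) * PowerSeries.X) ^ j * D ^ (j + 1))) *
          (i.choose j : R) with hf
  have h2 : ∀ j, PowerSeries.coeff k ((1 - PowerSeries.C t * PowerSeries.X) *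
      ((PowerSeries.C (p + t - 1) * PowerSeries.X) ^ j * D ^ (j + 1) *
        (i.choose j : PowerSeries R))) = f j := by
    intro j
    rw [hf]
    simp only
    rw [mul_comm _ (i.choose j : R), ← PowerSeries.coeff_C_mul]
    congr 1
    simp only [map_natCast]
    ring
  rw [Finset.sum_congr rfl fun j _ => h2 j]
  have hz1 : ∀ j, i < j → f j = 0 := fun j h => by
    simp [hf, Nat.choose_eq_zero_of_lt h]
  have hz2 : ∀ j, k < j → f j = 0 := fun j h => by
    simp only [hf]
    rw [show (1 - PowerSeries.C t * PowerSeries.X) *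
        ((PowerSeries.C (p + t - 1) * PowerSeries.X) ^ j * D ^ (j + 1)) = PowerSeries.X ^ j *
        ((1 - PowerSeries.C t * PowerSeries.X) * PowerSeries.C (p + t - 1) ^ j * D ^ (j + 1)) by
          ring, PowerSeries.coeff_X_pow_mul', if_neg (by omega), zero_mul]
  have e1 : ∑ j ∈ Finset.range (k + 1), f j = ∑ j ∈ Finset.range (k + i + 1), f j :=
    Finset.sum_subset (fun x => by simp; omega) (fun x _ h => hz2 x (by simp at h; omega))
  have e2 : ∑ j ∈ Finset.range (i + 1), f j = ∑ j ∈ Finset.range (k + i + 1), f j :=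
    Finset.sum_subset (fun x => by simp; omega) (fun x _ h => hz1 x (by simp at h; omega))
  rw [e1, e2]

theorem lsa_fin {K : Type*} [Field K] (t : K) : ∀ (m : ℕ) (N : Fin m → ℕ) {S : Type*} [CommRing S]
    [Algebra K S] (p : S) (M : ℕ), (List.ofFn N).sum ≤ M →
    lsa (algebraMap K S t) p N = ∑ i ∈ Finset.range (M + 1),
      p ^ i * algebraMap K S (lsv t i (List.ofFn N)) := by
  intro m
  induction m with
  | zero =>
    intro N S _ _ p M _
    simp only [lsa, List.ofFn_zero, lsv_nil, Finset.univ_eq_empty, Finset.prod_empty]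
    rw [Finset.sum_range_succ', Finset.sum_eq_zero (by simp)]
    have : (Finsupp.equivFunOnFinite.symm N) = 0 := Subsingleton.elim _ _
    rw [this]
    simp
  | succ m ih =>
    intro N S _ _ p M hM
    obtain ⟨k, N', rfl⟩ : ∃ k N', N = Fin.cons k N' := ⟨N 0, Fin.tail N, (Fin.cons_self_tail N).symm⟩
    simp only [List.ofFn_succ, Fin.cons_zero, Fin.cons_succ, List.sum_cons] at hM ⊢
    set l := List.ofFn N' with hl
    rw [lsa_cons]
    have h1 : ∀ j, (lsa (Polynomial.C (algebraMap K S t))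
        (Polynomial.C p * (1 + Polynomial.X)) N').coeff j =
        ∑ i ∈ Finset.range (l.sum + 1), p ^ i * algebraMap K S (lsv t i l) * (i.choose j : S) := by
      intro j
      have := ih N' (S := Polynomial S) (Polynomial.C p * (1 + Polynomial.X)) l.sum le_rfl
      rw [Polynomial.algebraMap_apply] at this
      rw [this, Polynomial.finsetSum_coeff]
      refine Finset.sum_congr rfl fun i _ => ?_
      rw [Polynomial.algebraMap_apply, mul_pow, mul_right_comm, ← Polynomial.C_pow,
        ← Polynomial.C_mul, Polynomial.coeff_C_mul, Polynomial.coeff_one_add_X_pow]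
    simp only [h1, Finset.mul_sum]
    rw [Finset.sum_comm]
    have h2 : ∀ i, ∑ j ∈ Finset.range (k + 1), PowerSeries.coeff k
        ((1 - PowerSeries.C (algebraMap K S t) * PowerSeries.X) *
        ((PowerSeries.C (p + algebraMap K S t - 1) * PowerSeries.X) ^ j *
          lsW (p + algebraMap K S t) ^ (j + 1))) *
        (p ^ i * algebraMap K S (lsv t i l) * (i.choose j : S)) =
        p ^ i * algebraMap K S (lsv t i l) * ∑ l ∈ Finset.range (k + 1), ((i + l).choose i : S) *
         p ^ l * PowerSeries.coeff k (lsP (algebraMap K S t) (i + l) i) := by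
      intro i
      rw [← series_expand, ← series_collapse, Finset.mul_sum]
      refine Finset.sum_congr rfl fun j _ => ?_
      ring
    rw [Finset.sum_congr rfl fun i _ => h2 i]
    have hP : ∀ s i, PowerSeries.coeff k (lsP (algebraMap K S t) s i) =
        algebraMap K S (PowerSeries.coeff k (lsP t s i)) := by
      intro s i
      have : lsP (algebraMap K S t) s i = PowerSeries.map (algebraMap K S) (lsP t s i) := by
        have hw : lsW (algebraMap K S t) = PowerSeries.map (algebraMap K S) (lsW t) := by
          ext n; simp [lsW]
        simp [lsP, hw]
      rw [this, PowerSeries.coeff_map]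
    simp only [lsv_cons, hP, map_sum, Finset.mul_sum, map_mul, map_natCast]
    -- both sides as a double sum
    set g : ℕ → ℕ → S := fun s i => p ^ s * ((s.choose i : S) *
      algebraMap K S (PowerSeries.coeff k (lsP t s i)) * algebraMap K S (lsv t i l)) with hg
    have hL : ∀ i ∈ Finset.range (l.sum + 1), ∑ x ∈ Finset.range (k + 1),
        p ^ i * algebraMap K S (lsv t i l) * (((i + x).choose i : S) *
         p ^ x * algebraMap K S (PowerSeries.coeff k (lsP t (i + x) i))) =
        ∑ s ∈ Finset.range (M + 1), if i ≤ s then g s i else 0 := by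
      intro i hi
      have hi' := Finset.mem_range.1 hi
      rw [← Finset.sum_filter]
      have e : (Finset.range (M + 1)).filter (fun s => i ≤ s) = Finset.Ico i (M + 1) := by
        ext s; simp; omega
      rw [e, Finset.sum_Ico_eq_sum_range]
      refine (Finset.sum_congr rfl fun x _ => ?_).trans
        (Finset.sum_subset (f := fun x => g (i + x) i)
          (show Finset.range (k + 1) ⊆ Finset.range (M + 1 - i) by intro x; simp; omega) ?_)
      · simp only [hg, pow_add]; ring
      · intro x _ hx
        have : PowerSeries.coeff k (lsP t (i + x) i) = 0 := by
          rw [lsP, mul_assoc, PowerSeries.coeff_X_pow_mul', if_neg (by simp at hx; omega)]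
        simp [hg, this]
    rw [Finset.sum_congr rfl hL, Finset.sum_comm]
    refine Finset.sum_congr rfl fun s _ => ?_
    rw [← Finset.sum_filter]
    apply Finset.sum_subset_zero_on_sdiff
    · intro x; simp
    · intro x hx
      have : lsv t x l = 0 := lsv_eq_zero t l x (by simp at hx; omega)
      simp [this]
    · intro x _; rfl

end Elim

/-! ### Words and permutations -/
section Words

/-- the key of position `i`: excedances come first -/
noncomputable def lsKey {n : ℕ} (σ : Equiv.Perm (Fin n)) (i : Fin n) : ℕ :=
  if i < σ i then (σ i : ℕ) else n + σ i

def lsGood {n m : ℕ} (c : Fin n → Fin m) (σ : Equiv.Perm (Fin n)) : Prop :=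
  ∀ i j, i < j → c i = c j → lsKey σ i < lsKey σ j

def lsFirst {n m : ℕ} (c : Fin n → Fin m) (j : Fin n) : Prop := ∀ i, i < j → c i ≠ c j

def lsAllowed {n m : ℕ} (c : Fin n → Fin m) (j : Fin n) (x : Fin m × Bool) : Prop :=
  (x.2 = true → c j ≤ x.1 ∧ ¬ (lsFirst c j ∧ x.1 = c j)) ∧ (x.2 = false → x.1 ≤ c j)

noncomputable def lsWord {n m : ℕ} (c : Fin n → Fin m) (σ : Equiv.Perm (Fin n)) :
    Fin n → Fin m × Bool :=
  fun j => (c (σ.symm j), decide (σ.symm j < j))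

theorem lsWord_allowed {n m : ℕ} (c : Fin n → Fin m) (hc : Antitone c) (σ : Equiv.Perm (Fin n))
    (j : Fin n) : lsAllowed c j (lsWord c σ j) := by
  constructor
  · intro h
    have h : σ.symm j < j := by simpa [lsWord] using h
    refine ⟨hc h.le, fun h2 => h2.1 _ h h2.2⟩
  · intro h
    have h : j ≤ σ.symm j := by simpa [lsWord] using h
    exact hc h

noncomputable def lsRank {m : ℕ} (x : Fin m × Bool) : ℕ :=
  2 * (m - x.1) + (if x.2 = true then 0 else 1)

theorem lsRank_inj {m : ℕ} (x y : Fin m × Bool) (h : lsRank x = lsRank y) : x = y := by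
  obtain ⟨a, b⟩ := x
  obtain ⟨a', b'⟩ := y
  have := a.2
  have := a'.2
  simp only [lsRank] at h
  have h1 : a = a' := by
    apply Fin.ext
    split_ifs at h <;> omega
  subst h1
  cases b <;> cases b' <;> simp_all

theorem lsRank_le {m : ℕ} (x y : Fin m × Bool) (h : lsRank x ≤ lsRank y) :
    y.1 ≤ x.1 ∧ (x.1 = y.1 → y.2 = true → x.2 = true) := by
  obtain ⟨a, b⟩ := x
  obtain ⟨a', b'⟩ := y
  have := a.2
  have := a'.2
  simp only [lsRank] at h ⊢
  refine ⟨?_, ?_⟩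
  · rw [Fin.le_def]
    split_ifs at h <;> omega
  · rintro rfl rfl
    by_contra hb
    simp [hb] at h

theorem lsWord_sort {n m : ℕ} (c : Fin n → Fin m) (hc : Antitone c) (σ : Equiv.Perm (Fin n))
    (hσ : lsGood c σ) : σ = Tuple.sort (fun j => lsRank (lsWord c σ j)) := by
  rw [Tuple.eq_sort_iff]
  constructor
  · intro i j hij
    rcases hij.eq_or_lt with rfl | hij
    · exact le_rfl
    simp only [Function.comp_apply, lsRank, lsWord, Equiv.symm_apply_apply]
    rcases (hc hij.le).lt_or_eq with h | h
    · have h2 := (c i).2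
      have h3 := (c j).2
      rw [Fin.lt_def] at h
      split_ifs <;> omega
    · have hk := hσ i j hij h.symm
      rw [h]
      have := (σ i).2
      have := (σ j).2
      simp only [lsKey] at hk
      simp only [decide_eq_true_eq]
      split_ifs at hk ⊢ <;> omega
  · intro i j hij he
    have he := lsRank_inj _ _ he
    simp only [lsWord, Equiv.symm_apply_apply, Prod.mk.injEq, decide_eq_decide] at he
    have hk := hσ i j hij he.1
    simp only [lsKey] at hk
    rw [Fin.lt_def]
    by_cases h : i < σ i
    · rw [if_pos h, if_pos (he.2.1 h)] at hk
      exact hk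
    · rw [if_neg h, if_neg (fun h' => h (he.2.2 h'))] at hk
      omega

theorem antitone_eq {n m : ℕ} (g c : Fin n → Fin m) (hg : Antitone g) (hc : Antitone c)
    (h : ∀ a, (Finset.univ.filter fun j => g j = a).card = (Finset.univ.filter fun j => c j = a).card) :
    g = c := by
  have key : ∀ b : Fin m, (Finset.univ.filter fun j => b ≤ g j) = (Finset.univ.filter fun j => b ≤ c j) := by
    intro b
    have hcard : (Finset.univ.filter fun j => b ≤ g j).card = (Finset.univ.filter fun j => b ≤ c j).card := by
      have e : ∀ g : Fin n → Fin m, (Finset.univ.filter fun j => b ≤ g j).card =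
          ∑ a ∈ Finset.univ.filter (fun a => b ≤ a), (Finset.univ.filter fun j => g j = a).card := by
        intro g
        rw [Finset.card_eq_sum_card_fiberwise (f := g) (t := Finset.univ.filter (fun a => b ≤ a))]
        · refine Finset.sum_congr rfl fun a ha => ?_
          congr 1
          ext j
          simp only [Finset.mem_filter, Finset.mem_univ, true_and] at ha ⊢
          constructor
          · exact fun h => h.2
          · rintro rfl
            exact ⟨ha, rfl⟩
        · intro j hj
          simpa using hj
      rw [e, e]
      exact Finset.sum_congr rfl fun a _ => h a
    have l1 : ∀ g : Fin n → Fin m, Antitone g →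
        IsLowerSet ((Finset.univ.filter fun j => b ≤ g j : Finset (Fin n)) : Set (Fin n)) := by
      intro g hg x y hxy hx
      simp only [Finset.coe_filter, Finset.mem_univ, true_and, Set.mem_ofPred_eq] at hx ⊢
      exact hx.trans (hg hxy)
    rcases (l1 g hg).total (l1 c hc) with h | h
    · exact Finset.eq_of_subset_of_card_le (by exact_mod_cast h) hcard.ge
    · exact (Finset.eq_of_subset_of_card_le (by exact_mod_cast h) hcard.le).symm
  funext j
  apply le_antisymm
  · have := Finset.ext_iff.1 (key (g j)) j
    simpa using this
  · have := Finset.ext_iff.1 (key (c j)) j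
    simpa using this

theorem lsWord_surj {n m : ℕ} (c : Fin n → Fin m) (hc : Antitone c) (w : Fin n → Fin m × Bool)
    (hw : ∀ j, lsAllowed c j (w j))
    (hcont : ∀ a, (Finset.univ.filter fun j => (w j).1 = a).card =
      (Finset.univ.filter fun j => c j = a).card) :
    ∃ σ, lsGood c σ ∧ lsWord c σ = w := by
  obtain ⟨hmono, hties⟩ := Tuple.eq_sort_iff.1 (Eq.refl (Tuple.sort (fun j => lsRank (w j))))
  generalize Tuple.sort (fun j => lsRank (w j)) = σ at hmono hties
  have hgc : (fun i => (w (σ i)).1) = c := by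
    refine antitone_eq _ _ (fun i j hij => (lsRank_le _ _ (hmono hij)).1) hc fun a => ?_
    rw [← hcont]
    refine Finset.card_bij (fun i _ => σ i) ?_ ?_ ?_
    · intro i hi; simpa using hi
    · intro i _ j _ h; exact σ.injective h
    · intro j hj
      exact ⟨σ.symm j, by simpa using hj, by simp⟩
  have hg : ∀ i, (w (σ i)).1 = c i := fun i => congrFun hgc i
  have hinc : ∀ i j, i < j → c i = c j → (w (σ i)).2 = (w (σ j)).2 → σ i < σ j := by
    intro i j hij h1 h2
    refine hties i j hij ?_
    show lsRank _ = lsRank _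
    congr 1
    exact Prod.ext (by rw [hg, hg, h1]) h2
  have hb : ∀ k : ℕ, ∀ i : Fin n, (i : ℕ) = k → (w (σ i)).2 = true → i < σ i := by
    intro k
    induction k using Nat.strong_induction_on with
    | _ k ih =>
    intro i hik hi
    obtain ⟨h1, h2⟩ := (hw (σ i)).1 hi
    rw [hg] at h1 h2
    rcases h1.lt_or_eq with h | h
    · by_contra hcon
      exact absurd (hc (not_lt.1 hcon)) (not_le.2 h)
    · by_cases hf : ∀ i₀, i₀ < i → c i₀ ≠ c i
      · have : ∃ i₀, i₀ < σ i ∧ c i₀ = c (σ i) := by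
          by_contra hne
          push Not at hne
          exact h2 ⟨hne, h.symm⟩
        obtain ⟨i₀, h3, h4⟩ := this
        by_contra hcon
        exact hf i₀ (lt_of_lt_of_le h3 (not_lt.1 hcon)) (h4.trans h)
      · push Not at hf
        obtain ⟨i₀, h3, h4⟩ := hf
        have hipos : 0 < (i : ℕ) := by
          have : (i₀ : ℕ) < i := h3
          omega
        have hp : (i : ℕ) - 1 < n := by have := i.2; omega
        have h5 : c ⟨i - 1, hp⟩ = c i := by
          apply le_antisymm
          · rw [← h4]
            refine hc ?_
            rw [Fin.le_def]
            have : (i₀ : ℕ) < i := h3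
            simp only
            omega
          · refine hc ?_
            rw [Fin.le_def]
            simp
        have h6 : (⟨i - 1, hp⟩ : Fin n) < i := by
          rw [Fin.lt_def]
          simp only
          omega
        have h7 : (w (σ ⟨i - 1, hp⟩)).2 = true :=
          (lsRank_le _ _ (hmono h6.le)).2 (by rw [hg, hg, h5]) hi
        have h8 := hinc _ _ h6 h5 (h7.trans hi.symm)
        have h9 := ih (i - 1) (by omega) ⟨i - 1, hp⟩ rfl h7
        rw [Fin.lt_def] at h8 h9 ⊢
        simp only at h8 h9
        omega
  have hu : ∀ k : ℕ, ∀ i : Fin n, (i : ℕ) + k = n → (w (σ i)).2 = false → σ i ≤ i := by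
    intro k
    induction k using Nat.strong_induction_on with
    | _ k ih =>
    intro i hik hi
    have h1 := (hw (σ i)).2 hi
    rw [hg] at h1
    rcases h1.lt_or_eq with h | h
    · by_contra hcon
      exact absurd (hc (not_le.1 hcon).le) (not_le.2 h)
    · by_contra hcon
      rw [not_le] at hcon
      have hcon' : (i : ℕ) < σ i := hcon
      have hp : (i : ℕ) + 1 < n := by have := (σ i).2; omega
      have h6 : i < (⟨i + 1, hp⟩ : Fin n) := by
        rw [Fin.lt_def]
        simp
      have h5 : c i = c ⟨i + 1, hp⟩ := by
        apply le_antisymm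
        · rw [h]
          refine hc ?_
          rw [Fin.le_def]
          simp only
          omega
        · exact hc h6.le
      have h7 : (w (σ ⟨i + 1, hp⟩)).2 = false := by
        by_contra hne
        rw [Bool.not_eq_false] at hne
        have := (lsRank_le _ _ (hmono h6.le)).2 (by rw [hg, hg, h5]) hne
        rw [hi] at this
        exact absurd this (by simp)
      have h8 := hinc _ _ h6 h5 (hi.trans h7.symm)
      have h9 := ih (k - 1) (by omega) ⟨i + 1, hp⟩ (by simp only; omega) h7
      rw [Fin.lt_def] at h8
      rw [Fin.le_def] at h9
      simp only at h8 h9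
      omega
  have hbar : ∀ i, decide (i < σ i) = (w (σ i)).2 := by
    intro i
    cases h : (w (σ i)).2 with
    | true => simpa using hb _ i rfl h
    | false => simpa using hu (n - i) i (by have := i.2; omega) h
  refine ⟨σ, ?_, ?_⟩
  · intro i j hij hcij
    have hle := (lsRank_le _ _ (hmono hij.le)).2 (by rw [hg, hg, hcij])
    rw [← hbar, ← hbar] at hle
    simp only [decide_eq_true_eq] at hle
    have hi := hinc i j hij hcij
    rw [← hbar, ← hbar] at hi
    have := (σ i).2
    have := (σ j).2
    simp only [lsKey]
    by_cases h1 : i < σ i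
    · by_cases h2 : j < σ j
      · rw [if_pos h1, if_pos h2]
        exact hi (by simp [h1, h2])
      · rw [if_pos h1, if_neg h2]
        omega
    · have h2 : ¬ j < σ j := fun h => h1 (hle h)
      rw [if_neg h1, if_neg h2]
      have : σ i < σ j := hi (by simp [h1, h2])
      rw [Fin.lt_def] at this
      omega
  · funext j
    have h1 := hg (σ.symm j)
    have h2 := hbar (σ.symm j)
    rw [Equiv.apply_symm_apply] at h1 h2
    exact Prod.ext h1.symm h2

end Words

section WordSum
variable {R : Type*} [CommRing R]

noncomputable def lsWt (t : R) {n m : ℕ} (c : Fin n → Fin m) (j : Fin n) (x : Fin m × Bool) : R :=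
  if lsAllowed c j x then (if x.2 = true then t else 1) else 0

theorem factor_expand (t : R) {n m : ℕ} (c : Fin n → Fin m) (j : Fin n) :
    lsL t 1 (c j) - (if lsFirst c j then MvPolynomial.C t * MvPolynomial.X (c j) else 0) =
      ∑ x : Fin m × Bool, MvPolynomial.C (lsWt t c j x) * MvPolynomial.X x.1 := by
  have e : (if lsFirst c j then MvPolynomial.C t * MvPolynomial.X (c j) else 0) =
      ∑ a : Fin m, MvPolynomial.C (if lsFirst c j ∧ a = c j then t else 0) *
        (MvPolynomial.X a : MvPolynomial (Fin m) R) := by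
    rw [Finset.sum_eq_single (c j)]
    · split_ifs with h h2 h2
      · rfl
      · exact absurd ⟨h, rfl⟩ h2
      · exact absurd h2.1 h
      · simp
    · intro b _ hb
      rw [if_neg (fun h => hb h.2)]
      simp
    · simp
  rw [e, lsL, ← Finset.sum_sub_distrib, Fintype.sum_prod_type]
  refine Finset.sum_congr rfl fun a _ => ?_
  rw [Fintype.sum_bool, ← sub_mul, ← add_mul, ← MvPolynomial.C_sub, ← MvPolynomial.C_add]
  congr 2
  simp only [lsWt, lsAllowed, if_true]
  rcases lt_trichotomy a (c j) with h | h | h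
  · simp [h, h.le, h.ne, not_le.2 h]
  · subst h
    by_cases hf : lsFirst c j
    · simp [hf]
    · simp [hf, add_comm]
  · simp [h, h.le, h.ne', not_le.2 h, not_lt.2 h.le]

theorem prod_lsB (t : R) {n m : ℕ} (c : Fin n → Fin m) :
    ∏ b, lsB t 1 b ((Finset.univ.filter fun j => c j = b).card) =
      ∏ j, (lsL t 1 (c j) -
        (if lsFirst c j then MvPolynomial.C t * MvPolynomial.X (c j) else 0)) := by
  rw [← Finset.prod_fiberwise (Finset.univ) c]
  refine Finset.prod_congr rfl fun b _ => ?_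
  set s := Finset.univ.filter fun j => c j = b with hs
  rcases s.eq_empty_or_nonempty with h | h
  · rw [h]
    simp [lsB]
  · have hm := s.min'_mem h
    have hcm : c (s.min' h) = b := (Finset.mem_filter.1 hm).2
    have hfirst : ∀ j ∈ s, (lsFirst c j ↔ j = s.min' h) := by
      intro j hj
      have hcj : c j = b := (Finset.mem_filter.1 hj).2
      constructor
      · intro hf
        by_contra hne
        exact hf _ (lt_of_le_of_ne (s.min'_le j hj) (Ne.symm hne)) (hcm.trans hcj.symm)
      · rintro hj2 i hi hci
        have : i ∈ s := by
          rw [hs, Finset.mem_filter]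
          exact ⟨Finset.mem_univ _, hci.trans hcj⟩
        have := s.min'_le i this
        rw [← hj2] at this
        exact absurd hi (not_lt.2 this)
    rw [← Finset.mul_prod_erase s _ hm, lsB, if_neg (Finset.card_pos.2 h).ne',
      if_pos ((hfirst _ hm).2 rfl), hcm, mul_comm]
    congr 1
    rw [← Finset.card_erase_of_mem hm, ← Finset.prod_const]
    refine Finset.prod_congr rfl fun j hj => ?_
    have hjs := Finset.mem_of_mem_erase hj
    rw [if_neg (fun hf => Finset.ne_of_mem_erase hj ((hfirst j hjs).1 hf)), sub_zero,
      (Finset.mem_filter.1 hjs).2]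

theorem prod_lsWt (t : R) {n m : ℕ} (c : Fin n → Fin m) (w : Fin n → Fin m × Bool) :
    ∏ j, lsWt t c j (w j) = if ∀ j, lsAllowed c j (w j) then
      t ^ (Finset.univ.filter fun j => (w j).2 = true).card else 0 := by
  split_ifs with h
  · rw [← Finset.prod_const, Finset.prod_filter]
    refine Finset.prod_congr rfl fun j _ => ?_
    rw [lsWt, if_pos (h j)]
  · push Not at h
    obtain ⟨j, hj⟩ := h
    refine Finset.prod_eq_zero (Finset.mem_univ j) ?_
    rw [lsWt, if_neg hj]

theorem coeff_prod_words (t : R) {n m : ℕ} (c : Fin n → Fin m) (N : Fin m → ℕ) :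
    MvPolynomial.coeff (Finsupp.equivFunOnFinite.symm N)
      (∏ j, ∑ x : Fin m × Bool, MvPolynomial.C (lsWt t c j x) * MvPolynomial.X x.1) =
    ∑ w : Fin n → Fin m × Bool,
      if (∀ j, lsAllowed c j (w j)) ∧ (∀ a, (Finset.univ.filter fun j => (w j).1 = a).card = N a)
      then t ^ (Finset.univ.filter fun j => (w j).2 = true).card else 0 := by
  rw [Finset.prod_univ_sum, Fintype.piFinset_univ, MvPolynomial.coeff_sum]
  refine Finset.sum_congr rfl fun w _ => ?_
  rw [Finset.prod_mul_distrib, ← map_prod, MvPolynomial.coeff_C_mul, prod_lsWt]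
  have e : (∏ j, MvPolynomial.X (w j).1 : MvPolynomial (Fin m) R) =
      MvPolynomial.monomial (∑ j, Finsupp.single (w j).1 1) 1 := by
    rw [MvPolynomial.monomial_sum_one]
    rfl
  rw [e, MvPolynomial.coeff_monomial]
  have e2 : (∑ j, Finsupp.single (w j).1 1 = Finsupp.equivFunOnFinite.symm N) ↔
      (∀ a, (Finset.univ.filter fun j => (w j).1 = a).card = N a) := by
    rw [Finsupp.ext_iff]
    refine forall_congr' fun a => ?_
    rw [Finsupp.finsetSum_apply, Finset.card_filter]
    simp [Finsupp.single_apply]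
  by_cases h1 : ∀ j, lsAllowed c j (w j)
  · by_cases h2 : (∀ a, (Finset.univ.filter fun j => (w j).1 = a).card = N a)
    · rw [if_pos h1, if_pos (e2.2 h2), if_pos ⟨h1, h2⟩, mul_one]
    · rw [if_neg (fun h => h2 (e2.1 h)), mul_zero, if_neg (fun h => h2 h.2)]
  · rw [if_neg h1, zero_mul, if_neg (fun h => h1 h.1)]

theorem words_sum (t : R) {n m : ℕ} (c : Fin n → Fin m) (hc : Antitone c) :
    (∑ σ : Equiv.Perm (Fin n), if lsGood c σ then t ^ excP σ else 0) =
      lsa t 1 (fun b => (Finset.univ.filter fun j => c j = b).card) := by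
  rw [lsa, prod_lsB]
  simp only [factor_expand]
  rw [coeff_prod_words, ← Finset.sum_filter, ← Finset.sum_filter]
  refine Finset.sum_bij (fun σ _ => lsWord c σ) ?_ ?_ ?_ ?_
  · intro σ _
    rw [Finset.mem_filter]
    refine ⟨Finset.mem_univ _, lsWord_allowed c hc σ, fun a => ?_⟩
    refine Finset.card_bij (fun i _ => σ.symm i) ?_ ?_ ?_
    · intro i hi
      exact Finset.mem_filter.2 ⟨Finset.mem_univ _, (Finset.mem_filter.1 hi).2⟩
    · intro i _ j _ h; exact σ.symm.injective h
    · intro j hj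
      refine ⟨σ j, Finset.mem_filter.2 ⟨Finset.mem_univ _, ?_⟩, by simp⟩
      simpa only [lsWord, Equiv.symm_apply_apply] using (Finset.mem_filter.1 hj).2
  · intro σ hσ τ hτ h
    rw [lsWord_sort c hc σ (Finset.mem_filter.1 hσ).2, lsWord_sort c hc τ (Finset.mem_filter.1 hτ).2, h]
  · intro w hw
    obtain ⟨h1, h2⟩ := (Finset.mem_filter.1 hw).2
    obtain ⟨σ, h3, h4⟩ := lsWord_surj c hc w h1 h2
    exact ⟨σ, Finset.mem_filter.2 ⟨Finset.mem_univ _, h3⟩, h4⟩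
  · intro σ _
    congr 1
    rw [excP]
    refine Finset.card_bij (fun i _ => σ i) ?_ ?_ ?_
    · intro i hi; simpa [lsWord] using hi
    · intro i _ j _ h; exact σ.injective h
    · intro j hj
      exact ⟨σ.symm j, by simpa [lsWord] using hj, by simp⟩

end WordSum

/-! ### Blocks of a composition, and the set `DEX` -/
section Blocks

def lsBlk : List ℕ → ℕ → ℕ
  | [], _ => 0
  | _ :: l, j => if l.sum ≤ j then 0 else lsBlk l j + 1

theorem lsBlk_lt : ∀ (l : List ℕ) (j : ℕ), j < l.sum → lsBlk l j < l.length
  | [], j, h => by simp at h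
  | k :: l, j, h => by
    rw [lsBlk, List.length_cons]
    split_ifs with h1
    · omega
    · have := lsBlk_lt l j (by omega)
      omega

theorem lsBlk_anti : ∀ (l : List ℕ) (i j : ℕ), i ≤ j → lsBlk l j ≤ lsBlk l i
  | [], _, _, _ => le_rfl
  | k :: l, i, j, h => by
    rw [lsBlk, lsBlk]
    have := lsBlk_anti l i j h
    split_ifs <;> omega

theorem lsBlk_card : ∀ (l : List ℕ) (b : ℕ) (hb : b < l.length),
    ((Finset.range l.sum).filter fun j => lsBlk l j = b).card = l[b]
  | [], b, hb => by simp at hb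
  | k :: l, 0, hb => by
    have : ((Finset.range (k :: l).sum).filter fun j => lsBlk (k :: l) j = 0) =
        Finset.Ico l.sum (l.sum + k) := by
      ext j
      rw [Finset.mem_filter, Finset.mem_range, Finset.mem_Ico, lsBlk, List.sum_cons]
      constructor
      · rintro ⟨h1, h2⟩
        split_ifs at h2 with h3
        exact ⟨h3, by omega⟩
      · rintro ⟨h1, h2⟩
        exact ⟨by omega, if_pos h1⟩
    rw [this]
    simp
  | k :: l, b + 1, hb => by
    have : ((Finset.range (k :: l).sum).filter fun j => lsBlk (k :: l) j = b + 1) =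
        ((Finset.range l.sum).filter fun j => lsBlk l j = b) := by
      ext j
      rw [Finset.mem_filter, Finset.mem_filter, Finset.mem_range, Finset.mem_range, lsBlk,
        List.sum_cons]
      constructor
      · rintro ⟨h1, h2⟩
        split_ifs at h2 with h3
        exact ⟨by omega, by omega⟩
      · rintro ⟨h1, h2⟩
        exact ⟨by omega, by rw [if_neg (by omega), h2]⟩
    rw [this, lsBlk_card l b (by simpa using hb)]
    simp

theorem satL_iff (D : Finset ℕ) : ∀ l : List ℕ, satL D l ↔
    ∀ j, 1 ≤ j → j < l.sum → lsBlk l (j - 1) = lsBlk l j → j ∉ D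
  | [] => by simp [satL]
  | k :: l => by
    rw [satL, satL_iff D l]
    constructor
    · rintro ⟨h1, h2⟩ j hj1 hj2 hb
      rw [List.sum_cons] at hj2
      rw [lsBlk, lsBlk] at hb
      by_cases h3 : l.sum ≤ j - 1
      · exact h1 j (by omega) (by omega)
      · rw [if_neg h3] at hb
        by_cases h4 : l.sum ≤ j
        · rw [if_pos h4] at hb
          omega
        · rw [if_neg h4] at hb
          exact h2 j hj1 (by omega) (by omega)
    · intro h
      constructor
      · intro i h1 h2
        refine h i (by omega) (by rw [List.sum_cons]; omega) ?_
        rw [lsBlk, lsBlk, if_pos (by omega), if_pos (by omega)]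
      · intro j h1 h2 hb
        refine h j h1 (by rw [List.sum_cons]; omega) ?_
        rw [lsBlk, lsBlk, if_neg (by omega), if_neg (by omega), hb]

/-- extension of a permutation to `ℕ` -/
noncomputable def lsExt {n : ℕ} (σ : Equiv.Perm (Fin n)) (i : ℕ) : ℕ :=
  if h : i < n then (σ ⟨i, h⟩ : ℕ) else i

noncomputable def lsKeyN {n : ℕ} (σ : Equiv.Perm (Fin n)) (i : ℕ) : ℕ :=
  if i < lsExt σ i then lsExt σ i else n + lsExt σ i

noncomputable def lsD {n : ℕ} (σ : Equiv.Perm (Fin n)) : Finset ℕ :=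
  (Finset.Ico 1 n).filter fun j => lsKeyN σ j < lsKeyN σ (j - 1)

theorem lsExt_lt {n : ℕ} (σ : Equiv.Perm (Fin n)) (i : ℕ) (h : i < n) : lsExt σ i < n := by
  rw [lsExt, dif_pos h]
  exact (σ ⟨i, h⟩).2

theorem lsExt_fin {n : ℕ} (σ : Equiv.Perm (Fin n)) (i : Fin n) : lsExt σ i = σ i := by
  rw [lsExt, dif_pos i.2]

theorem lsExt_inj {n : ℕ} (σ : Equiv.Perm (Fin n)) (i j : ℕ) (hi : i < n) (hj : j < n)
    (h : lsExt σ i = lsExt σ j) : i = j := by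
  rw [lsExt, lsExt, dif_pos hi, dif_pos hj] at h
  have := σ.injective (Fin.ext h)
  exact Fin.mk.inj_iff.1 this

theorem lsKeyN_fin {n : ℕ} (σ : Equiv.Perm (Fin n)) (i : Fin n) : lsKeyN σ i = lsKey σ i := by
  rw [lsKeyN, lsKey, lsExt_fin]
  rfl

theorem lsKeyN_inj {n : ℕ} (σ : Equiv.Perm (Fin n)) (i j : ℕ) (hi : i < n) (hj : j < n)
    (h : lsKeyN σ i = lsKeyN σ j) : i = j := by
  have h1 := lsExt_lt σ i hi
  have h2 := lsExt_lt σ j hj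
  apply lsExt_inj σ i j hi hj
  rw [lsKeyN, lsKeyN] at h
  split_ifs at h <;> omega

theorem satL_good {n : ℕ} (l : List ℕ) (hl : l.sum = n) (σ : Equiv.Perm (Fin n))
    (c : Fin n → Fin l.length) (hc : ∀ i, (c i : ℕ) = lsBlk l i) :
    satL (lsD σ) l ↔ lsGood c σ := by
  rw [satL_iff]
  constructor
  · intro h
    have key : ∀ d i : ℕ, i + d + 1 < n → lsBlk l i = lsBlk l (i + d + 1) →
        lsKeyN σ i < lsKeyN σ (i + d + 1) := by
      intro d
      induction d with
      | zero =>
        intro i hi hb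
        have := h (i + 1) (by omega) (by omega) hb
        simp only [lsD, Finset.mem_filter, Finset.mem_Ico, not_and, not_lt] at this
        have h1 := this ⟨by omega, by omega⟩
        rw [show i + 1 - 1 = i by omega] at h1
        refine lt_of_le_of_ne h1 fun he => ?_
        have := lsKeyN_inj σ _ _ (by omega) (by omega) he
        omega
      | succ d ih =>
        intro i hi hb
        have b1 := lsBlk_anti l i (i + d + 1) (by omega)
        have b2 := lsBlk_anti l (i + d + 1) (i + (d + 1) + 1) (by omega)
        have h0 := ih i (by omega) (by omega)
        have := h (i + (d + 1) + 1) (by omega) (by omega) (by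
          rw [show i + (d + 1) + 1 - 1 = i + d + 1 by omega]; omega)
        simp only [lsD, Finset.mem_filter, Finset.mem_Ico, not_and, not_lt] at this
        have h1 := this ⟨by omega, by omega⟩
        rw [show i + (d + 1) + 1 - 1 = i + d + 1 by omega] at h1
        omega
    intro i j hij hcij
    rw [Fin.lt_def] at hij
    have := key (j - i - 1) i (by have := j.2; omega) (by
      rw [show (i : ℕ) + (j - i - 1) + 1 = j by omega, ← hc, ← hc, hcij])
    rw [show (i : ℕ) + (j - i - 1) + 1 = j by omega, lsKeyN_fin, lsKeyN_fin] at this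
    exact this
  · intro h j hj1 hj2 hb hD
    have hjn : j < n := by omega
    have h1 := h ⟨j - 1, by omega⟩ ⟨j, hjn⟩ (by rw [Fin.lt_def]; simp only; omega)
      (by apply Fin.ext; rw [hc, hc]; exact hb)
    rw [← lsKeyN_fin, ← lsKeyN_fin] at h1
    have h2 := (Finset.mem_filter.1 hD).2
    simp only at h1
    omega

theorem card_fin_filter (n : ℕ) (P : ℕ → Prop) [DecidablePred P] :
    (Finset.univ.filter fun j : Fin n => P j).card = ((Finset.range n).filter P).card := by
  rw [Finset.card_filter, Finset.card_filter, Fin.sum_univ_eq_sum_range (fun j => if P j then 1 else 0)]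

theorem list_perm_sum {K : Type*} [Field K] (t : K) {n : ℕ} (l : List ℕ) (hl : l.sum = n) :
    (∑ σ : Equiv.Perm (Fin n), if satL (lsD σ) l then t ^ excP σ else 0) =
      ∑ i ∈ Finset.range (n + 1), lsv t i l := by
  set c : Fin n → Fin l.length := fun i => ⟨lsBlk l i, lsBlk_lt l i (by have := i.2; omega)⟩ with hcd
  have hc : ∀ i, (c i : ℕ) = lsBlk l i := fun i => rfl
  have h1 : (∑ σ : Equiv.Perm (Fin n), if satL (lsD σ) l then t ^ excP σ else 0) =
      ∑ σ : Equiv.Perm (Fin n), if lsGood c σ then t ^ excP σ else 0 := by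
    refine Finset.sum_congr rfl fun σ _ => ?_
    by_cases h : lsGood c σ
    · rw [if_pos h, if_pos ((satL_good l hl σ c hc).2 h)]
    · rw [if_neg h, if_neg (fun h' => h ((satL_good l hl σ c hc).1 h'))]
  rw [h1, words_sum t c (fun i j hij => by rw [Fin.le_def, hc, hc]; exact lsBlk_anti l i j hij)]
  have h2 : (fun b => (Finset.univ.filter fun j => c j = b).card) = l.get := by
    funext b
    have := lsBlk_card l b b.2
    rw [List.get_eq_getElem, ← this, hl, ← card_fin_filter n (fun j => lsBlk l j = b)]
    congr 1
    ext j
    simp only [Finset.mem_filter, Finset.mem_univ, true_and]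
    rw [← hc, Fin.ext_iff]
  rw [h2]
  have := lsa_fin t l.length l.get (S := K) 1 n (by rw [List.ofFn_get]; exact hl.le)
  simpa using this

theorem excP_eq {n : ℕ} (σ : Equiv.Perm (Fin n)) :
    excP σ = ∑ j ∈ Finset.range n, if j < lsExt σ j then 1 else 0 := by
  rw [excP, Finset.card_filter, ← Fin.sum_univ_eq_sum_range (fun j => if j < lsExt σ j then 1 else 0)]
  simp only [lsExt_fin]

theorem maj_dex {n : ℕ} (σ : Equiv.Perm (Fin n)) :
    majF (permWord σ) = (∑ j ∈ (Finset.Ico 1 n).filter (· ∈ lsD σ), j) + excP σ := by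
  rcases n with _ | n
  · simp [majF, excP]
  have h1 : majF (permWord σ) = ∑ j ∈ Finset.range n,
      if lsExt σ (j + 1) < lsExt σ j then (j + 1) else 0 := by
    rw [majF, Finset.sum_filter]
    rw [← Fin.sum_univ_eq_sum_range (fun j => if lsExt σ (j + 1) < lsExt σ j then (j + 1) else 0)]
    refine Finset.sum_congr rfl fun i _ => ?_
    have hi : (i : ℕ) < n := i.2
    rw [lsExt, dif_pos (by omega), lsExt, dif_pos (by omega)]
    rfl
  have h2 : (∑ j ∈ (Finset.Ico 1 (n + 1)).filter (· ∈ lsD σ), j) = ∑ j ∈ Finset.range n,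
      if lsKeyN σ (j + 1) < lsKeyN σ j then (j + 1) else 0 := by
    rw [Finset.sum_filter, Finset.sum_Ico_eq_sum_range]
    refine Finset.sum_congr (by simp) fun j hj => ?_
    have hj' : j < n := Finset.mem_range.1 hj
    rw [add_comm 1 j]
    congr 1
    simp only [lsD, Finset.mem_filter, Finset.mem_Ico, Nat.add_sub_cancel, eq_iff_iff]
    constructor
    · exact fun h => h.2
    · exact fun h => ⟨⟨by omega, by omega⟩, h⟩
  have key : ∀ m, m ≤ n → (∑ j ∈ Finset.range m,
      if lsExt σ (j + 1) < lsExt σ j then (j + 1) else 0) + (if m < lsExt σ m then m else 0) =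
      (∑ j ∈ Finset.range m, if lsKeyN σ (j + 1) < lsKeyN σ j then (j + 1) else 0) +
        ∑ j ∈ Finset.range m, if j < lsExt σ j then 1 else 0 := by
    intro m
    induction m with
    | zero => intro _; simp
    | succ m ih =>
      intro hm
      have ih := ih (by omega)
      rw [Finset.sum_range_succ, Finset.sum_range_succ, Finset.sum_range_succ]
      have a1 := lsExt_lt σ m (by omega)
      have a2 := lsExt_lt σ (m + 1) (by omega)
      have a3 : lsExt σ m ≠ lsExt σ (m + 1) := fun h => by
        have := lsExt_inj σ _ _ (by omega) (by omega) h
        omega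
      simp only [lsKeyN] at ih ⊢
      by_cases c1 : m < lsExt σ m <;> by_cases c2 : m + 1 < lsExt σ (m + 1) <;>
        by_cases c3 : lsExt σ (m + 1) < lsExt σ m <;>
        simp only [c1, c2, c3, if_true, if_false] at ih ⊢ <;> (try split_ifs) <;> omega
  have hk := key n le_rfl
  have hn := lsExt_lt σ n (by omega)
  rw [if_neg (by omega), add_zero] at hk
  rw [h1, h2, hk, excP_eq, Finset.sum_range_succ, if_neg (by omega), add_zero]

/-- The generating function of `(maj, exc)`. -/
theorem maj_exc_gf {K : Type*} [Field K] {q : K} (hq : ∀ n : ℕ, q ^ (n + 1) ≠ 1) (t : K) (n : ℕ) :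
    (∑ σ : Equiv.Perm (Fin n), q ^ majF (permWord σ) * t ^ excP σ) =
      lsb q (t * q) n * qf q n := by
  have h1 : ∀ σ : Equiv.Perm (Fin n), q ^ majF (permWord σ) * t ^ excP σ =
      (t * q) ^ excP σ * lsT q n (fun l => if satL (lsD σ) l then 1 else 0) * qf q n := by
    intro σ
    rw [mul_assoc, lsT_sat hq, maj_dex, pow_add, mul_pow]
    ring
  simp only [h1]
  rw [← Finset.sum_mul, ← lsT_sum]
  congr 1
  rw [lsb]
  have h2 : ∀ i, PowerSeries.coeff n (lsV q (t * q) ^ i) = 1 * lsT q n (lsv (t * q) i) := by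
    intro i
    rw [one_mul, lsT_lsv hq]
  simp only [h2]
  rw [← lsT_sum]
  refine lsT_congr _ _ _ _ fun l hl => ?_
  simp only [one_mul]
  rw [← list_perm_sum (t * q) l hl]
  refine Finset.sum_congr rfl fun σ _ => ?_
  rw [mul_ite, mul_one, mul_zero]

end Blocks

/-! ### Admissible inversions: recursion on words -/
section Admissible

noncomputable def lsCnt (x : ℕ) (l : List ℕ) : ℕ := l.countP (fun y => decide (y < x))

noncomputable def aiR : ℕ → List ℕ → ℕ
  | _, [] => 0
  | p, x :: l => (if p < x then lsCnt x l else lsCnt x (l.dropWhile (fun y => decide (y ≤ x)))) +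
      aiR x l

noncomputable def desR : ℕ → List ℕ → ℕ
  | _, [] => 0
  | p, x :: l => (if x < p then 1 else 0) + desR x l

noncomputable def lsInv (α β : List ℕ) : ℕ := (α.map (fun x => lsCnt x β)).sum

theorem lsCnt_all (x : ℕ) (l : List ℕ) (h : ∀ y ∈ l, y < x) : lsCnt x l = l.length := by
  rw [lsCnt, List.countP_eq_length]
  intro y hy
  simpa using h y hy

theorem dropWhile_all (x : ℕ) : ∀ (l : List ℕ), (∀ y ∈ l, y < x) →
    l.dropWhile (fun y => decide (y ≤ x)) = []
  | [], _ => rfl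
  | y :: l, h => by
    rw [List.dropWhile_cons_of_pos (by simpa using (h y (by simp)).le)]
    exact dropWhile_all x l fun z hz => h z (by simp [hz])

theorem lsCnt_append (x M : ℕ) (hx : x < M) (α β : List ℕ) :
    lsCnt x (α ++ M :: β) = lsCnt x α + lsCnt x β := by
  rw [lsCnt, List.countP_append, List.countP_cons_of_neg (by simp; omega)]
  rfl

theorem lsCnt_drop (x M : ℕ) (hx : x < M) : ∀ (α β : List ℕ),
    lsCnt x ((α ++ M :: β).dropWhile (fun y => decide (y ≤ x))) =
      lsCnt x (α.dropWhile (fun y => decide (y ≤ x))) + lsCnt x β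
  | [], β => by
    rw [List.nil_append, List.dropWhile_cons_of_neg (by simp; omega)]
    have := lsCnt_append x M hx [] β
    simpa [lsCnt] using this
  | y :: α, β => by
    by_cases h : y ≤ x
    · rw [List.cons_append, List.dropWhile_cons_of_pos (by simpa using h),
        List.dropWhile_cons_of_pos (by simpa using h)]
      exact lsCnt_drop x M hx α β
    · rw [List.cons_append, List.dropWhile_cons_of_neg (by simpa using h),
        List.dropWhile_cons_of_neg (by simpa using h)]
      exact lsCnt_append x M hx (y :: α) β

theorem aiR_append (M : ℕ) (β : List ℕ) (hβ : ∀ y ∈ β, y < M) : ∀ (α : List ℕ) (p : ℕ),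
    (∀ y ∈ α, y < M) → aiR p (α ++ M :: β) = aiR p α + lsInv α β +
      (if p < M ∨ α ≠ [] then β.length else 0) + aiR M β
  | [], p, _ => by
    rw [List.nil_append, aiR, aiR, lsCnt_all M β hβ, dropWhile_all M β hβ]
    simp [lsInv, lsCnt]
  | x :: α, p, h => by
    have hx : x < M := h x (by simp)
    rw [List.cons_append, aiR, aiR_append M β hβ α x (fun y hy => h y (by simp [hy])), aiR,
      lsCnt_append x M hx, lsCnt_drop x M hx, if_pos (Or.inl hx), if_pos (Or.inr (by simp))]
    simp only [lsInv, List.map_cons, List.sum_cons]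
    split_ifs <;> ring

theorem desR_append (M : ℕ) (β : List ℕ) : ∀ (α : List ℕ) (p : ℕ), p ≤ M →
    (∀ y ∈ α, y < M) → desR p (α ++ M :: β) = desR p α + desR M β
  | [], p, hp, _ => by
    rw [List.nil_append, desR, desR, if_neg (by omega)]
  | x :: α, p, hp, h => by
    have hx : x < M := h x (by simp)
    rw [List.cons_append, desR, desR_append M β α x hx.le (fun y hy => h y (by simp [hy])), desR]
    ring

theorem desR_max (M : ℕ) (β : List ℕ) (hβ : ∀ y ∈ β, y < M) :
    desR M β = desR 0 β + (if β = [] then 0 else 1) := by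
  cases β with
  | nil => simp [desR]
  | cons x β =>
    have := hβ x (by simp)
    rw [desR, desR, if_pos this, if_neg (by omega), if_neg (by simp)]
    ring

theorem desF_eq {m : ℕ} : ∀ (w : Fin (m + 1) → ℕ) (p : ℕ),
    desR p (List.ofFn w) = (if w 0 < p then 1 else 0) + desF w := by
  induction m with
  | zero =>
    intro w p
    simp [desR, desF]
  | succ m ih =>
    intro w p
    rw [List.ofFn_succ, desR, ih]
    congr 1
    rw [desF, desF, Finset.card_filter, Finset.card_filter]
    exact (Fin.sum_univ_succ (n := m) (fun i : Fin (m + 1) => if w ⟨(i : ℕ) + 1, by omega⟩ < w ⟨(i : ℕ), by omega⟩ then 1 else 0)).symm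

theorem cnt_eq (x : ℕ) {m : ℕ} : ∀ (w : Fin m → ℕ),
    lsCnt x (List.ofFn w) = ∑ j : Fin m, if w j < x then 1 else 0 := by
  induction m with
  | zero => intro w; simp [lsCnt]
  | succ m ih =>
    intro w
    rw [List.ofFn_succ, Fin.sum_univ_succ, ← ih, lsCnt, List.countP_cons, lsCnt, add_comm]
    simp

theorem drop_eq (x : ℕ) {m : ℕ} : ∀ (w : Fin m → ℕ),
    lsCnt x ((List.ofFn w).dropWhile (fun y => decide (y ≤ x))) =
      ∑ j : Fin m, if w j < x ∧ ∃ k, k < j ∧ x < w k then 1 else 0 := by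
  induction m with
  | zero => intro w; simp [lsCnt]
  | succ m ih =>
    intro w
    rw [List.ofFn_succ, Fin.sum_univ_succ, if_neg (by rintro ⟨_, k, hk, _⟩; simp at hk), zero_add]
    by_cases h : w 0 ≤ x
    · rw [List.dropWhile_cons_of_pos (by simpa using h), ih]
      refine Finset.sum_congr rfl fun j _ => ?_
      congr 1
      rw [eq_iff_iff]
      refine and_congr_right fun _ => ?_
      constructor
      · rintro ⟨k, h1, h2⟩
        exact ⟨k.succ, by simpa using h1, h2⟩
      · rintro ⟨k, h1, h2⟩
        refine Fin.cases ?_ ?_ k h1 h2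
        · intro _ h3; omega
        · intro k h3 h4; exact ⟨k, by simpa using h3, h4⟩
    · rw [List.dropWhile_cons_of_neg (by simpa using h), lsCnt, List.countP_cons_of_neg (by simp; omega)]
      have : ∀ j : Fin m, (w j.succ < x ∧ ∃ k, k < j.succ ∧ x < w k) ↔ w j.succ < x := by
        intro j
        exact ⟨fun h => h.1, fun h' => ⟨h', 0, Fin.succ_pos j, by omega⟩⟩
      simp only [this]
      exact cnt_eq x (fun i : Fin m => w i.succ)

noncomputable def aiG {m : ℕ} (p : ℕ) (w : Fin m → ℕ) : ℕ :=
  ∑ i : Fin m, ∑ j : Fin m, if i < j ∧ w j < w i ∧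
    ((if h : 0 < (i : ℕ) then w ⟨(i : ℕ) - 1, by have := i.2; omega⟩ else p) < w i ∨
      ∃ k : Fin m, i < k ∧ k < j ∧ w i < w k) then 1 else 0

theorem aiG_eq {m : ℕ} : ∀ (w : Fin m → ℕ) (p : ℕ), aiR p (List.ofFn w) = aiG p w := by
  induction m with
  | zero => intro w p; simp [aiR, aiG]
  | succ m ih =>
    intro w p
    rw [List.ofFn_succ, aiR, ih, aiG, aiG, Fin.sum_univ_succ]
    congr 1
    · rw [Fin.sum_univ_succ, if_neg (c := (0 : Fin (m + 1)) < 0 ∧ _) (fun h => lt_irrefl _ h.1),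
        zero_add, cnt_eq, drop_eq]
      by_cases hp : p < w 0
      · rw [if_pos hp]
        refine Finset.sum_congr rfl fun j _ => ?_
        simp [hp]
      · rw [if_neg hp]
        refine Finset.sum_congr rfl fun j _ => ?_
        congr 1
        rw [eq_iff_iff, dif_neg (by simp), and_iff_right (Fin.succ_pos j), or_iff_right hp]
        refine and_congr_right fun _ => ?_
        constructor
        · rintro ⟨k, h1, h2⟩
          exact ⟨k.succ, Fin.succ_pos k, by simpa using h1, h2⟩
        · rintro ⟨k, h1, h2, h3⟩
          refine Fin.cases ?_ ?_ k h1 h2 h3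
          · intro h; simp at h
          · intro k _ h3 h4; exact ⟨k, by simpa using h3, h4⟩
    · refine Finset.sum_congr rfl fun i _ => ?_
      rw [Fin.sum_univ_succ, if_neg (by simp), zero_add]
      refine Finset.sum_congr rfl fun j _ => ?_
      congr 1
      rw [eq_iff_iff, Fin.succ_lt_succ_iff]
      refine and_congr_right fun _ => and_congr_right fun _ => or_congr ?_ ?_
      · rw [dif_pos (show 0 < ((i.succ : Fin (m + 1)) : ℕ) by simp)]
        by_cases hi : 0 < (i : ℕ)
        · rw [dif_pos hi]
          have : (⟨(i : ℕ) - 1, by have := i.2; omega⟩ : Fin m).succ =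
              ⟨((i.succ : Fin (m + 1)) : ℕ) - 1, by have := i.2; simp⟩ := by
            apply Fin.ext
            simp
            omega
          rw [this]
        · rw [dif_neg hi]
          have : (⟨((i.succ : Fin (m + 1)) : ℕ) - 1, by have := i.2; simp⟩ : Fin (m + 1)) = 0 := by
            apply Fin.ext
            simp
            omega
          rw [this]
      · constructor
        · rintro ⟨k, h1, h2, h3⟩
          exact ⟨k.succ, by simpa using h1, by simpa using h2, h3⟩
        · rintro ⟨k, h1, h2, h3⟩
          refine Fin.cases ?_ ?_ k h1 h2 h3
          · intro h; simp at h
          · intro k h2 h3 h4; exact ⟨k, by simpa using h2, by simpa using h3, h4⟩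

theorem aiW_eq {m : ℕ} (w : Fin m → ℕ) (p : ℕ) (hp : ∀ i, w i ≤ p) :
    aiW w = aiR p (List.ofFn w) := by
  rw [aiG_eq, aiG, aiW, Finset.card_filter, Fintype.sum_prod_type]
  refine Finset.sum_congr rfl fun i _ => Finset.sum_congr rfl fun j _ => ?_
  congr 1
  rw [eq_iff_iff]
  refine and_congr_right fun _ => and_congr_right fun _ => or_congr ?_ Iff.rfl
  by_cases hi : 0 < (i : ℕ)
  · rw [dif_pos hi]
    exact ⟨fun h => h.2, fun h => ⟨hi, h⟩⟩
  · rw [dif_neg hi]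
    exact ⟨fun h => absurd h.1 hi, fun h => absurd h (not_lt.2 (hp i))⟩

theorem desF_eq_zero {m : ℕ} (w : Fin m → ℕ) : desF w = desR 0 (List.ofFn w) := by
  cases m with
  | zero => simp [desF, desR]
  | succ m => rw [desF_eq, if_neg (by omega), zero_add]

end Admissible

/-! ### The generating function of `(aid, des)` -/
section AidGF
variable {K : Type*} [Field K]

noncomputable def lsArr (s : Finset ℕ) : Finset (List ℕ) := s.val.lists.toFinset

theorem lsArr_iff (s : Finset ℕ) (l : List ℕ) : l ∈ lsArr s ↔ s.val = (l : Multiset ℕ) := by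
  rw [lsArr, Multiset.mem_toFinset, Multiset.mem_lists_iff, Multiset.quot_mk_to_coe]

theorem mem_lsArr (s : Finset ℕ) (l : List ℕ) : l ∈ lsArr s ↔ l.Nodup ∧ ∀ x, x ∈ l ↔ x ∈ s := by
  rw [lsArr_iff]
  constructor
  · intro h
    refine ⟨?_, fun x => ?_⟩
    · have := s.nodup
      rw [h] at this
      exact this
    · rw [Finset.mem_def, h, Multiset.mem_coe]
  · rintro ⟨h1, h2⟩
    refine (Multiset.Nodup.ext s.nodup (Multiset.coe_nodup.2 h1)).2 fun x => ?_
    rw [Multiset.mem_coe, h2]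
    rfl

theorem length_lsArr (s : Finset ℕ) (l : List ℕ) (h : l ∈ lsArr s) : l.length = s.card := by
  rw [lsArr_iff] at h
  rw [Finset.card_def, h, Multiset.coe_card]

noncomputable def lsInvF (u v : Finset ℕ) : ℕ := ∑ x ∈ u, (v.filter fun y => y < x).card

theorem lsInv_eq (u v : Finset ℕ) (α β : List ℕ) (hα : α ∈ lsArr u) (hβ : β ∈ lsArr v) :
    lsInv α β = lsInvF u v := by
  have hc : ∀ x, lsCnt x β = (v.filter fun y => y < x).card := by
    intro x
    rw [lsArr_iff] at hβ
    rw [lsCnt, ← Multiset.coe_countP, ← hβ, Multiset.countP_eq_card_filter]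
    rw [Finset.card_def, Finset.filter_val]
  rw [lsArr_iff] at hα
  rw [lsInv, lsInvF, Finset.sum, hα, Multiset.map_coe, Multiset.sum_coe]
  simp only [hc]

/-- the Gaussian binomial coefficient -/
noncomputable def lsGb (q : K) : ℕ → ℕ → K
  | _, 0 => 1
  | 0, _ + 1 => 0
  | n + 1, k + 1 => lsGb q n (k + 1) + q ^ (n - k) * lsGb q n k

theorem lsGb_zero (q : K) (n : ℕ) : lsGb q n 0 = 1 := by cases n <;> rfl

theorem lsGb_succ (q : K) (n k : ℕ) :
    lsGb q (n + 1) (k + 1) = lsGb q n (k + 1) + q ^ (n - k) * lsGb q n k := rfl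

theorem lsGb_gt (q : K) : ∀ n k, n < k → lsGb q n k = 0
  | 0, k + 1, _ => rfl
  | n + 1, k + 1, h => by
    rw [lsGb_succ, lsGb_gt q n (k + 1) (by omega), lsGb_gt q n k (by omega)]
    simp

theorem lsGb_mul (q : K) : ∀ n k, k ≤ n → lsGb q n k * qf q k * qf q (n - k) = qf q n
  | n, 0, _ => by simp [lsGb_zero, qf_zero]
  | n + 1, k + 1, h => by
    have h1 := lsGb_mul q n k (by omega)
    rw [lsGb_succ, Nat.add_sub_add_right]
    rcases (show k ≤ n by omega).eq_or_lt with rfl | hk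
    · rw [lsGb_gt q k (k + 1) (by omega), Nat.sub_self, qf_succ, qf_zero]
      rw [Nat.sub_self, qf_zero] at h1
      linear_combination (1 - q ^ (k + 1)) * h1
    · have h2 := lsGb_mul q n (k + 1) (by omega)
      obtain ⟨d, rfl⟩ : ∃ d, n = k + 1 + d := ⟨n - (k + 1), by omega⟩
      rw [show k + 1 + d - k = d + 1 by omega] at h1 ⊢
      rw [show k + 1 + d - (k + 1) = d by omega] at h2
      rw [qf_succ q (k + 1 + d)]
      rw [qf_succ q d] at h1 ⊢
      rw [qf_succ q k] at h2 ⊢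
      have e : q ^ (k + 1 + d + 1) = q ^ (d + 1) * q ^ (k + 1) := by ring
      rw [e]
      linear_combination (1 - q ^ (d + 1)) * h2 + q ^ (d + 1) * (1 - q ^ (k + 1)) * h1

theorem lsInvF_insert_right (u v : Finset ℕ) (M : ℕ) (hu : ∀ x ∈ u, x < M) :
    lsInvF u (insert M v) = lsInvF u v := by
  refine Finset.sum_congr rfl fun x hx => ?_
  rw [Finset.filter_insert, if_neg (by have := hu x hx; omega)]

theorem lsInvF_insert_left (u v : Finset ℕ) (M : ℕ) (hM : M ∉ u) (hv : ∀ x ∈ v, x < M) :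
    lsInvF (insert M u) v = lsInvF u v + v.card := by
  rw [lsInvF, Finset.sum_insert hM, add_comm, Finset.filter_true_of_mem hv]
  rfl

theorem gauss_sum (q : K) (s : Finset ℕ) : ∀ f : ℕ → K,
    ∑ u ∈ s.powerset, q ^ lsInvF u (s \ u) * f u.card =
      ∑ k ∈ Finset.range (s.card + 1), lsGb q s.card k * f k := by
  induction s using Finset.induction_on_max with
  | empty => intro f; simp [lsInvF, lsGb]
  | insert M s hM ih =>
    intro f
    have hMs : M ∉ s := fun h => lt_irrefl _ (hM M h)
    rw [Finset.sum_powerset_insert hMs, Finset.card_insert_of_notMem hMs]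
    have h1 : ∑ u ∈ s.powerset, q ^ lsInvF u (insert M s \ u) * f u.card =
        ∑ u ∈ s.powerset, q ^ lsInvF u (s \ u) * f u.card := by
      refine Finset.sum_congr rfl fun u hu => ?_
      have hus := Finset.mem_powerset.1 hu
      rw [Finset.insert_sdiff_of_notMem _ (fun h => hMs (hus h)),
        lsInvF_insert_right _ _ _ (fun x hx => hM x (hus hx))]
    have h2 : ∑ u ∈ s.powerset, q ^ lsInvF (insert M u) (insert M s \ insert M u) *
          f (insert M u).card =
        ∑ u ∈ s.powerset, q ^ lsInvF u (s \ u) *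
          (fun k => q ^ (s.card - k) * f (k + 1)) u.card := by
      refine Finset.sum_congr rfl fun u hu => ?_
      have hus := Finset.mem_powerset.1 hu
      have hMu : M ∉ u := fun h => hMs (hus h)
      have e : insert M s \ insert M u = s \ u := by
        ext x
        simp only [Finset.mem_sdiff, Finset.mem_insert, not_or]
        constructor
        · rintro ⟨h | h, h', h''⟩
          · exact absurd h h'
          · exact ⟨h, h''⟩
        · rintro ⟨h, h'⟩
          exact ⟨Or.inr h, fun h'' => hMs (h'' ▸ h), h'⟩
      rw [e, lsInvF_insert_left _ _ _ hMu (fun x hx => hM x (Finset.mem_sdiff.1 hx).1),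
        Finset.card_insert_of_notMem hMu, Finset.card_sdiff_of_subset hus, pow_add]
      ring
    rw [h1, h2, ih f, ih (fun k => q ^ (s.card - k) * f (k + 1)), Finset.sum_range_succ' _ (s.card + 1)]
    simp only [lsGb_succ, add_mul, Finset.sum_add_distrib]
    have h3 : ∑ k ∈ Finset.range (s.card + 1), lsGb q s.card k * f k =
        ∑ k ∈ Finset.range (s.card + 1), lsGb q s.card (k + 1) * f (k + 1) + lsGb q s.card 0 * f 0 := by
      rw [← Finset.sum_range_succ' (fun k => lsGb q s.card k * f k), Finset.sum_range_succ _ (s.card + 1),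
        lsGb_gt q _ _ (Nat.lt_succ_self _), zero_mul, add_zero]
    rw [h3, lsGb_zero, lsGb_zero]
    have h4 : ∀ k, lsGb q s.card k * (q ^ (s.card - k) * f (k + 1)) =
      q ^ (s.card - k) * lsGb q s.card k * f (k + 1) := fun k => by ring
    simp only [h4]
    ring

theorem sum_lsArr_insert (s : Finset ℕ) (M : ℕ) (hM : ∀ x ∈ s, x < M) (F : List ℕ → K) :
    ∑ l ∈ lsArr (insert M s), F l =
      ∑ u ∈ s.powerset, ∑ p ∈ lsArr u ×ˢ lsArr (s \ u), F (p.1 ++ M :: p.2) := by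
  have hMs : M ∉ s := fun h => lt_irrefl _ (hM M h)
  rw [Finset.sum_sigma']
  symm
  refine Finset.sum_bij (fun x _ => x.2.1 ++ M :: x.2.2) ?_ ?_ ?_ ?_
  · rintro ⟨u, α, β⟩ h
    simp only [Finset.mem_sigma, Finset.mem_powerset, Finset.mem_product, mem_lsArr] at h ⊢
    obtain ⟨hu, ⟨h1, h2⟩, h3, h4⟩ := h
    constructor
    · rw [List.nodup_append]
      refine ⟨h1, List.nodup_cons.2 ⟨?_, h3⟩, ?_⟩
      · rw [h4]
        exact fun h => hMs (Finset.mem_sdiff.1 h).1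
      · intro a ha b hb hab
        subst hab
        rw [h2] at ha
        rcases List.mem_cons.1 hb with rfl | hb
        · exact hMs (hu ha)
        · rw [h4] at hb
          exact (Finset.mem_sdiff.1 hb).2 ha
    · intro x
      rw [List.mem_append, List.mem_cons, h2, h4, Finset.mem_insert, Finset.mem_sdiff]
      constructor
      · rintro (h | h | h)
        · exact Or.inr (hu h)
        · exact Or.inl h
        · exact Or.inr h.1
      · rintro (h | h)
        · exact Or.inr (Or.inl h)
        · by_cases hx : x ∈ u
          · exact Or.inl hx
          · exact Or.inr (Or.inr ⟨h, hx⟩)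
  · rintro ⟨u, α, β⟩ h ⟨u', α', β'⟩ h' he
    simp only [Finset.mem_sigma, Finset.mem_powerset, Finset.mem_product, mem_lsArr] at h h' he
    obtain ⟨hu, ⟨h1, h2⟩, h3, h4⟩ := h
    obtain ⟨hu', ⟨h1', h2'⟩, h3', h4'⟩ := h'
    have n1 : M ∉ α := fun h => hMs (hu ((h2 M).1 h))
    have n2 : M ∉ β := fun h => hMs (Finset.mem_sdiff.1 ((h4 M).1 h)).1
    obtain ⟨e1, -, e2⟩ := (List.append_cons_inj_of_notMem n1 n2).1 he
    subst e1 e2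
    have : u = u' := by
      ext x
      rw [← h2, ← h2']
    subst this
    rfl
  · intro l hl
    rw [mem_lsArr] at hl
    obtain ⟨h1, h2⟩ := hl
    obtain ⟨α, β, rfl⟩ := List.append_of_mem ((h2 M).2 (Finset.mem_insert_self _ _))
    rw [List.nodup_append] at h1
    obtain ⟨a1, a2, a3⟩ := h1
    rw [List.nodup_cons] at a2
    have hαM : M ∉ α := fun h => a3 M h M (by simp) rfl
    have hαβ : ∀ x, x ∈ α → x ∉ β := fun x h h' => a3 x h x (by simp [h']) rfl
    have hin : ∀ x, x ∈ α ∨ x ∈ β ↔ x ∈ s := by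
      intro x
      have := h2 x
      rw [List.mem_append, List.mem_cons, Finset.mem_insert] at this
      constructor
      · rintro (h | h)
        · rcases this.1 (Or.inl h) with rfl | h'
          · exact absurd h hαM
          · exact h'
        · rcases this.1 (Or.inr (Or.inr h)) with rfl | h'
          · exact absurd h a2.1
          · exact h'
      · intro h
        rcases this.2 (Or.inr h) with h' | rfl | h'
        · exact Or.inl h'
        · exact absurd h hMs
        · exact Or.inr h'
    refine ⟨⟨s.filter (fun x => x ∈ α), α, β⟩, ?_, rfl⟩
    simp only [Finset.mem_sigma, Finset.mem_powerset, Finset.mem_product, mem_lsArr]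
    refine ⟨Finset.filter_subset _ _, ⟨a1, fun x => ?_⟩, a2.2, fun x => ?_⟩
    · rw [Finset.mem_filter]
      exact ⟨fun h => ⟨(hin x).1 (Or.inl h), h⟩, fun h => h.2⟩
    · rw [Finset.mem_sdiff, Finset.mem_filter]
      constructor
      · exact fun h => ⟨(hin x).1 (Or.inr h), fun h' => hαβ x h'.2 h⟩
      · rintro ⟨h, h'⟩
        rcases (hin x).2 h with h'' | h''
        · exact absurd ⟨h, h''⟩ h'
        · exact h''
  · intro x _
    rfl

noncomputable def lsF (q t : K) (B : ℕ) (l : List ℕ) : K := q ^ (aiR B l) * (t * q) ^ desR 0 l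

theorem lsF_append (q t : K) (s : Finset ℕ) (M B : ℕ) (hM : ∀ x ∈ s, x < M) (hB : M ≤ B)
    (u : Finset ℕ) (hu : u ⊆ s) (α β : List ℕ) (hα : α ∈ lsArr u) (hβ : β ∈ lsArr (s \ u)) :
    lsF q t B (α ++ M :: β) = q ^ lsInvF u (s \ u) * (q ^ (if u.card = 0 then 0 else s.card - u.card) *
      (t * q) ^ (if s.card - u.card = 0 then 0 else 1)) * (lsF q t B α * lsF q t M β) := by
  have hβM : ∀ y ∈ β, y < M := fun y hy =>
    hM y (Finset.mem_sdiff.1 (((mem_lsArr _ _).1 hβ).2 y |>.1 hy)).1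
  have hαM : ∀ y ∈ α, y < M := fun y hy => hM y (hu ((((mem_lsArr _ _).1 hα).2 y).1 hy))
  have lα := length_lsArr _ _ hα
  have lβ := length_lsArr _ _ hβ
  rw [Finset.card_sdiff_of_subset hu] at lβ
  rw [lsF, aiR_append M β hβM α B hαM, desR_append M β α 0 (Nat.zero_le _) hαM,
    desR_max M β hβM, lsInv_eq u (s \ u) α β hα hβ, lsF, lsF, ← lβ, ← lα]
  have e1 : (if B < M ∨ α ≠ [] then β.length else 0) = (if α.length = 0 then 0 else β.length) := by
    by_cases h : α = []
    · rw [if_pos (List.length_eq_zero_iff.2 h), if_neg (by rintro (h' | h'); omega; exact h' h)]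
    · rw [if_neg (fun h' => h (List.length_eq_zero_iff.1 h')), if_pos (Or.inr h)]
  have e2 : (if β = [] then 0 else 1) = (if β.length = 0 then 0 else 1) := by
    simp only [List.length_eq_zero_iff]
  rw [e1, e2]
  ring

theorem aid_arr {q : K} (hq : ∀ n : ℕ, q ^ (n + 1) ≠ 1) (t : K) (n : ℕ) :
    ∀ (s : Finset ℕ) (B : ℕ), s.card = n → (∀ x ∈ s, x ≤ B) →
      ∑ l ∈ lsArr s, lsF q t B l = lsb q (t * q) n * qf q n := by
  induction n using Nat.strong_induction_on with
  | _ n ih =>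
  intro s B hs hB
  rcases n with _ | n
  · have : s = ∅ := Finset.card_eq_zero.1 hs
    subst this
    have : lsArr ∅ = {[]} := by
      ext l
      rw [mem_lsArr, Finset.mem_singleton]
      constructor
      · rintro ⟨_, h⟩
        exact List.eq_nil_iff_forall_not_mem.2 fun x hx => by simpa using (h x).1 hx
      · rintro rfl
        simp
    rw [this]
    simp [lsF, aiR, desR, lsb_zero, qf_zero]
  · obtain ⟨M, s', hM, rfl⟩ : ∃ M s', (∀ x ∈ s', x < M) ∧ s = insert M s' := by
      have hne : s.Nonempty := Finset.card_pos.1 (by omega)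
      refine ⟨s.max' hne, s.erase (s.max' hne), fun x hx => ?_, ?_⟩
      · exact lt_of_le_of_ne (s.le_max' x (Finset.mem_of_mem_erase hx)) (Finset.ne_of_mem_erase hx)
      · rw [Finset.insert_erase (s.max'_mem hne)]
    have hMs : M ∉ s' := fun h => lt_irrefl _ (hM M h)
    rw [Finset.card_insert_of_notMem hMs] at hs
    have hs' : s'.card = n := by omega
    have hBM : M ≤ B := hB M (Finset.mem_insert_self _ _)
    rw [sum_lsArr_insert s' M hM]
    have h1 : ∀ u ∈ s'.powerset, ∑ p ∈ lsArr u ×ˢ lsArr (s' \ u), lsF q t B (p.1 ++ M :: p.2) =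
        q ^ lsInvF u (s' \ u) * (fun k => (q ^ (if k = 0 then 0 else n - k) *
          (t * q) ^ (if n - k = 0 then 0 else 1)) * ((lsb q (t * q) k * qf q k) *
            (lsb q (t * q) (n - k) * qf q (n - k)))) u.card := by
      intro u hu
      have hus := Finset.mem_powerset.1 hu
      have hcu := Finset.card_le_card hus
      have hcv : (s' \ u).card = n - u.card := by rw [Finset.card_sdiff_of_subset hus, hs']
      have i1 := ih u.card (by omega) u B rfl (fun x hx => ((hM x (hus hx)).le.trans hBM))
      have i2 := ih (n - u.card) (by omega) (s' \ u) M hcv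
        (fun x hx => (hM x (Finset.mem_sdiff.1 hx).1).le)
      simp only
      rw [← i1, ← i2, Finset.sum_mul_sum, ← Finset.sum_product', ← mul_assoc, Finset.mul_sum]
      refine Finset.sum_congr rfl fun p hp => ?_
      obtain ⟨hp1, hp2⟩ := Finset.mem_product.1 hp
      rw [lsF_append q t s' M B hM hBM u hus p.1 p.2 hp1 hp2, hs']
    rw [Finset.sum_congr rfl h1, gauss_sum q s' (fun k => (q ^ (if k = 0 then 0 else n - k) *
          (t * q) ^ (if n - k = 0 then 0 else 1)) * ((lsb q (t * q) k * qf q k) *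
            (lsb q (t * q) (n - k) * qf q (n - k)))), hs', qf_succ, ← mul_assoc,
      mul_right_comm, mul_comm _ (1 - q ^ (n + 1)), lsb_rec hq]
    have h2 : ∀ k ∈ Finset.range (n + 1), lsGb q n k * ((q ^ (if k = 0 then 0 else n - k) *
          (t * q) ^ (if n - k = 0 then 0 else 1)) * ((lsb q (t * q) k * qf q k) *
            (lsb q (t * q) (n - k) * qf q (n - k)))) =
        qf q n * (q ^ (if k = 0 then 0 else n - k) *
          (t * q) ^ (if n - k = 0 then 0 else 1) * (lsb q (t * q) k * lsb q (t * q) (n - k))) := by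
      intro k hk
      rw [← lsGb_mul q n k (by have := Finset.mem_range.1 hk; omega)]
      ring
    rw [Finset.sum_congr rfl h2, ← Finset.mul_sum, mul_comm (qf q n)]
    congr 1
    rcases n with _ | n
    · simp [lsb_zero]
    · rw [Finset.sum_range_succ', Finset.sum_range_succ, Finset.sum_range_succ' _ (n + 1),
        Finset.sum_range_succ _ n]
      have h3 : ∀ k ∈ Finset.range n, q ^ (if k + 1 = 0 then 0 else n + 1 - (k + 1)) *
          (t * q) ^ (if n + 1 - (k + 1) = 0 then 0 else 1) *
            (lsb q (t * q) (k + 1) * lsb q (t * q) (n + 1 - (k + 1))) =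
          (t * q) * (lsb q (t * q) (k + 1) * (q ^ (n + 1 - (k + 1)) * lsb q (t * q) (n + 1 - (k + 1)))) := by
        intro k hk
        have := Finset.mem_range.1 hk
        rw [if_neg (by omega), if_neg (by omega)]
        ring
      rw [Finset.sum_congr rfl h3, ← Finset.mul_sum]
      simp [lsb_zero]
      ring

theorem perm_arr (n : ℕ) (F : List ℕ → K) :
    ∑ σ : Equiv.Perm (Fin n), F (List.ofFn (permWord σ)) = ∑ l ∈ lsArr (Finset.range n), F l := by
  refine Finset.sum_bij (fun σ _ => List.ofFn (permWord σ)) ?_ ?_ ?_ ?_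
  · intro σ _
    rw [mem_lsArr, List.nodup_ofFn]
    refine ⟨fun i j h => σ.injective (Fin.ext h), fun x => ?_⟩
    rw [List.mem_ofFn, Finset.mem_range]
    constructor
    · rintro ⟨i, rfl⟩
      exact (σ i).2
    · intro h
      exact ⟨σ.symm ⟨x, h⟩, by simp [permWord]⟩
  · intro σ _ τ _ h
    have := List.ofFn_injective h
    ext i
    exact congrFun this i
  · intro l hl
    have hlen := length_lsArr _ _ hl
    rw [Finset.card_range] at hlen
    obtain ⟨h1, h2⟩ := (mem_lsArr _ _).1 hl
    subst hlen
    let f : Fin l.length → Fin l.length := fun i => ⟨l.get i, by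
      have := (h2 (l.get i)).1 (List.get_mem l i)
      exact Finset.mem_range.1 this⟩
    have hf : Function.Injective f := by
      intro i j h
      have : l.get i = l.get j := congrArg Fin.val h
      exact h1.injective_get this
    refine ⟨Equiv.ofBijective f (Finite.injective_iff_bijective.1 hf), Finset.mem_univ _, ?_⟩
    exact List.ofFn_get l
  · intro σ _
    rfl

theorem aid_des_gf {q : K} (hq : ∀ n : ℕ, q ^ (n + 1) ≠ 1) (t : K) (n : ℕ) :
    (∑ σ : Equiv.Perm (Fin n), q ^ aidP σ * t ^ desF (permWord σ)) =
      lsb q (t * q) n * qf q n := by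
  rw [← aid_arr hq t n (Finset.range n) n (by simp) (fun x hx => (Finset.mem_range.1 hx).le),
    ← perm_arr]
  refine Finset.sum_congr rfl fun σ _ => ?_
  rw [lsF, aidP, aiW_eq (permWord σ) n (fun i => (σ i).2.le), desF_eq_zero, pow_add, mul_pow]
  ring

end AidGF

theorem ls_main {K : Type*} [Field K] {q : K} (hq : ∀ n : ℕ, q ^ (n + 1) ≠ 1) (t : K) (n : ℕ) :
    (∑ σ : Equiv.Perm (Fin n), q ^ aidP σ * t ^ desF (permWord σ)) =
      ∑ σ : Equiv.Perm (Fin n), q ^ majF (permWord σ) * t ^ excP σ := by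
  rw [aid_des_gf hq, maj_exc_gf hq]

/-- Theorem 6.1 of Linusson–Shareshian–Wachs: the pair of statistics
`(aid, des)` is equidistributed with the pair `(maj, exc)` on the symmetric group `S_n`,
i.e. `∑_{σ ∈ S_n} q^{aid σ} t^{des σ} = ∑_{σ ∈ S_n} q^{maj σ} t^{exc σ}` in `ℤ[q,t]`
(here `q = X 0` and `t = X 1`). -/
theorem statement_9 (n : ℕ) :
    (∑ σ : Equiv.Perm (Fin n),
        (MvPolynomial.X 0 : MvPolynomial (Fin 2) ℤ) ^ aidP σ *
          MvPolynomial.X 1 ^ desF (permWord σ)) =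
      ∑ σ : Equiv.Perm (Fin n),
        (MvPolynomial.X 0 : MvPolynomial (Fin 2) ℤ) ^ majF (permWord σ) *
          MvPolynomial.X 1 ^ excP σ := by
  apply IsFractionRing.injective (MvPolynomial (Fin 2) ℤ) (FractionRing (MvPolynomial (Fin 2) ℤ))
  have hq : ∀ n : ℕ, (algebraMap (MvPolynomial (Fin 2) ℤ) (FractionRing (MvPolynomial (Fin 2) ℤ))
      (MvPolynomial.X 0)) ^ (n + 1) ≠ 1 := by
    intro n h
    rw [← map_pow, ← map_one (algebraMap (MvPolynomial (Fin 2) ℤ)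
      (FractionRing (MvPolynomial (Fin 2) ℤ)))] at h
    have h2 := IsFractionRing.injective (MvPolynomial (Fin 2) ℤ)
      (FractionRing (MvPolynomial (Fin 2) ℤ)) h
    have h3 := congrArg (MvPolynomial.eval (fun _ => (0 : ℤ))) h2
    simp at h3
  have := ls_main hq (algebraMap (MvPolynomial (Fin 2) ℤ)
    (FractionRing (MvPolynomial (Fin 2) ℤ)) (MvPolynomial.X 1)) n
  simpa only [map_sum, map_mul, map_pow] using this
end

section
/- For every n ≥ 0, Σ_{σ ∈ S_n} q^{aid(σ)} = [n]_q! in ℤ[q]; that is, the statistic aid is Mahonian on the symmetric group S_n. -/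
attribute [local instance] Classical.propDecidable

open Polynomial

/-- The q-integer `[m]_q = 1 + q + ⋯ + q^{m-1}`. -/
noncomputable def qInt (m : ℕ) : Polynomial ℤ :=
  ∑ i ∈ Finset.range m, Polynomial.X ^ i

/-- admissible inversions of the first `n` values of `f`. -/
noncomputable def aiN (n : ℕ) (f : ℕ → ℕ) : ℕ :=
  ∑ i ∈ Finset.range n, ∑ j ∈ Finset.range n,
    if (i < j ∧ f j < f i ∧ ((0 < i ∧ f (i - 1) < f i) ∨ ∃ k, i < k ∧ k < j ∧ f i < f k))
      then 1 else 0

noncomputable def desN (n : ℕ) (f : ℕ → ℕ) : ℕ :=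
  ∑ i ∈ Finset.range (n - 1), if f (i + 1) < f i then 1 else 0

lemma aiW_eq_s12 {m : ℕ} (w : Fin m → ℕ) (f : ℕ → ℕ) (h : ∀ i : Fin m, w i = f i) :
    aiW w = aiN m f := by
  unfold aiW aiN
  rw [Finset.card_filter, Fintype.sum_prod_type, Finset.sum_range]
  refine Finset.sum_congr rfl fun i _ => ?_
  rw [Finset.sum_range]
  refine Finset.sum_congr rfl fun j _ => ?_
  have : (∃ k : Fin m, i < k ∧ k < j ∧ w i < w k) ↔
      (∃ k : ℕ, (i : ℕ) < k ∧ k < (j : ℕ) ∧ f i < f k) := by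
    constructor
    · rintro ⟨k, h1, h2, h3⟩
      exact ⟨k, h1, h2, by rwa [← h, ← h]⟩
    · rintro ⟨k, h1, h2, h3⟩
      exact ⟨⟨k, h2.trans j.2⟩, h1, h2, by rwa [h, h]⟩
  simp only [this]
  simp only [h, Fin.lt_def]

lemma desF_eq_s12 {m : ℕ} (w : Fin m → ℕ) (f : ℕ → ℕ) (h : ∀ i : Fin m, w i = f i) :
    desF w = desN m f := by
  unfold desF desN
  rw [Finset.card_filter, Finset.sum_range]
  simp only [h]

lemma desN_split (a b : ℕ) (f : ℕ → ℕ) (h1 : ∀ i < a, f i < f a)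
    (h2 : ∀ j < b, f (a + 1 + j) < f a) :
    desN (a + 1 + b) f = desN a f + desN b (fun j => f (a + 1 + j)) + (if 0 < b then 1 else 0) := by
  unfold desN
  have e : a + 1 + b - 1 = a + b := by omega
  rw [e, Finset.sum_range_add]
  have A : ∑ i ∈ Finset.range a, (if f (i + 1) < f i then 1 else 0) =
      ∑ i ∈ Finset.range (a - 1), (if f (i + 1) < f i then 1 else 0) := by
    rcases a with _ | a
    · simp
    · rw [Finset.sum_range_succ, if_neg (by have := h1 a (by omega); omega)]
      simp
  have B : ∑ i ∈ Finset.range b, (if f (a + i + 1) < f (a + i) then 1 else 0) =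
      ∑ i ∈ Finset.range (b - 1), (if f (a + 1 + (i + 1)) < f (a + 1 + i) then 1 else 0)
        + (if 0 < b then 1 else 0) := by
    rcases b with _ | b
    · simp
    · rw [Finset.sum_range_succ']
      have := h2 0 (by omega)
      simp only [add_zero] at this ⊢
      rw [if_pos this, if_pos (by omega)]
      simp only [Nat.add_sub_cancel]
      congr 1
      refine Finset.sum_congr rfl fun i _ => ?_
      rw [show a + (i + 1) + 1 = a + 1 + (i + 1) by ring, show a + (i + 1) = a + 1 + i by ring]
  rw [A, B, add_assoc]

lemma aiN_split (a b : ℕ) (f : ℕ → ℕ) (h1 : ∀ i < a, f i < f a)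
    (h2 : ∀ j < b, f (a + 1 + j) < f a) :
    aiN (a + 1 + b) f = aiN a f + aiN b (fun j => f (a + 1 + j)) + (if 0 < a then b else 0)
      + ∑ i ∈ Finset.range a, ∑ j ∈ Finset.range b, if f (a + 1 + j) < f i then 1 else 0 := by
  unfold aiN
  rw [Finset.sum_range_add, Finset.sum_range_succ]
  simp only [Finset.sum_range_add, Finset.sum_range_succ, Finset.sum_add_distrib]
  have z1 : ∀ i ∈ Finset.range a, (if (i < a ∧ f a < f i ∧
      ((0 < i ∧ f (i - 1) < f i) ∨ ∃ k, i < k ∧ k < a ∧ f i < f k)) then 1 else 0) = 0 := by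
    intro i hi
    have := h1 i (by simpa using hi)
    exact if_neg (by omega)
  have z2 : ∀ i ∈ Finset.range a, ∀ j ∈ Finset.range b, (if (i < a + 1 + j ∧ f (a + 1 + j) < f i ∧
      ((0 < i ∧ f (i - 1) < f i) ∨ ∃ k, i < k ∧ k < a + 1 + j ∧ f i < f k)) then 1 else 0) =
      if f (a + 1 + j) < f i then 1 else 0 := by
    intro i hi j hj
    have hi : i < a := by simpa using hi
    have := h1 i hi
    refine if_congr ⟨fun h => h.2.1, fun h => ⟨by omega, h, Or.inr ⟨a, hi, by omega, this⟩⟩⟩ rfl rfl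
  have z3 : ∀ j ∈ Finset.range a, (if (a < j ∧ f j < f a ∧
      ((0 < a ∧ f (a - 1) < f a) ∨ ∃ k, a < k ∧ k < j ∧ f a < f k)) then 1 else 0) = 0 := by
    intro i hi
    have : i < a := by simpa using hi
    exact if_neg (by omega)
  have z4 : ∀ j ∈ Finset.range b, (if (a < a + 1 + j ∧ f (a + 1 + j) < f a ∧
      ((0 < a ∧ f (a - 1) < f a) ∨ ∃ k, a < k ∧ k < a + 1 + j ∧ f a < f k)) then 1 else 0) =
      if 0 < a then 1 else 0 := by
    intro j hj
    have hj : j < b := by simpa using hj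
    refine if_congr ⟨?_, fun h => ⟨by omega, h2 j hj, Or.inl ⟨h, h1 _ (by omega)⟩⟩⟩ rfl rfl
    rintro ⟨_, _, h | ⟨k, hk1, hk2, hk3⟩⟩
    · exact h.1
    · have := h2 (k - (a + 1)) (by omega)
      rw [show a + 1 + (k - (a + 1)) = k by omega] at this
      omega
  have z5 : ∀ i ∈ Finset.range b, ∀ j ∈ Finset.range a, (if (a + 1 + i < j ∧ f j < f (a + 1 + i) ∧
      ((0 < a + 1 + i ∧ f (a + 1 + i - 1) < f (a + 1 + i)) ∨
        ∃ k, a + 1 + i < k ∧ k < j ∧ f (a + 1 + i) < f k)) then 1 else 0) = 0 := by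
    intro i _ j hj
    have : j < a := by simpa using hj
    exact if_neg (by omega)
  have z6 : ∀ i ∈ Finset.range b, (if (a + 1 + i < a ∧ f a < f (a + 1 + i) ∧
      ((0 < a + 1 + i ∧ f (a + 1 + i - 1) < f (a + 1 + i)) ∨
        ∃ k, a + 1 + i < k ∧ k < a ∧ f (a + 1 + i) < f k)) then 1 else 0) = 0 := by
    intro i _
    exact if_neg (by omega)
  have z7 : ∀ i ∈ Finset.range b, ∀ j ∈ Finset.range b,
      (if (a + 1 + i < a + 1 + j ∧ f (a + 1 + j) < f (a + 1 + i) ∧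
      ((0 < a + 1 + i ∧ f (a + 1 + i - 1) < f (a + 1 + i)) ∨
        ∃ k, a + 1 + i < k ∧ k < a + 1 + j ∧ f (a + 1 + i) < f k)) then 1 else 0) =
      if (i < j ∧ f (a + 1 + j) < f (a + 1 + i) ∧
        ((0 < i ∧ f (a + 1 + (i - 1)) < f (a + 1 + i)) ∨
        ∃ k, i < k ∧ k < j ∧ f (a + 1 + i) < f (a + 1 + k))) then 1 else 0 := by
    intro i hi j hj
    have hi : i < b := by simpa using hi
    have e : (∃ k, a + 1 + i < k ∧ k < a + 1 + j ∧ f (a + 1 + i) < f k) ↔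
        ∃ k, i < k ∧ k < j ∧ f (a + 1 + i) < f (a + 1 + k) := by
      constructor
      · rintro ⟨k, q1, q2, q3⟩
        refine ⟨k - (a + 1), by omega, by omega, ?_⟩
        rwa [show a + 1 + (k - (a + 1)) = k by omega]
      · rintro ⟨k, q1, q2, q3⟩
        exact ⟨a + 1 + k, by omega, by omega, q3⟩
    have e' : (0 < a + 1 + i ∧ f (a + 1 + i - 1) < f (a + 1 + i)) ↔
        (0 < i ∧ f (a + 1 + (i - 1)) < f (a + 1 + i)) := by
      rcases i with _ | i
      · have := h2 0 hi
        simp only [add_zero, Nat.add_sub_cancel] at this ⊢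
        omega
      · rw [show a + 1 + (i + 1) - 1 = a + 1 + (i + 1 - 1) by omega]
        simp
    refine if_congr ?_ rfl rfl
    rw [e, e']
    simp
  have z8 : (if (a < a ∧ f a < f a ∧
      ((0 < a ∧ f (a - 1) < f a) ∨ ∃ k, a < k ∧ k < a ∧ f a < f k)) then 1 else 0) = 0 :=
    if_neg (by omega)
  rw [Finset.sum_congr rfl z1, Finset.sum_congr rfl (fun i hi => Finset.sum_congr rfl (z2 i hi)),
    Finset.sum_congr rfl z3, Finset.sum_congr rfl z4,
    Finset.sum_congr rfl (fun i hi => Finset.sum_congr rfl (z5 i hi)),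
    Finset.sum_congr rfl z6, Finset.sum_congr rfl (fun i hi => Finset.sum_congr rfl (z7 i hi)), z8]
  simp only [Finset.sum_const_zero, Finset.sum_const, Finset.card_range, smul_eq_mul]
  have : b * (if 0 < a then 1 else 0) = if 0 < a then b else 0 := by split_ifs <;> simp
  rw [this]
  ring

/-- `aid` of a list. -/
noncomputable def aidL (l : List ℕ) : ℕ :=
  aiN l.length (fun i => l.getD i 0) + desN l.length (fun i => l.getD i 0)

lemma aiN_congr {n : ℕ} {f g : ℕ → ℕ} (h : ∀ i < n, f i = g i) : aiN n f = aiN n g := by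
  rw [← aiW_eq_s12 (fun i : Fin n => f i) f (fun _ => rfl),
    ← aiW_eq_s12 (fun i : Fin n => f i) g (fun i => h i i.2)]

lemma desN_congr {n : ℕ} {f g : ℕ → ℕ} (h : ∀ i < n, f i = g i) : desN n f = desN n g := by
  rw [← desF_eq_s12 (fun i : Fin n => f i) f (fun _ => rfl),
    ← desF_eq_s12 (fun i : Fin n => f i) g (fun i => h i i.2)]

noncomputable def cross (S T : Finset ℕ) : ℕ := ∑ t ∈ S, ∑ s ∈ T, if s < t then 1 else 0

lemma sum_list (S : Finset ℕ) (l : List ℕ) (h : S.val = (l : Multiset ℕ)) (F : ℕ → ℕ) :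
    ∑ i ∈ Finset.range l.length, F (l.getD i 0) = ∑ s ∈ S, F s := by
  have : ∑ s ∈ S, F s = (l.map F).sum := by
    rw [Finset.sum_eq_multiset_sum, h]; simp
  rw [this, Finset.sum_range, ← List.sum_ofFn]
  congr 1
  apply List.ext_getElem <;> simp

def eE (a b : ℕ) : ℕ := (if 0 < a then b else 0) + (if 0 < b then 1 else 0)

lemma aidL_split (T U : Finset ℕ) (u v : List ℕ) (M : ℕ) (hu : T.val = (u : Multiset ℕ))
    (hv : U.val = (v : Multiset ℕ)) (hT : ∀ x ∈ T, x < M) (hU : ∀ x ∈ U, x < M) :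
    aidL (u ++ M :: v) = aidL u + aidL v + eE T.card U.card + cross T U := by
  have cu : T.card = u.length := by rw [Finset.card, hu]; simp
  have cv : U.card = v.length := by rw [Finset.card, hv]; simp
  have mu : ∀ x ∈ u, x < M := fun x hx => hT x (by rw [← Finset.mem_val, hu]; simpa using hx)
  have mv : ∀ x ∈ v, x < M := fun x hx => hU x (by rw [← Finset.mem_val, hv]; simpa using hx)
  have len : (u ++ M :: v).length = u.length + 1 + v.length := by simp; omega
  set f : ℕ → ℕ := fun i => (u ++ M :: v).getD i 0 with hf
  have fu : ∀ i < u.length, f i = u.getD i 0 := by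
    intro i hi
    simp only [hf]
    rw [List.getD_append _ _ _ _ hi]
  have fM : f u.length = M := by simp [hf]
  have fv : ∀ j, f (u.length + 1 + j) = v.getD j 0 := by
    intro j
    simp only [hf]
    rw [List.getD_append_right _ _ _ _ (by omega),
      show u.length + 1 + j - u.length = j + 1 by omega, List.getD_cons_succ]
  have h1 : ∀ i < u.length, f i < f u.length := by
    intro i hi
    rw [fM, fu i hi, List.getD_eq_getElem _ _ hi]
    exact mu _ (List.getElem_mem _)
  have h2 : ∀ j < v.length, f (u.length + 1 + j) < f u.length := by
    intro i hi
    rw [fM, fv i, List.getD_eq_getElem _ _ hi]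
    exact mv _ (List.getElem_mem _)
  have hc : ∑ i ∈ Finset.range u.length, ∑ j ∈ Finset.range v.length,
      (if f (u.length + 1 + j) < f i then 1 else 0) = cross T U := by
    unfold cross
    rw [← sum_list T u hu]
    refine Finset.sum_congr rfl fun i hi => ?_
    rw [← sum_list U v hv]
    refine Finset.sum_congr rfl fun j _ => ?_
    rw [fv, fu i (by simpa using hi)]
  unfold aidL
  rw [len, aiN_split _ _ f h1 h2, desN_split _ _ f h1 h2, hc, aiN_congr fu, desN_congr fu,
    aiN_congr (fun j _ => fv j), desN_congr (fun j _ => fv j), eE, cu, cv]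
  ring

noncomputable def qF (n : ℕ) : Polynomial ℤ := ∏ m ∈ Finset.range n, qInt (m + 1)

lemma qF_succ (n : ℕ) : qF (n + 1) = qF n * qInt (n + 1) := Finset.prod_range_succ _ _

lemma qInt_add (a b : ℕ) : qInt (a + b) = qInt a + X ^ a * qInt b := by
  simp [qInt, Finset.sum_range_add, Finset.mul_sum, pow_add]

noncomputable def gB (S : Finset ℕ) (k : ℕ) : Polynomial ℤ :=
  ∑ T ∈ S.powersetCard k, X ^ cross T (S \ T)

lemma cross_insert_right (T U : Finset ℕ) (M : ℕ) (hT : ∀ x ∈ T, x < M) (hM : M ∉ U) :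
    cross T (insert M U) = cross T U := by
  unfold cross
  refine Finset.sum_congr rfl fun t ht => ?_
  rw [Finset.sum_insert hM, if_neg (by have := hT t ht; omega), zero_add]

lemma cross_insert_left (T U : Finset ℕ) (M : ℕ) (hU : ∀ x ∈ U, x < M) (hM : M ∉ T) :
    cross (insert M T) U = U.card + cross T U := by
  unfold cross
  rw [Finset.sum_insert hM, Finset.sum_congr rfl (fun s hs => if_pos (hU s hs))]
  simp

lemma gB_insert (S : Finset ℕ) (M : ℕ) (hS : ∀ x ∈ S, x < M) (k : ℕ) (hk : k ≤ S.card) :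
    gB (insert M S) (k + 1) = gB S (k + 1) + X ^ (S.card - k) * gB S k := by
  have hM : M ∉ S := fun h => lt_irrefl _ (hS M h)
  unfold gB
  rw [Finset.powersetCard_succ_insert hM, Finset.sum_union, Finset.sum_image, Finset.mul_sum]
  · congr 1
    · refine Finset.sum_congr rfl fun T hT => ?_
      have hT := (Finset.mem_powersetCard.1 hT).1
      rw [Finset.insert_sdiff_of_notMem _ (fun h => hM (hT h)),
        cross_insert_right _ _ _ (fun x hx => hS x (hT hx)) (by simp [hM])]
    · refine Finset.sum_congr rfl fun T hT => ?_
      obtain ⟨hT, hc⟩ := Finset.mem_powersetCard.1 hT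
      have e : insert M S \ insert M T = S \ T := by
        ext x
        simp only [Finset.mem_sdiff, Finset.mem_insert]
        constructor
        · tauto
        · rintro ⟨h1, h2⟩
          have : x ≠ M := fun h => hM (h ▸ h1)
          tauto
      rw [e, cross_insert_left _ _ _ (fun x hx => hS x (Finset.mem_sdiff.1 hx).1)
        (fun h => hM (hT h)), Finset.card_sdiff_of_subset hT, hc, pow_add]
  · intro T hT U hU h
    have hT := (Finset.mem_powersetCard.1 hT).1
    have hU := (Finset.mem_powersetCard.1 hU).1
    have := congrArg (fun Z => Z.erase M) h
    simpa [Finset.erase_insert (fun h => hM (hT h)), Finset.erase_insert (fun h => hM (hU h))]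
      using this
  · rw [Finset.disjoint_left]
    intro T hT hT'
    obtain ⟨U, _, rfl⟩ := Finset.mem_image.1 hT'
    exact hM ((Finset.mem_powersetCard.1 hT).1 (Finset.mem_insert_self _ _))

lemma gB_zero (S : Finset ℕ) : gB S 0 = 1 := by
  simp [gB, cross]

lemma gB_mul (S : Finset ℕ) : ∀ k ≤ S.card, gB S k * (qF k * qF (S.card - k)) = qF S.card := by
  induction S using Finset.induction_on_max with
  | empty => intro k hk; simp at hk; subst hk; simp [gB_zero, qF]
  | insert M S hS ih =>
    have hM : M ∉ S := fun h => lt_irrefl _ (hS M h)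
    rw [Finset.card_insert_of_notMem hM]
    intro k hk
    rcases k with _ | k
    · simp [gB_zero, qF]
    · rw [gB_insert S M hS k (by omega)]
      have i1 := ih k (by omega)
      rcases Nat.eq_or_lt_of_le (show k ≤ S.card by omega) with h | h
      · have : gB S (k + 1) = 0 := by
          unfold gB; rw [Finset.powersetCard_eq_empty.2 (by omega)]; simp
        subst h
        rw [this]
        simp only [Nat.sub_self, qF_succ] at i1 ⊢
        linear_combination (qInt (S.card + 1)) * i1
      · obtain ⟨d, hd⟩ : ∃ d, S.card = k + 1 + d := ⟨S.card - (k + 1), by omega⟩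
        have i2 := ih (k + 1) (by omega)
        rw [hd] at i1 i2 ⊢
        have a1 : k + 1 + d - k = d + 1 := by omega
        have a2 : k + 1 + d - (k + 1) = d := by omega
        have a3 : k + 1 + d + 1 - (k + 1) = d + 1 := by omega
        rw [a1] at i1
        rw [a2] at i2
        rw [a1, a3, qF_succ (k + 1 + d), show k + 1 + d + 1 = (d + 1) + (k + 1) by ring, qInt_add]
        rw [qF_succ k] at *
        rw [qF_succ d] at *
        linear_combination qInt (d + 1) * i2 + X ^ (d + 1) * qInt (k + 1) * i1

lemma sum_eE (m : ℕ) : ∑ k ∈ Finset.range (m + 1), (X : Polynomial ℤ) ^ eE k (m - k) =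
    qInt (m + 1) := by
  rcases m with _ | m
  · simp [eE, qInt]
  · rw [Finset.sum_range_succ, Finset.sum_range_succ', qInt, Finset.sum_range_succ',
      Finset.sum_range_succ', ← Finset.sum_range_reflect]
    have : ∀ j ∈ Finset.range m, (X : Polynomial ℤ) ^ eE (m - 1 - j + 1) (m + 1 - (m - 1 - j + 1)) =
        X ^ (j + 1 + 1) := by
      intro j hj
      have : j < m := by simpa using hj
      congr 1
      unfold eE
      rw [if_pos (by omega), if_pos (by omega)]
      omega
    rw [Finset.sum_congr rfl this]
    simp [eE]

noncomputable def pL (S : Finset ℕ) : Finset (List ℕ) := S.val.lists.toFinset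

lemma mem_pL (S : Finset ℕ) (l : List ℕ) : l ∈ pL S ↔ S.val = (l : Multiset ℕ) := by
  simp [pL, Multiset.mem_lists_iff]

lemma sum_lists (S : Finset ℕ) (M : ℕ) (hM : M ∉ S) (F : List ℕ → Polynomial ℤ) :
    ∑ l ∈ (pL (insert M S)), F l =
      ∑ T ∈ S.powerset, ∑ u ∈ (pL T), ∑ v ∈ (pL (S \ T)), F (u ++ M :: v) := by
  simp_rw [← Finset.sum_product']
  rw [Finset.sum_sigma']
  symm
  refine Finset.sum_bij (fun p _ => p.2.1 ++ M :: p.2.2) ?_ ?_ ?_ ?_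
  · rintro ⟨T, u, v⟩ h
    simp only [Finset.mem_sigma, Finset.mem_powerset, Finset.mem_product,
      mem_pL] at h ⊢
    obtain ⟨hT, hu, hv⟩ := h
    rw [← Multiset.coe_add, ← Multiset.cons_coe, ← hu, ← hv, Finset.insert_val_of_notMem hM,
      Multiset.add_cons, Finset.sdiff_val, add_tsub_cancel_of_le (Finset.val_le_iff.2 hT)]
  · rintro ⟨T, u, v⟩ h ⟨T', u', v'⟩ h' heq
    simp only [Finset.mem_sigma, Finset.mem_powerset, Finset.mem_product,
      mem_pL] at h h' heq
    obtain ⟨hT, hu, hv⟩ := h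
    obtain ⟨hT', hu', hv'⟩ := h'
    have m1 : M ∉ u := fun hx => hM (hT (by rw [← Finset.mem_val, hu]; simpa using hx))
    have m2 : M ∉ u' := fun hx => hM (hT' (by rw [← Finset.mem_val, hu']; simpa using hx))
    have m3 : M ∉ v := fun hx => hM (Finset.sdiff_subset (s := S) (t := T)
      (by rw [← Finset.mem_val, hv]; simpa using hx))
    have key : u = u' ∧ v = v' := by
      rw [List.append_cons_inj_of_notMem m1 m3] at heq
      exact ⟨heq.1, heq.2.2⟩
    obtain ⟨rfl, rfl⟩ := key
    have : T = T' := Finset.val_injective (hu.trans hu'.symm)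
    subst this
    rfl
  · intro l hl
    simp only [mem_pL] at hl
    have hMl : M ∈ l := by
      rw [← Multiset.mem_coe, ← hl]; simp
    obtain ⟨u, v, rfl⟩ := List.append_of_mem hMl
    rw [← Multiset.coe_add, ← Multiset.cons_coe, Finset.insert_val_of_notMem hM,
      Multiset.add_cons, Multiset.cons_inj_right] at hl
    have nd : (u : Multiset ℕ).Nodup :=
      Multiset.nodup_of_le (hl ▸ Multiset.le_add_right _ _) S.nodup
    refine ⟨⟨⟨(u : Multiset ℕ), nd⟩, u, v⟩, ?_, rfl⟩
    simp only [Finset.mem_sigma, Finset.mem_powerset, Finset.mem_product,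
      mem_pL, Finset.sdiff_val]
    refine ⟨?_, trivial, ?_⟩
    · rw [← Finset.val_le_iff, hl]; exact Multiset.le_add_right _ _
    · rw [hl, add_tsub_cancel_left]
  · intros; rfl

lemma main_lists (n : ℕ) : ∀ S : Finset ℕ, S.card = n →
    ∑ l ∈ (pL S), (X : Polynomial ℤ) ^ aidL l = qF n := by
  induction n using Nat.strong_induction_on with
  | _ n ih =>
    intro S hS
    rcases S.eq_empty_or_nonempty with rfl | hne
    · simp at hS
      subst hS
      have : (pL (∅ : Finset ℕ)) = {[]} := by
        ext l
        simp [mem_pL, eq_comm]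
      rw [this]
      simp [aidL, aiN, desN, qF]
    · obtain ⟨M, S', hlt, rfl⟩ : ∃ M S', (∀ x ∈ S', x < M) ∧ S = insert M S' := by
        refine ⟨S.max' hne, S.erase (S.max' hne), ?_, ?_⟩
        · intro x hx; exact S.lt_max'_of_mem_erase_max' hne hx
        · rw [Finset.insert_erase (S.max'_mem hne)]
      have hM : M ∉ S' := fun h => lt_irrefl _ (hlt M h)
      rw [Finset.card_insert_of_notMem hM] at hS
      subst hS
      rw [sum_lists S' M hM]
      have step : ∀ T ∈ S'.powerset, ∑ u ∈ (pL T), ∑ v ∈ (pL (S' \ T)),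
          (X : Polynomial ℤ) ^ aidL (u ++ M :: v) =
          X ^ eE T.card (S'.card - T.card) * (X ^ cross T (S' \ T) *
            (qF T.card * qF (S'.card - T.card))) := by
        intro T hT
        have hT := Finset.mem_powerset.1 hT
        have c := Finset.card_sdiff_of_subset hT
        have := Finset.card_le_card hT
        rw [← ih T.card (by omega) T rfl, ← ih (S'.card - T.card) (by omega) (S' \ T) c,
          Finset.sum_mul_sum, Finset.mul_sum, Finset.mul_sum]
        refine Finset.sum_congr rfl fun u hu => ?_
        rw [Finset.mul_sum, Finset.mul_sum]
        refine Finset.sum_congr rfl fun v hv => ?_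
        rw [aidL_split T (S' \ T) u v M (by simpa [mem_pL] using hu)
          (by simpa only [mem_pL] using hv)
          (fun x hx => hlt x (hT hx))
          (fun x hx => hlt x (Finset.mem_sdiff.1 hx).1), c]
        ring
      rw [Finset.sum_congr rfl step, Finset.sum_powerset]
      have step2 : ∀ k ∈ Finset.range (S'.card + 1), ∑ T ∈ S'.powersetCard k,
          (X : Polynomial ℤ) ^ eE T.card (S'.card - T.card) * (X ^ cross T (S' \ T) *
            (qF T.card * qF (S'.card - T.card))) = X ^ eE k (S'.card - k) * qF S'.card := by
        intro k hk
        have hk : k ≤ S'.card := by simpa [Nat.lt_succ_iff] using hk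
        rw [← gB_mul S' k hk, gB, Finset.sum_mul, Finset.mul_sum]
        refine Finset.sum_congr rfl fun T hT => ?_
        rw [(Finset.mem_powersetCard.1 hT).2]
      rw [Finset.sum_congr rfl step2, ← Finset.sum_mul, sum_eE, qF_succ, mul_comm]

/-- Proposition 6.3 of Linusson–Shareshian–Wachs: the statistic `aid`
is Mahonian, i.e. `∑_{σ ∈ S_n} q^{aid σ} = [n]_q! = [1]_q [2]_q ⋯ [n]_q` for all `n`. -/
theorem statement_12 (n : ℕ) :
    (∑ σ : Equiv.Perm (Fin n), (Polynomial.X : Polynomial ℤ) ^ aidP σ) =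
      ∏ m ∈ Finset.range n, qInt (m + 1) := by
  change _ = qF n
  rw [← main_lists n (Finset.range n) (by simp)]
  refine Finset.sum_bij (fun σ _ => List.ofFn (permWord σ)) ?_ ?_ ?_ ?_
  · intro σ _
    simp only [mem_pL]
    rw [Multiset.Nodup.ext (Finset.range n).nodup]
    · intro a
      simp only [Finset.mem_val, Finset.mem_range, Multiset.mem_coe, List.mem_ofFn, permWord]
      constructor
      · intro h
        exact ⟨σ.symm ⟨a, h⟩, by simp⟩
      · rintro ⟨i, rfl⟩
        exact (σ i).2
    · rw [Multiset.coe_nodup, List.nodup_ofFn]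
      exact Fin.val_injective.comp σ.injective
  · intro σ _ τ _ h
    have := List.ofFn_injective h
    ext i
    exact congrFun this i
  · intro l hl
    simp only [mem_pL] at hl
    have len : l.length = n := by
      have := congrArg Multiset.card hl
      simpa using this.symm
    have nd : l.Nodup := by
      rw [← Multiset.coe_nodup, ← hl]; exact (Finset.range n).nodup
    have lt : ∀ x ∈ l, x < n := by
      intro x hx
      rw [← Multiset.mem_coe, ← hl] at hx
      simpa using hx
    subst len
    have inj : Function.Injective
        (fun i : Fin l.length => (⟨l[i], lt _ (List.getElem_mem _)⟩ : Fin l.length)) := by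
      intro i j h
      simp only [Fin.mk.injEq] at h
      exact Fin.ext ((nd.getElem_inj_iff).1 h)
    refine ⟨Equiv.ofBijective _ (Finite.injective_iff_bijective.1 inj), Finset.mem_univ _, ?_⟩
    apply List.ext_getElem
    · simp
    · intro i h1 h2
      simp [permWord]
  · intro σ _
    have hw : ∀ i : Fin n, permWord σ i = (List.ofFn (permWord σ)).getD i 0 := by
      intro i
      simp
    congr 1
    unfold aidP aidL
    rw [aiW_eq_s12 _ (fun i => (List.ofFn (permWord σ)).getD i 0) hw,
      desF_eq_s12 _ (fun i => (List.ofFn (permWord σ)).getD i 0) hw, List.length_ofFn]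
end
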